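/- Let (R, 𝔪) be a local Noetherian ring of dimension d and 𝔞 an ideal. Then Ann_R(H^d_𝔞(R)) = 0 if and only if Ass_R(R) = Att_R(H^d_𝔞(R)). -/

import Mathlib

open CategoryTheory

universe u

/-- `H^i_I(M) ≠ 0`: the `i`-th local cohomology of `M` with respect to `I` is nonzero. -/
abbrev LCNonzero {R : Type u} [CommRing R] (I : Ideal R) (i : ℕ)
    (M : Type u) [AddCommGroup M] [Module R M] : Prop :=
  Nontrivial ((localCohomology I i).obj (ModuleCat.of R M))

/-- Cohomological dimension `cd(I, M) = sup {i : H^i_I(M) ≠ 0}`, as an element of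
`WithBot ℕ∞` (it is `⊥` if all local cohomology of `M` vanishes). -/
noncomputable def cohDim {R : Type u} [CommRing R] (I : Ideal R)
    (M : Type u) [AddCommGroup M] [Module R M] : WithBot ℕ∞ :=
  sSup {n : WithBot ℕ∞ | ∃ i : ℕ, n = (i : ℕ∞) ∧ LCNonzero I i M}

/-- Krull dimension of a module, i.e. the Krull dimension of `R ⧸ Ann_R M`. -/
noncomputable def modDim (R : Type u) [CommRing R]
    (M : Type u) [AddCommGroup M] [Module R M] : WithBot ℕ∞ :=
  ringKrullDim (R ⧸ Module.annihilator R M)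

/-- `p` is an attached prime of `M` if `p` is prime and is the annihilator of some
quotient of `M`. -/
def IsAttachedPrime (R : Type u) [CommRing R] (M : Type u) [AddCommGroup M] [Module R M]
    (p : Ideal R) : Prop :=
  p.IsPrime ∧ ∃ N : Submodule R M, p = Module.annihilator R (M ⧸ N)


set_option autoImplicit false
set_option linter.all false

section fileLC1

namespace LC

open CategoryTheory.Abelian

variable {R : Type u} [CommRing R]

/-- The projection `R/a → R/b` for `a ≤ b`. -/
noncomputable def tr {a b : Ideal R} (h : a ≤ b) :
    ModuleCat.of R (R ⧸ a) ⟶ ModuleCat.of R (R ⧸ b) :=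
  ModuleCat.ofHom (Submodule.factor h)

lemma tr_comp {a b c : Ideal R} (h : a ≤ b) (h' : b ≤ c) :
    tr h ≫ tr h' = tr (h.trans h') := by
  ext
  rfl

lemma tr_id {a : Ideal R} (h : a ≤ a) : tr h = 𝟙 _ := by
  ext
  rfl

/-- precomposition with the projection. -/
noncomputable def pre {a b : Ideal R} (h : a ≤ b) (M : ModuleCat.{u} R) (i : ℕ) :
    Ext (ModuleCat.of R (R ⧸ b)) M i →ₗ[R] Ext (ModuleCat.of R (R ⧸ a)) M i :=
  Ext.precompOfLinear (Ext.mk₀ (tr h)) R M (zero_add i)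

lemma pre_apply {a b : Ideal R} (h : a ≤ b) {M : ModuleCat.{u} R} {i : ℕ}
    (e : Ext (ModuleCat.of R (R ⧸ b)) M i) :
    pre h M i e = (Ext.mk₀ (tr h)).comp e (zero_add i) := rfl

lemma pre_pre {a b c : Ideal R} (h : a ≤ b) (h' : b ≤ c) {M : ModuleCat.{u} R} {i : ℕ}
    (e : Ext (ModuleCat.of R (R ⧸ c)) M i) :
    pre h M i (pre h' M i e) = pre (h.trans h') M i e := by
  simp only [pre_apply]
  rw [Ext.mk₀_comp_mk₀_assoc, tr_comp]

lemma pre_id {a : Ideal R} (h : a ≤ a) {M : ModuleCat.{u} R} {i : ℕ}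
    (e : Ext (ModuleCat.of R (R ⧸ a)) M i) :
    pre h M i e = e := by
  simp [pre_apply, tr_id]

lemma pre_comp {a b : Ideal R} (h : a ≤ b) {M N : ModuleCat.{u} R} {i j k : ℕ}
    (e : Ext (ModuleCat.of R (R ⧸ b)) M i) (f : Ext M N j) (hk : i + j = k) :
    pre h N k (e.comp f hk) = (pre h M i e).comp f hk := by
  simp only [pre_apply]
  rw [Ext.comp_assoc _ _ _ _ _ (by omega)]

/-- transition maps -/
noncomputable def sysMap (a : Ideal R) (M : ModuleCat.{u} R) (i : ℕ) (n m : ℕ) (h : n ≤ m) :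
    Ext (ModuleCat.of R (R ⧸ a ^ n)) M i →ₗ[R] Ext (ModuleCat.of R (R ⧸ a ^ m)) M i :=
  pre (Ideal.pow_le_pow_right h) M i

instance (a : Ideal R) (M : ModuleCat.{u} R) (i : ℕ) :
    DirectedSystem (fun n : ℕ => Ext (ModuleCat.of R (R ⧸ a ^ n)) M i)
      (fun n m h => sysMap a M i n m h) where
  map_self n x := pre_id _ _
  map_map _ _ _ _ _ x := pre_pre _ _ _

/-- Local cohomology as a direct limit of `Ext`. -/
def H (a : Ideal R) (i : ℕ) (M : ModuleCat.{u} R) : Type u :=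
  Module.DirectLimit (fun n : ℕ => Ext (ModuleCat.of R (R ⧸ a ^ n)) M i) (sysMap a M i)

noncomputable instance (a : Ideal R) (i : ℕ) (M : ModuleCat.{u} R) : AddCommGroup (H a i M) :=
  inferInstanceAs (AddCommGroup (Module.DirectLimit
    (fun n : ℕ => Ext (ModuleCat.of R (R ⧸ a ^ n)) M i) (sysMap a M i)))

noncomputable instance (a : Ideal R) (i : ℕ) (M : ModuleCat.{u} R) : Module R (H a i M) :=
  inferInstanceAs (Module R (Module.DirectLimit
    (fun n : ℕ => Ext (ModuleCat.of R (R ⧸ a ^ n)) M i) (sysMap a M i)))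

/-- The class of an extension. -/
noncomputable def mk (a : Ideal R) {i : ℕ} {M : ModuleCat.{u} R} (n : ℕ) :
    Ext (ModuleCat.of R (R ⧸ a ^ n)) M i →ₗ[R] H a i M :=
  Module.DirectLimit.of R ℕ (fun n : ℕ => Ext (ModuleCat.of R (R ⧸ a ^ n)) M i) (sysMap a M i) n

lemma mk_surj {a : Ideal R} {i : ℕ} {M : ModuleCat.{u} R} (h : H a i M) :
    ∃ n e, mk a n e = h := by
  obtain ⟨n, e, rfl⟩ := Module.DirectLimit.exists_of (f := sysMap a M i) h
  exact ⟨n, e, rfl⟩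

lemma mk_pre {a : Ideal R} {i : ℕ} {M : ModuleCat.{u} R} {n m : ℕ} (h : n ≤ m)
    (hle : a ^ m ≤ a ^ n) (e : Ext (ModuleCat.of R (R ⧸ a ^ n)) M i) :
    mk a m (pre hle M i e) = mk a n e :=
  Module.DirectLimit.of_f (f := sysMap a M i) (hij := h)

lemma mk_eq_zero {a : Ideal R} {i : ℕ} {M : ModuleCat.{u} R} {n : ℕ}
    {e : Ext (ModuleCat.of R (R ⧸ a ^ n)) M i} (h : mk a n e = 0) :
    ∃ m, ∃ _ : n ≤ m, ∃ hle : a ^ m ≤ a ^ n, pre hle M i e = 0 := by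
  obtain ⟨m, hm, h⟩ := Module.DirectLimit.of.zero_exact (f := sysMap a M i) h
  exact ⟨m, hm, Ideal.pow_le_pow_right hm, h⟩

/-- Yoneda product. -/
noncomputable def comp (a : Ideal R) {i j k : ℕ} {M N : ModuleCat.{u} R} (f : Ext M N j)
    (hk : i + j = k) : H a i M →ₗ[R] H a k N :=
  Module.DirectLimit.lift R ℕ (fun n : ℕ => Ext (ModuleCat.of R (R ⧸ a ^ n)) M i) (sysMap a M i)
    (fun n => (mk a n).comp (Ext.postcompOfLinear f R _ hk)) (by
    intro n m h e
    change mk a m ((pre _ M i e).comp f hk) = mk a n (e.comp f hk)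
    rw [← pre_comp, mk_pre h])

@[simp] lemma comp_mk {a : Ideal R} {i j k : ℕ} {M N : ModuleCat.{u} R} (f : Ext M N j)
    (hk : i + j = k) (n : ℕ) (e : Ext (ModuleCat.of R (R ⧸ a ^ n)) M i) :
    comp a f hk (mk a n e) = mk a n (e.comp f hk) :=
  Module.DirectLimit.lift_of (f := sysMap a M i) _ _ _

lemma comp_add (a : Ideal R) {i j k : ℕ} {M N : ModuleCat.{u} R} (f g : Ext M N j)
    (hk : i + j = k) (h : H a i M) : comp a (f + g) hk h = comp a f hk h + comp a g hk h := by
  obtain ⟨n, e, rfl⟩ := mk_surj h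
  simp [Ext.comp_add]

lemma comp_smul (a : Ideal R) {i j k : ℕ} {M N : ModuleCat.{u} R} (r : R) (f : Ext M N j)
    (hk : i + j = k) (h : H a i M) : comp a (r • f) hk h = r • comp a f hk h := by
  obtain ⟨n, e, rfl⟩ := mk_surj h
  simp

lemma comp_zero (a : Ideal R) {i j k : ℕ} {M N : ModuleCat.{u} R}
    (hk : i + j = k) (h : H a i M) : comp a (0 : Ext M N j) hk h = 0 := by
  obtain ⟨n, e, rfl⟩ := mk_surj h
  simp

lemma comp_sum (a : Ideal R) {i j k : ℕ} {M N : ModuleCat.{u} R} {ι : Type*} (s : Finset ι)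
    (f : ι → Ext M N j) (hk : i + j = k) (h : H a i M) :
    comp a (∑ x ∈ s, f x) hk h = ∑ x ∈ s, comp a (f x) hk h := by
  classical
  induction s using Finset.induction_on with
  | empty => simp [comp_zero]
  | insert x s hx ih => rw [Finset.sum_insert hx, Finset.sum_insert hx, comp_add, ih]

lemma comp_comp (a : Ideal R) {i j k l m : ℕ} {M N P : ModuleCat.{u} R} (f : Ext M N j)
    (g : Ext N P l) (hk : i + j = k) (hm : k + l = m) {jl : ℕ} (hjl : j + l = jl)
    (him : i + jl = m)
    (h : H a i M) : comp a g hm (comp a f hk h) = comp a (f.comp g hjl) him h := by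
  obtain ⟨n, e, rfl⟩ := mk_surj h
  simp only [comp_mk]
  rw [Ext.comp_assoc _ _ _ _ _ (by omega)]

lemma comp_id (a : Ideal R) {i : ℕ} {M : ModuleCat.{u} R} (h : H a i M) :
    comp a (Ext.mk₀ (𝟙 M)) (add_zero i) h = h := by
  obtain ⟨n, e, rfl⟩ := mk_surj h
  simp

/-- Functoriality. -/
noncomputable def map (a : Ideal R) (i : ℕ) {M N : ModuleCat.{u} R} (f : M ⟶ N) :
    H a i M →ₗ[R] H a i N := comp a (Ext.mk₀ f) (add_zero i)

lemma map_map (a : Ideal R) (i : ℕ) {M N P : ModuleCat.{u} R} (f : M ⟶ N) (g : N ⟶ P)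
    (h : H a i M) : map a i g (map a i f h) = map a i (f ≫ g) h := by
  unfold map
  rw [comp_comp a _ _ _ _ (zero_add 0) (add_zero i), Ext.mk₀_comp_mk₀]

lemma map_id (a : Ideal R) (i : ℕ) {M : ModuleCat.{u} R} (h : H a i M) :
    map a i (𝟙 M) h = h := comp_id a h

lemma map_zero' (a : Ideal R) (i : ℕ) {M N : ModuleCat.{u} R} (h : H a i M) :
    map a i (0 : M ⟶ N) h = 0 := by
  unfold map
  rw [Ext.mk₀_zero, comp_zero]

lemma map_add' (a : Ideal R) (i : ℕ) {M N : ModuleCat.{u} R} (f g : M ⟶ N) (h : H a i M) :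
    map a i (f + g) h = map a i f h + map a i g h := by
  unfold map
  rw [Ext.mk₀_add, comp_add]

lemma map_smul' (a : Ideal R) (i : ℕ) {M N : ModuleCat.{u} R} (r : R) (f : M ⟶ N) (h : H a i M) :
    map a i (r • f) h = r • map a i f h := by
  unfold map
  rw [Ext.mk₀_smul, comp_smul]

/-- Restriction along `a ≤ b`. -/
noncomputable def res {a b : Ideal R} (h : a ≤ b) (i : ℕ) (M : ModuleCat.{u} R) :
    H b i M →ₗ[R] H a i M :=
  Module.DirectLimit.lift R ℕ (fun n : ℕ => Ext (ModuleCat.of R (R ⧸ b ^ n)) M i) (sysMap b M i)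
    (fun n => (mk a n).comp (pre (Ideal.pow_right_mono h n) M i)) (by
    intro n m hnm e
    change mk a m (pre _ M i (pre _ M i e)) = mk a n (pre _ M i e)
    rw [pre_pre, ← mk_pre hnm (Ideal.pow_le_pow_right hnm) (pre _ M i e), pre_pre])

@[simp] lemma res_mk {a b : Ideal R} (h : a ≤ b) {i : ℕ} {M : ModuleCat.{u} R} (n : ℕ)
    (e : Ext (ModuleCat.of R (R ⧸ b ^ n)) M i) :
    res h i M (mk b n e) = mk a n (pre (Ideal.pow_right_mono h n) M i e) :=
  Module.DirectLimit.lift_of (f := sysMap b M i) _ _ _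

lemma res_comp {a b : Ideal R} (hab : a ≤ b) {i j k : ℕ} {M N : ModuleCat.{u} R} (f : Ext M N j)
    (hk : i + j = k) (h : H b i M) :
    res hab k N (comp b f hk h) = comp a f hk (res hab i M h) := by
  obtain ⟨n, e, rfl⟩ := mk_surj h
  simp [pre_comp]

lemma res_res {a b c : Ideal R} (hab : a ≤ b) (hbc : b ≤ c) {i : ℕ} {M : ModuleCat.{u} R}
    (h : H c i M) : res hab i M (res hbc i M h) = res (hab.trans hbc) i M h := by
  obtain ⟨n, e, rfl⟩ := mk_surj h
  simp [pre_pre]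

lemma res_map {a b : Ideal R} (hab : a ≤ b) {i : ℕ} {M N : ModuleCat.{u} R} (f : M ⟶ N)
    (h : H b i M) :
    res hab i N (map b i f h) = map a i f (res hab i M h) := res_comp hab _ _ h

section exact

variable {S : ShortComplex (ModuleCat.{u} R)} (hS : S.ShortExact) (a : Ideal R)

/-- connecting map -/
noncomputable def δ {i k : ℕ} (hk : i + 1 = k) : H a i S.X₃ →ₗ[R] H a k S.X₁ :=
  comp a hS.extClass hk

lemma res_δ {a b : Ideal R} (hab : a ≤ b) {i k : ℕ} (hk : i + 1 = k) (h : H b i S.X₃) :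
    res hab k _ (δ hS b hk h) = δ hS a hk (res hab i _ h) := res_comp hab _ _ h

lemma exact₂ {S : ShortComplex (ModuleCat.{u} R)} (hS : S.ShortExact) (a : Ideal R)
    {i : ℕ} {h : H a i S.X₂} (h0 : map a i S.g h = 0) :
    ∃ h', map a i S.f h' = h := by
  obtain ⟨n, e, rfl⟩ := mk_surj h
  rw [map, comp_mk] at h0
  obtain ⟨m, hm, hle, h0⟩ := mk_eq_zero h0
  rw [pre_comp] at h0
  obtain ⟨e', he'⟩ := Ext.covariant_sequence_exact₂ _ hS _ h0
  exact ⟨mk a m e', by rw [map, comp_mk, he', mk_pre hm]⟩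

lemma exact₃ {i k : ℕ} (hk : i + 1 = k) {h : H a i S.X₃} (h0 : δ hS a hk h = 0) :
    ∃ h', map a i S.g h' = h := by
  obtain ⟨n, e, rfl⟩ := mk_surj h
  rw [δ, comp_mk] at h0
  obtain ⟨m, hm, hle, h0⟩ := mk_eq_zero h0
  rw [pre_comp] at h0
  obtain ⟨e', he'⟩ := Ext.covariant_sequence_exact₃ _ hS _ hk h0
  exact ⟨mk a m e', by rw [map, comp_mk, he', mk_pre hm]⟩

lemma exact₁ {i k : ℕ} (hk : i + 1 = k) {h : H a k S.X₁} (h0 : map a k S.f h = 0) :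
    ∃ h', δ hS a hk h' = h := by
  obtain ⟨n, e, rfl⟩ := mk_surj h
  rw [map, comp_mk] at h0
  obtain ⟨m, hm, hle, h0⟩ := mk_eq_zero h0
  rw [pre_comp] at h0
  obtain ⟨e', he'⟩ := Ext.covariant_sequence_exact₁ _ hS _ h0 hk
  exact ⟨mk a m e', by rw [δ, comp_mk, he', mk_pre hm]⟩

lemma map_g_f {i : ℕ} (h : H a i S.X₁) : map a i S.g (map a i S.f h) = 0 := by
  rw [map_map, S.zero, map_zero']

lemma δ_map_g {i k : ℕ} (hk : i + 1 = k) (h : H a i S.X₂) : δ hS a hk (map a i S.g h) = 0 := by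
  rw [δ, map, comp_comp a _ _ _ _ (zero_add 1) hk, hS.comp_extClass, comp_zero]

lemma map_f_δ {i k : ℕ} (hk : i + 1 = k) (h : H a i S.X₃) : map a k S.f (δ hS a hk h) = 0 := by
  rw [δ, map, comp_comp a _ _ _ _ (add_zero 1) hk, hS.extClass_comp, comp_zero]

end exact

lemma H_injective (a : Ideal R) {i : ℕ} (hi : 0 < i) (M : ModuleCat.{u} R) [Injective M]
    (h : H a i M) : h = 0 := by
  obtain ⟨n, e, rfl⟩ := mk_surj h
  obtain ⟨j, rfl⟩ := Nat.exists_eq_succ_of_ne_zero hi.ne'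
  rw [e.eq_zero_of_injective, _root_.map_zero]

lemma H_torsion (a : Ideal R) {i : ℕ} {M : ModuleCat.{u} R} (h : H a i M) :
    ∃ n, ∀ r ∈ a ^ n, r • h = 0 := by
  obtain ⟨n, e, rfl⟩ := mk_surj h
  refine ⟨n, fun r hr => ?_⟩
  have h0 : r • 𝟙 (ModuleCat.of R (R ⧸ a ^ n)) = 0 := by
    ext
    exact Ideal.Quotient.eq_zero_iff_mem.2 (by simpa using hr)
  have : r • e = (Ext.mk₀ (r • 𝟙 _)).comp e (zero_add i) := by
    rw [Ext.mk₀_smul]; simp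
  rw [← map_smul, this, h0]
  simp

/-- Degree zero: evaluate at one. -/
noncomputable def ev (a : Ideal R) (M : ModuleCat.{u} R) : H a 0 M →ₗ[R] M :=
  Module.DirectLimit.lift R ℕ (fun n : ℕ => Ext (ModuleCat.of R (R ⧸ a ^ n)) M 0) (sysMap a M 0)
    (fun n => { toFun := fun e => (Ext.linearEquiv₀ (R := R) e).hom (1 : R ⧸ a ^ n)
                map_add' := by intros; simp
                map_smul' := by intros; simp })
    (by
      intro n m h e
      obtain ⟨f, rfl⟩ := (Ext.mk₀_bijective _ _).2 e
      have : sysMap a M 0 n m h (Ext.mk₀ f) = Ext.mk₀ (tr (Ideal.pow_le_pow_right h) ≫ f) := by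
        change pre _ M 0 _ = _
        rw [pre_apply, Ext.mk₀_comp_mk₀]
      rw [this]
      have hz : ∀ {X : ModuleCat.{u} R} (g : X ⟶ M), Ext.linearEquiv₀ (R := R) (Ext.mk₀ g) = g :=
        fun g => (Ext.mk₀_bijective _ _).1 (by simp)
      simp only [hz, LinearMap.coe_mk, AddHom.coe_mk]
      rfl)

lemma ev_mk (a : Ideal R) {M : ModuleCat.{u} R} (n : ℕ) (f : ModuleCat.of R (R ⧸ a ^ n) ⟶ M) :
    ev a M (mk a n (Ext.mk₀ f)) = f.hom (1 : R ⧸ a ^ n) := by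
  have hz : Ext.linearEquiv₀ (R := R) (Ext.mk₀ f) = f :=
    (Ext.mk₀_bijective _ _).1 (by simp)
  refine (Module.DirectLimit.lift_of (f := sysMap a M 0) _ _ _).trans ?_
  simp only [LinearMap.coe_mk, AddHom.coe_mk, hz]

lemma ev_inj (a : Ideal R) {M : ModuleCat.{u} R} : Function.Injective (ev a M) := by
  rw [injective_iff_map_eq_zero]
  intro h h0
  obtain ⟨n, e, rfl⟩ := mk_surj h
  obtain ⟨f, rfl⟩ := (Ext.mk₀_bijective _ _).2 e
  rw [ev_mk] at h0
  have : f = 0 := by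
    ext
    exact h0
  rw [this]
  simp

lemma ev_map (a : Ideal R) {M N : ModuleCat.{u} R} (g : M ⟶ N) (h : H a 0 M) :
    ev a N (map a 0 g h) = g.hom (ev a M h) := by
  obtain ⟨n, e, rfl⟩ := mk_surj h
  obtain ⟨f, rfl⟩ := (Ext.mk₀_bijective _ _).2 e
  rw [map, comp_mk, Ext.mk₀_comp_mk₀, ev_mk, ev_mk]
  rfl

lemma ev_res {a b : Ideal R} (hab : a ≤ b) {M : ModuleCat.{u} R} (h : H b 0 M) :
    ev a M (res hab 0 M h) = ev b M h := by
  obtain ⟨n, e, rfl⟩ := mk_surj h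
  obtain ⟨f, rfl⟩ := (Ext.mk₀_bijective _ _).2 e
  rw [res_mk, pre_apply, Ext.mk₀_comp_mk₀, ev_mk, ev_mk]
  rfl

lemma ev_surj (a : Ideal R) {M : ModuleCat.{u} R} (m : M) (n : ℕ) (hm : ∀ r ∈ a ^ n, r • m = 0) :
    ∃ h, ev a M h = m := by
  refine ⟨mk a n (Ext.mk₀ (ModuleCat.ofHom
    (Submodule.liftQ (a ^ n) (LinearMap.toSpanSingleton R M m) ?_))), ?_⟩
  · intro r hr
    rw [LinearMap.mem_ker, LinearMap.toSpanSingleton_apply]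
    exact hm r hr
  · rw [ev_mk]
    exact (Submodule.liftQ_apply _ _ _).trans (one_smul R m)

lemma ev_torsion (a : Ideal R) {M : ModuleCat.{u} R} (h : H a 0 M) :
    ∃ n, ∀ r ∈ a ^ n, r • ev a M h = 0 := by
  obtain ⟨n, hn⟩ := H_torsion a h
  exact ⟨n, fun r hr => by rw [← map_smul, hn r hr, _root_.map_zero]⟩

end LC

end fileLC1

section fileLC2

namespace LC

open CategoryTheory.Abelian

variable {R : Type u} [CommRing R]

section ses

variable {A B C : Type u} [AddCommGroup A] [Module R A] [AddCommGroup B] [Module R B]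
  [AddCommGroup C] [Module R C]

/-- short complex from linear maps -/
abbrev sc (f : A →ₗ[R] B) (g : B →ₗ[R] C) (h : Function.Exact f g) :
    ShortComplex (ModuleCat.{u} R) :=
  ShortComplex.mk (ModuleCat.ofHom f) (ModuleCat.ofHom g) (by
    ext x
    exact h.apply_apply_eq_zero x)

lemma sc_exact (f : A →ₗ[R] B) (g : B →ₗ[R] C) (h : Function.Exact f g)
    (hf : Function.Injective f) (hg : Function.Surjective g) : (sc f g h).ShortExact := by
  refine ShortComplex.ShortExact.mk' ?_ ?_ ?_
  · exact (ShortComplex.ShortExact.moduleCat_exact_iff_function_exact _).2 h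
  · exact (ModuleCat.mono_iff_injective _).2 hf
  · exact (ModuleCat.epi_iff_surjective _).2 hg

end ses

/-- torsion submodule -/
def tors (c : Ideal R) (M : Type u) [AddCommGroup M] [Module R M] : Submodule R M where
  carrier := {m | ∃ n : ℕ, ∀ r ∈ c ^ n, r • m = 0}
  zero_mem' := ⟨0, by simp⟩
  add_mem' := by
    rintro x y ⟨n, hn⟩ ⟨k, hk⟩
    refine ⟨n + k, fun r hr => ?_⟩
    rw [smul_add, hn r (Ideal.pow_le_pow_right (by omega) hr),
      hk r (Ideal.pow_le_pow_right (by omega) hr), add_zero]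
  smul_mem' := by
    rintro s x ⟨n, hn⟩
    exact ⟨n, fun r hr => by rw [smul_comm, hn r hr, smul_zero]⟩

/-- every element is killed by a power of `c` -/
def IsTors (c : Ideal R) (M : Type u) [AddCommGroup M] [Module R M] : Prop :=
  ∀ m : M, ∃ n : ℕ, ∀ r ∈ c ^ n, r • m = 0

lemma isTors_tors (c : Ideal R) (M : Type u) [AddCommGroup M] [Module R M] :
    IsTors c (tors c M) := by
  rintro ⟨m, n, hn⟩
  exact ⟨n, fun r hr => Subtype.ext (hn r hr)⟩

lemma IsTors.of_surj {c : Ideal R} {M N : Type u} [AddCommGroup M] [Module R M]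
    [AddCommGroup N] [Module R N] (h : IsTors c M) (f : M →ₗ[R] N) (hf : Function.Surjective f) :
    IsTors c N := by
  intro x
  obtain ⟨m, rfl⟩ := hf x
  obtain ⟨n, hn⟩ := h m
  exact ⟨n, fun r hr => by rw [← map_smul, hn r hr, map_zero]⟩

lemma IsTors.of_inj {c : Ideal R} {M N : Type u} [AddCommGroup M] [Module R M]
    [AddCommGroup N] [Module R N] (h : IsTors c N) (f : M →ₗ[R] N) (hf : Function.Injective f) :
    IsTors c M := by
  intro x
  obtain ⟨n, hn⟩ := h (f x)
  exact ⟨n, fun r hr => hf (by rw [map_smul, hn r hr, map_zero])⟩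

/-- A finite torsion module is killed by a power. -/
lemma IsTors.exists_pow {c : Ideal R} {M : Type u} [AddCommGroup M] [Module R M]
    [Module.Finite R M] (h : IsTors c M) : ∃ n : ℕ, ∀ r ∈ c ^ n, ∀ m : M, r • m = 0 := by
  obtain ⟨s, hs⟩ := (Module.Finite.fg_top : (⊤ : Submodule R M).FG)
  choose n hn using h
  refine ⟨s.sup n, fun r hr m => ?_⟩
  have hm : m ∈ Submodule.span R (s : Set M) := hs ▸ Submodule.mem_top
  induction hm using Submodule.span_induction with
  | mem x hx => exact hn x r (Ideal.pow_le_pow_right (Finset.le_sup hx) hr)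
  | zero => simp
  | add x y _ _ hx hy => rw [smul_add, hx, hy, add_zero]
  | smul t x _ hx => rw [smul_comm, hx, smul_zero]

lemma tors_injective [IsNoetherianRing R] (c : Ideal R) (I : Type u) [AddCommGroup I] [Module R I]
    [hI : Module.Injective R I] : Module.Injective R (tors c I) := by
  refine Module.Baer.injective ?_
  intro J g
  -- a power of `c` kills the image
  have hfin : IsTors c (LinearMap.range g) := (isTors_tors c I).of_inj (LinearMap.range g).subtype
    Subtype.val_injective
  obtain ⟨n, hn⟩ := hfin.exists_pow
  have hn' : ∀ r ∈ c ^ n, ∀ x : J, g (r • x) = 0 := by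
    intro r hr x
    have := hn r hr ⟨g x, x, rfl⟩
    rw [map_smul]
    exact congrArg Subtype.val this
  obtain ⟨k, hk⟩ := Ideal.exists_pow_inf_eq_pow_smul c (J : Submodule R R)
  have hJ : ∀ x : J, (x : R) ∈ c ^ (n + k) → g x = 0 := by
    intro x hx
    have h1 : (x : R) ∈ (c ^ (n + k) • (⊤ : Submodule R R)) ⊓ J := by
      refine ⟨?_, x.2⟩
      simpa using hx
    rw [hk (n + k) (by omega)] at h1
    have h2 : (x : R) ∈ (c ^ n • J : Ideal R) := by
      rw [show n + k - k = n by omega] at h1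
      exact Submodule.smul_mono le_rfl inf_le_right h1
    have h3 : ∀ y ∈ (c ^ n • J : Ideal R), ∃ hy : y ∈ J, g ⟨y, hy⟩ = 0 := by
      intro y hy
      refine Submodule.smul_induction_on hy ?_ ?_
      · intro r hr z hz
        exact ⟨J.mul_mem_left _ hz, hn' r hr ⟨z, hz⟩⟩
      · rintro y z ⟨hy, hy'⟩ ⟨hz, hz'⟩
        refine ⟨J.add_mem hy hz, ?_⟩
        have := g.map_add ⟨y, hy⟩ ⟨z, hz⟩
        rw [hy', hz', add_zero] at this
        exact this
    exact (h3 _ h2).2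
  -- factor through `R / c^(n+k)`
  let q : R →ₗ[R] R ⧸ c ^ (n + k) := Submodule.mkQ _
  let j : J →ₗ[R] R ⧸ c ^ (n + k) := q.comp (Submodule.subtype J)
  have hker : LinearMap.ker j ≤ LinearMap.ker g := by
    intro x hx
    exact hJ x ((Submodule.Quotient.mk_eq_zero _).1 hx)
  let g' : (J ⧸ LinearMap.ker j) →ₗ[R] I := (Submodule.liftQ _ ((tors c I).subtype.comp g) (by
    intro x hx
    have := hker hx
    rw [LinearMap.mem_ker] at this
    rw [LinearMap.mem_ker, LinearMap.comp_apply, this, map_zero]))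
  obtain ⟨F, hF⟩ := hI.out (Submodule.liftQ _ j le_rfl)
    (by
      rw [← LinearMap.ker_eq_bot]
      exact Submodule.ker_liftQ_eq_bot _ _ _ le_rfl) g'
  have hFt : ∀ r : R, F (q r) ∈ tors c I := by
    intro r
    refine ⟨n + k, fun s hs => ?_⟩
    rw [← map_smul, ← map_smul]
    have : q (s • r) = 0 := (Submodule.Quotient.mk_eq_zero _).2 (Ideal.mul_mem_right _ _ hs)
    rw [this, map_zero]
  refine ⟨LinearMap.codRestrict _ (F.comp q) hFt, fun x hx => ?_⟩
  apply Subtype.ext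
  have := hF (Submodule.Quotient.mk ⟨x, hx⟩)
  exact this

lemma exists_tors_injective [IsNoetherianRing R] (c : Ideal R) (G : ModuleCat.{u} R)
    (hG : IsTors c G) : ∃ (S : ShortComplex (ModuleCat.{u} R)) (_ : S.ShortExact), S.X₁ = G ∧
      Injective S.X₂ ∧ IsTors c S.X₂ ∧ IsTors c S.X₃ := by
  let I := Injective.under G
  have hI0 : Injective (ModuleCat.of R I) := (inferInstance : Injective (Injective.under G))
  have : Module.Injective R I := (Module.injective_iff_injective_object R I).2 hI0
  have := tors_injective c I
  have hinj : Function.Injective (Injective.ι G).hom := (ModuleCat.mono_iff_injective _).1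
    inferInstance
  let f : G →ₗ[R] tors c I := LinearMap.codRestrict _ (Injective.ι G).hom (by
    intro x
    obtain ⟨n, hn⟩ := hG x
    exact ⟨n, fun r hr => by rw [← map_smul, hn r hr, _root_.map_zero]⟩)
  have hf : Function.Injective f := by
    intro x y h
    exact hinj (congrArg Subtype.val h)
  refine ⟨sc f (LinearMap.range f).mkQ (LinearMap.exact_map_mkQ_range f), sc_exact _ _ _ hf
    (Submodule.mkQ_surjective _), rfl, ?_, isTors_tors c I, ?_⟩
  · exact (Module.injective_iff_injective_object R (tors c I)).1 inferInstance
  · exact (isTors_tors c I).of_surj _ (Submodule.mkQ_surjective _)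

lemma res_bij [IsNoetherianRing R] {a b c : Ideal R} (hab : a ≤ b) {N : ℕ} (hN : b ^ N ≤ a ⊔ c)
    (i : ℕ) (G : ModuleCat.{u} R) (hG : IsTors c G) : Function.Bijective (res hab i G) := by
  induction i generalizing G with
  | zero =>
    constructor
    · intro x y h
      apply ev_inj b
      rw [← ev_res hab, ← ev_res hab, h]
    · intro h
      obtain ⟨n, hn⟩ := ev_torsion a h
      obtain ⟨k, hk⟩ := hG (ev a G h)
      obtain ⟨h', hh'⟩ := ev_surj b (ev a G h) (N * (n + k)) (by
        intro r hr
        have h1 : r ∈ a ^ n ⊔ c ^ k := by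
          rw [pow_mul] at hr
          exact Ideal.sup_pow_add_le_pow_sup_pow (Ideal.pow_right_mono hN _ hr)
        obtain ⟨s, hs, t, ht, rfl⟩ := Submodule.mem_sup.1 h1
        rw [add_smul, hn s hs, hk t ht, add_zero])
      refine ⟨h', ev_inj a ?_⟩
      rw [ev_res, hh']
  | succ i ih =>
    obtain ⟨S, hS, rfl, hI, h2, h3⟩ := exists_tors_injective c G hG
    have key : ∀ (e : Ideal R) (h : H e (i + 1) S.X₁), ∃ h', δ hS e rfl h' = h := by
      intro e h
      exact exact₁ hS e rfl (H_injective e (Nat.succ_pos i) _ _)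
    constructor
    · rw [injective_iff_map_eq_zero]
      intro h h0
      obtain ⟨h', rfl⟩ := key b h
      rw [res_δ] at h0
      obtain ⟨j, hj⟩ := exact₃ hS a rfl h0
      obtain ⟨j', rfl⟩ := (ih S.X₂ h2).2 j
      rw [← res_map] at hj
      rw [← (ih S.X₃ h3).1 hj, δ_map_g]
    · intro h
      obtain ⟨h', rfl⟩ := key a h
      obtain ⟨h'', rfl⟩ := (ih S.X₃ h3).2 h'
      exact ⟨δ hS b rfl h'', res_δ hS hab rfl h''⟩

lemma H_tors_eq_zero [IsNoetherianRing R] {a : Ideal R} {i : ℕ} (hi : 0 < i) (G : ModuleCat.{u} R)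
    (hG : IsTors a G) (h : H a i G) : h = 0 := by
  induction i generalizing G with
  | zero => omega
  | succ i ih =>
    obtain ⟨S, hS, rfl, hI, h2, h3⟩ := exists_tors_injective a G hG
    obtain ⟨h', rfl⟩ := exact₁ hS a rfl (h := h) (H_injective a (Nat.succ_pos i) _ _)
    have : ∃ j, map a i S.g j = h' := by
      rcases Nat.eq_zero_or_pos i with rfl | hpos
      · have : Epi S.g := hS.epi_g
        obtain ⟨m, hm⟩ := (ModuleCat.epi_iff_surjective S.g).1 inferInstance (ev a _ h')
        obtain ⟨n, hn⟩ := h2 m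
        obtain ⟨j, hj⟩ := ev_surj a m n hn
        refine ⟨j, ev_inj a ?_⟩
        rw [ev_map, hj]
        exact hm
      · exact ⟨0, by rw [_root_.map_zero]; exact (ih hpos _ h3 _).symm⟩
    obtain ⟨j, rfl⟩ := this
    rw [δ_map_g]

end LC

end fileLC2

section fileLC3

namespace LC

open CategoryTheory.Abelian

variable {R : Type u} [CommRing R]

lemma map_lsmul (a : Ideal R) (i : ℕ) {M : Type u} [AddCommGroup M] [Module R M] (r : R)
    (h : H a i (ModuleCat.of R M)) :
    map a i (ModuleCat.ofHom (LinearMap.lsmul R M r)) h = r • h := by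
  have : ModuleCat.ofHom (LinearMap.lsmul R M r) = r • 𝟙 (ModuleCat.of R M) := by
    ext
    rfl
  rw [this, map_smul', map_id]

/-- multiplication by `y` sequence -/
abbrev msc {M : Type u} [AddCommGroup M] [Module R M] (y : R) : ShortComplex (ModuleCat.{u} R) :=
  sc (LinearMap.lsmul R M y) (LinearMap.range (LinearMap.lsmul R M y)).mkQ
    (LinearMap.exact_map_mkQ_range _)

lemma msc_exact {M : Type u} [AddCommGroup M] [Module R M] (y : R) (hy : IsSMulRegular M y) :
    (msc (M := M) y).ShortExact :=
  sc_exact _ _ _ hy (Submodule.mkQ_surjective _)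

/-- submodule-quotient sequence -/
abbrev qsc {M : Type u} [AddCommGroup M] [Module R M] (N : Submodule R M) :
    ShortComplex (ModuleCat.{u} R) :=
  sc N.subtype N.mkQ (LinearMap.exact_subtype_mkQ N)

lemma qsc_exact {M : Type u} [AddCommGroup M] [Module R M] (N : Submodule R M) :
    (qsc N).ShortExact :=
  sc_exact _ _ _ N.injective_subtype N.mkQ_surjective

lemma tors_quot (a : Ideal R) [IsNoetherianRing R] (M : Type u) [AddCommGroup M] [Module R M]
    [Module.Finite R M]
    (x : M ⧸ tors a M) (n : ℕ) (hx : ∀ r ∈ a ^ n, r • x = 0) : x = 0 := by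
  obtain ⟨m, rfl⟩ := Submodule.mkQ_surjective _ x
  obtain ⟨k, hk⟩ := (isTors_tors a M).exists_pow
  refine (Submodule.Quotient.mk_eq_zero _).2 ⟨k + n, fun r hr => ?_⟩
  rw [pow_add] at hr
  refine Submodule.mul_induction_on hr ?_ ?_
  · intro s hs t ht
    have h1 : t • m ∈ tors a M := by
      rw [← Submodule.Quotient.mk_eq_zero]
      exact hx t ht
    have := congrArg Subtype.val (hk s hs ⟨_, h1⟩)
    rw [mul_smul]
    exact this
  · intro s t hs ht
    rw [add_smul, hs, ht, add_zero]

lemma map_tors_inj (a : Ideal R) [IsNoetherianRing R] (M : Type u) [AddCommGroup M] [Module R M]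
    {i : ℕ} (hi : 0 < i) : Function.Injective (map a i (qsc (tors a M)).g) := by
  rw [injective_iff_map_eq_zero]
  intro h h0
  obtain ⟨h', rfl⟩ := exact₂ (qsc_exact (tors a M)) a h0
  rw [H_tors_eq_zero hi _ (isTors_tors a M) h', _root_.map_zero]

lemma map_tors_surj (a : Ideal R) [IsNoetherianRing R] (M : Type u) [AddCommGroup M] [Module R M]
    {i : ℕ} : Function.Surjective (map a i (qsc (tors a M)).g) := by
  intro h
  exact exact₃ (qsc_exact (tors a M)) a rfl (H_tors_eq_zero (Nat.succ_pos i) _ (isTors_tors a M) _)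

lemma exists_regular (a : Ideal R) [IsNoetherianRing R] (M : Type u) [AddCommGroup M] [Module R M]
    [Module.Finite R M] (hM : ∀ x : M, (∀ r ∈ a, r • x = 0) → x = 0) :
    ∃ y ∈ a, IsSMulRegular M y := by
  have : Subsingleton ((R ⧸ a) →ₗ[R] M) := by
    refine ⟨fun f g => ?_⟩
    apply LinearMap.ext
    intro x
    obtain ⟨r, rfl⟩ := Submodule.mkQ_surjective _ x
    rw [hM (f _) fun s hs => ?_, hM (g _) fun s hs => ?_]
    all_goals
      rw [← map_smul, ← map_smul, show (Submodule.mkQ a) (s • r) = 0 from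
        (Submodule.Quotient.mk_eq_zero _).2 (Ideal.mul_mem_right _ _ hs), _root_.map_zero]
  obtain ⟨y, hy, h⟩ := IsSMulRegular.subsingleton_linearMap_iff.1 this
  rw [Ideal.annihilator_quotient] at hy
  exact ⟨y, hy, h⟩

lemma ass_iff [IsNoetherianRing R] {M : Type u} [AddCommGroup M] [Module R M] {p : Ideal R} :
    p ∈ associatedPrimes R M ↔ p.IsPrime ∧ ∃ x : M, ∀ r, r ∈ p ↔ r • x = 0 := by
  rw [AssociatedPrimes.mem_iff, isAssociatedPrime_iff]
  refine and_congr_right fun _ => exists_congr fun x => ?_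
  rw [Ideal.ext_iff]
  simp [Submodule.mem_colon_singleton]

/-- chains ending at `q`. -/
def Chn {α : Type u} [Preorder α] (S : Set α) : ℕ → α → Prop
  | 0, q => q ∈ S
  | (i + 1), q => q ∈ S ∧ ∃ q' < q, Chn S i q'

lemma Chn.mem {α : Type u} [Preorder α] {S : Set α} {n : ℕ} {q : α} (h : Chn S n q) : q ∈ S := by
  cases n with
  | zero => exact h
  | succ n => exact h.1

lemma Chn.mono {α : Type u} [Preorder α] {S T : Set α} (hST : S ⊆ T) {n : ℕ} {q : α}
    (h : Chn S n q) : Chn T n q := by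
  induction n generalizing q with
  | zero => exact hST h
  | succ n ih =>
    obtain ⟨h1, q', h2, h3⟩ := h
    exact ⟨hST h1, q', h2, ih h3⟩

lemma Chn.shift {α : Type u} [Preorder α] {S T : Set α} (hST : S ⊆ T)
    (h : ∀ q ∈ S, ∃ q' ∈ T, q' < q) {n : ℕ} {q : α}
    (hq : Chn S n q) : Chn T (n + 1) q := by
  induction n generalizing q with
  | zero =>
    obtain ⟨q', h1, h2⟩ := h q hq
    exact ⟨hST hq, q', h2, h1⟩
  | succ n ih =>
    obtain ⟨h1, q', h2, h3⟩ := hq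
    exact ⟨hST h1, q', h2, ih h3⟩

lemma Chn.series {α : Type u} [Preorder α] {S : Set α} {n : ℕ} {q : α}
    (h : Chn S n q) : ∃ p : LTSeries S, p.length = n ∧ p.last = q := by
  induction n generalizing q with
  | zero => exact ⟨RelSeries.singleton _ ⟨q, h⟩, rfl, rfl⟩
  | succ n ih =>
    obtain ⟨h1, q', h2, h3⟩ := h
    obtain ⟨p, hp, hp'⟩ := ih h3
    refine ⟨RelSeries.snoc p ⟨q, h1⟩ ?_, ?_, ?_⟩
    · change (p.last : α) < q
      rwa [hp']
    · simp [hp]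
    · simp

lemma Chn.le_dim {α : Type u} [Preorder α] {S : Set α} {n : ℕ} {q : α}
    (h : Chn S n q) : (n : WithBot ℕ∞) ≤ Order.krullDim S := by
  obtain ⟨p, rfl, -⟩ := h.series
  exact Order.LTSeries.length_le_krullDim p

lemma vt [IsNoetherianRing R] (a : Ideal R) (z : R) (i : ℕ) (M : Type u) [AddCommGroup M]
    [Module R M] [Module.Finite R M]
    (hz : ∀ q, Chn (Module.support R M) i q → z ∈ q.asIdeal) (h : H a i (ModuleCat.of R M)) :
    ∃ k, z ^ k • h = 0 := by
  induction i generalizing M with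
  | zero =>
    have : z ∈ (Module.annihilator R M).radical := by
      rw [Ideal.radical_eq_sInf, Submodule.mem_sInf]
      rintro p ⟨hp, hp'⟩
      exact hz ⟨p, hp'⟩ (Module.mem_support_iff_of_finite.2 hp)
    obtain ⟨k, hk⟩ := this
    refine ⟨k, ev_inj a ?_⟩
    rw [map_smul, _root_.map_zero]
    exact Module.mem_annihilator.1 hk _
  | succ i ih =>
    suffices hs : ∀ (N : Type u) [AddCommGroup N] [Module R N] [Module.Finite R N]
        (_ : ∀ x : N, (∀ r ∈ a, r • x = 0) → x = 0)
        (_ : Module.support R N ⊆ Module.support R M) (h : H a (i + 1) (ModuleCat.of R N)),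
          ∃ k, z ^ k • h = 0 by
      obtain ⟨k, hk⟩ := hs (M ⧸ tors a M) (fun x hx => tors_quot a M x 1 (by simpa using hx))
        (Module.support_subset_of_surjective _ (Submodule.mkQ_surjective _))
        (map a _ (qsc (tors a M)).g h)
      refine ⟨k, map_tors_inj a M (Nat.succ_pos i) ?_⟩
      rw [map_smul, hk, _root_.map_zero]
    intro N _ _ _ hN hsupp h
    obtain ⟨x, hxa, hx⟩ := exists_regular a N hN
    obtain ⟨n, hn⟩ := H_torsion a h
    have hy : IsSMulRegular N (x ^ n) := hx.pow n
    have h0 : map a (i + 1) (msc (M := N) (x ^ n)).f h = 0 := by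
      rw [map_lsmul]
      exact hn _ (Ideal.pow_mem_pow hxa n)
    obtain ⟨h', rfl⟩ := exact₁ (msc_exact _ hy) a rfl h0
    have key : ∀ q, Chn (Module.support R (N ⧸ LinearMap.range (LinearMap.lsmul R N (x ^ n)))) i q →
        z ∈ q.asIdeal := by
      intro q hq
      refine hz q (Chn.mono hsupp (Chn.shift ?_ ?_ hq))
      · exact Module.support_subset_of_surjective _ (Submodule.mkQ_surjective _)
      · intro q hq
        have hq1 := Module.mem_support_iff_of_finite.1 hq
        have hq2 := Module.mem_support_iff_of_finite.1 (Module.support_subset_of_surjective _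
          (Submodule.mkQ_surjective (LinearMap.range (LinearMap.lsmul R N (x ^ n)))) hq)
        have := q.2
        obtain ⟨p, hp, hpq⟩ := Ideal.exists_minimalPrimes_le hq2
        have hpp := hp.1.1
        refine ⟨⟨p, hpp⟩, Module.mem_support_iff_of_finite.2 hp.1.2, lt_of_le_of_ne hpq ?_⟩
        intro heq
        have hmem : x ^ n ∈ p := by
          have : x ^ n ∈ q.asIdeal := by
            apply hq1
            rw [Module.mem_annihilator]
            intro m
            obtain ⟨m, rfl⟩ := Submodule.mkQ_surjective _ m
            exact (Submodule.Quotient.mk_eq_zero _).2 ⟨m, rfl⟩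
          rw [← heq] at this
          exact this
        have hass := Module.associatedPrimes.minimalPrimes_annihilator_subset_associatedPrimes R N hp
        obtain ⟨-, m, hm⟩ := ass_iff.1 hass
        have h1 : x ^ n • m = 0 := (hm _).1 hmem
        have h2 : m = 0 := hy (by simpa using h1)
        exact hpp.ne_top ((Ideal.eq_top_iff_one _).2 ((hm 1).2 (by rw [h2, smul_zero])))
    obtain ⟨k, hk⟩ := ih (N ⧸ LinearMap.range (LinearMap.lsmul R N (x ^ n))) key h'
    exact ⟨k, by rw [← map_smul, hk, _root_.map_zero]⟩

lemma H_eq_zero_of_dim [IsNoetherianRing R] (a : Ideal R) (i : ℕ) (M : Type u) [AddCommGroup M]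
    [Module R M] [Module.Finite R M] (hi : Module.supportDim R M < i)
    (h : H a i (ModuleCat.of R M)) : h = 0 := by
  obtain ⟨k, hk⟩ := vt a (1 : R) i M (fun q hq => absurd hq.le_dim (not_le.2 hi)) h
  simpa using hk

lemma H_tors_max [IsNoetherianRing R] [IsLocalRing R] (a : Ideal R) (d : ℕ)
    (hd : ringKrullDim R ≤ (d : WithBot ℕ∞)) (M : Type u) [AddCommGroup M]
    [Module R M] [Module.Finite R M] (z : R) (hz : z ∈ IsLocalRing.maximalIdeal R)
    (h : H a d (ModuleCat.of R M)) : ∃ k, z ^ k • h = 0 := by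
  refine vt a z d M (fun q hq => ?_) h
  by_contra hzq
  have hlt : q < IsLocalRing.closedPoint R := by
    refine lt_of_le_of_ne (IsLocalRing.le_maximalIdeal q.2.ne_top) ?_
    rintro rfl
    exact hzq hz
  have h1 : Chn (Set.univ : Set (PrimeSpectrum R)) (d + 1) (IsLocalRing.closedPoint R) :=
    ⟨trivial, q, hlt, hq.mono (Set.subset_univ _)⟩
  have h2 := h1.le_dim
  have h3 : Order.krullDim (Set.univ : Set (PrimeSpectrum R)) = ringKrullDim R :=
    Order.krullDim_eq_of_orderIso OrderIso.Set.univ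
  rw [h3] at h2
  have h4 := h2.trans hd
  have h5 : d + 1 ≤ d := by exact_mod_cast h4
  omega

end LC

end fileLC3

section fileLC4

namespace LC

open CategoryTheory.Abelian

variable {R : Type u} [CommRing R]

/-- the ideal of `j`th powers -/
abbrev PI (L : List R) (j : ℕ) : Ideal R := Ideal.ofList (L.map (· ^ j))

lemma PI_mul {L : List R} {j k : ℕ} {r : R} (hr : r ∈ PI L j) : L.prod ^ k * r ∈ PI L (j + k) := by
  have hle : PI L j ≤ Submodule.comap (LinearMap.lsmul R R (L.prod ^ k)) (PI L (j + k)) := by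
    refine Ideal.span_le.2 ?_
    intro y hy
    obtain ⟨x, hx, rfl⟩ := List.mem_map.1 hy
    obtain ⟨c, hc⟩ := List.dvd_prod hx
    have h1 : x ^ (j + k) ∈ PI L (j + k) := Ideal.subset_span (List.mem_map.2 ⟨x, hx, rfl⟩)
    have : L.prod ^ k * x ^ j = c ^ k * x ^ (j + k) := by
      rw [hc]; ring
    change L.prod ^ k * x ^ j ∈ PI L (j + k)
    rw [this]
    exact Ideal.mul_mem_left _ _ h1
  exact hle hr

lemma PI_smul {L : List R} {j : ℕ} (k : ℕ) {M : Type u} [AddCommGroup M] [Module R M] {m : M}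
    (hm : m ∈ PI L j • (⊤ : Submodule R M)) :
    L.prod ^ k • m ∈ PI L (j + k) • (⊤ : Submodule R M) := by
  refine Submodule.smul_induction_on hm ?_ ?_
  · intro r hr m _
    rw [← mul_smul]
    exact Submodule.smul_mem_smul (PI_mul hr) trivial
  · intro x y hx hy
    rw [smul_add]
    exact add_mem hx hy

lemma PI_cons_smul (z : R) (L : List R) (j : ℕ) {M : Type u} [AddCommGroup M] [Module R M] {m : M} :
    m ∈ PI (z :: L) j • (⊤ : Submodule R M) ↔
      ∃ m', m - z ^ j • m' ∈ PI L j • (⊤ : Submodule R M) := by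
  rw [PI, List.map_cons, Ideal.ofList_cons, Submodule.sup_smul, Submodule.mem_sup]
  constructor
  · rintro ⟨a, ha, b, hb, rfl⟩
    rw [Submodule.ideal_span_singleton_smul, ← SetLike.mem_coe, Submodule.coe_pointwise_smul] at ha
    obtain ⟨m', -, rfl⟩ := ha
    exact ⟨m', by simpa using hb⟩
  · rintro ⟨m', hm'⟩
    refine ⟨z ^ j • m', ?_, _, hm', by abel⟩
    exact Submodule.smul_mem_smul (Ideal.mem_span_singleton_self _) trivial

/-- elementwise description of vanishing -/
def Elim (L : List R) (y : R) (M : Type u) [AddCommGroup M] [Module R M] : Prop :=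
  ∀ (m : M) (n : ℕ), ∃ k, L.prod ^ k • y • m ∈ PI L (n + k) • (⊤ : Submodule R M)

/-- `T` is the top Cech cohomology. -/
structure IsTop (L : List R) (M T : Type u) [AddCommGroup M] [Module R M] [AddCommGroup T]
    [Module R T] where
  /-- structure maps -/
  θ : ℕ → M →ₗ[R] T
  surj : ∀ t, ∃ n m, θ n m = t
  step : ∀ n m, θ (n + 1) (L.prod • m) = θ n m
  zero : ∀ n m, θ n m = 0 ↔ ∃ k, L.prod ^ k • m ∈ PI L (n + k) • (⊤ : Submodule R M)

lemma IsTop.steps {L : List R} {M T : Type u} [AddCommGroup M] [Module R M] [AddCommGroup T]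
    [Module R T] (h : IsTop L M T) (n k : ℕ) (m : M) : h.θ (n + k) (L.prod ^ k • m) = h.θ n m := by
  induction k with
  | zero => simp
  | succ k ih => rw [pow_succ', mul_smul, ← add_assoc, h.step, ih]

lemma IsTop.elim {L : List R} {M T : Type u} [AddCommGroup M] [Module R M] [AddCommGroup T]
    [Module R T] (h : IsTop L M T) (y : R) : (∀ t : T, y • t = 0) ↔ Elim L y M := by
  constructor
  · intro hy m n
    rw [← h.zero, map_smul, hy]
  · intro hy t
    obtain ⟨n, m, rfl⟩ := h.surj t
    rw [← map_smul, h.zero]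
    exact hy m n

/-- base case -/
def isTop_nil (M : Type u) [AddCommGroup M] [Module R M] : IsTop ([] : List R) M M where
  θ _ := LinearMap.id
  surj t := ⟨0, t, rfl⟩
  step n m := by simp
  zero n m := by simp [PI]

/-- power in the submonoid -/
def pw (z : R) (n : ℕ) : Submonoid.powers z := ⟨z ^ n, Submonoid.mem_powers_iff _ _ |>.2 ⟨n, rfl⟩⟩

lemma pw_smul (z : R) (n : ℕ) {T : Type u} [AddCommGroup T] [Module R T] (t : T) :
    pw z n • t = z ^ n • t := rfl

/-- localization -/
abbrev Lz (z : R) (T : Type u) [AddCommGroup T] [Module R T] : Type u :=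
  LocalizedModule (Submonoid.powers z) T

/-- quotient of the localization -/
abbrev Qz (z : R) (T : Type u) [AddCommGroup T] [Module R T] : Type u :=
  Lz z T ⧸ LinearMap.range (LocalizedModule.mkLinearMap (Submonoid.powers z) T)

lemma Lz_ex {z : R} {T : Type u} [AddCommGroup T] [Module R T] (w : Lz z T) :
    ∃ (t : T) (n : ℕ), w = LocalizedModule.mk t (pw z n) := by
  induction w using LocalizedModule.induction_on with
  | h t s =>
    obtain ⟨_, n, rfl⟩ := s
    exact ⟨t, n, rfl⟩

/-- division map -/
noncomputable def dv (z : R) (T : Type u) [AddCommGroup T] [Module R T] (n : ℕ) :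
    T →ₗ[R] Qz z T :=
  (Submodule.mkQ _).comp ((LocalizedModule.divBy (pw z n)).comp
    (LocalizedModule.mkLinearMap (Submonoid.powers z) T))

lemma dv_apply (z : R) (T : Type u) [AddCommGroup T] [Module R T] (n : ℕ) (t : T) :
    dv z T n t = Submodule.Quotient.mk (LocalizedModule.mk t (pw z n)) := by
  rw [dv, LinearMap.comp_apply, LinearMap.comp_apply, LocalizedModule.mkLinearMap_apply,
    LocalizedModule.divBy_apply]
  rw [LocalizedModule.liftOn_mk, one_mul]
  rfl

lemma dv_ex {z : R} {T : Type u} [AddCommGroup T] [Module R T] (w : Qz z T) :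
    ∃ n t, w = dv z T n t := by
  obtain ⟨w, rfl⟩ := Submodule.mkQ_surjective _ w
  obtain ⟨t, n, rfl⟩ := Lz_ex w
  exact ⟨n, t, (dv_apply _ _ _ _).symm⟩

lemma dv_step (z : R) (T : Type u) [AddCommGroup T] [Module R T] (n k : ℕ) (t : T) :
    dv z T (n + k) (z ^ k • t) = dv z T n t := by
  rw [dv_apply, dv_apply]
  congr 1
  rw [LocalizedModule.mk_eq]
  refine ⟨1, ?_⟩
  simp only [one_smul, pw_smul, ← mul_smul]
  congr 1
  ring

lemma dv_zero (z : R) (T : Type u) [AddCommGroup T] [Module R T] (n : ℕ) (t : T) :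
    dv z T n t = 0 ↔ ∃ (l : ℕ) (t' : T), z ^ l • t = z ^ (l + n) • t' := by
  rw [dv_apply, Submodule.Quotient.mk_eq_zero]
  constructor
  · rintro ⟨t', ht⟩
    rw [LocalizedModule.mkLinearMap_apply, LocalizedModule.mk_eq] at ht
    obtain ⟨s, h⟩ := ht
    obtain ⟨l, rfl⟩ : ∃ l, s = pw z l := by
      obtain ⟨_, l, rfl⟩ := s
      exact ⟨l, rfl⟩
    refine ⟨l, t', ?_⟩
    simp only [one_smul, pw_smul] at h
    rw [pow_add, mul_smul, h]
  · rintro ⟨l, t', h⟩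
    refine ⟨t', ?_⟩
    rw [LocalizedModule.mkLinearMap_apply, LocalizedModule.mk_eq]
    refine ⟨pw z l, ?_⟩
    simp only [one_smul, pw_smul]
    rw [h, pow_add, mul_smul]

/-- inductive step -/
noncomputable def isTop_cons {L : List R} {M T : Type u} [AddCommGroup M] [Module R M]
    [AddCommGroup T] [Module R T] (h : IsTop L M T) (z : R) : IsTop (z :: L) M (Qz z T) where
  θ n := (dv z T n).comp (h.θ n)
  surj w := by
    obtain ⟨j, t, rfl⟩ := dv_ex w
    obtain ⟨n, m, rfl⟩ := h.surj t
    refine ⟨n + j, L.prod ^ j • z ^ n • m, ?_⟩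
    rw [LinearMap.comp_apply, h.steps, map_smul, add_comm n j, dv_step]
  step n m := by
    rw [LinearMap.comp_apply, LinearMap.comp_apply, List.prod_cons, mul_comm, mul_smul, h.step,
      map_smul]
    have := dv_step z T n 1 (h.θ n m)
    rwa [pow_one] at this
  zero n m := by
    rw [LinearMap.comp_apply, dv_zero]
    constructor
    · rintro ⟨l, t', ht⟩
      obtain ⟨N, m', rfl⟩ := h.surj t'
      rw [← h.steps n N, ← h.steps N n, ← map_smul, ← map_smul, add_comm N n, ← sub_eq_zero,
        ← map_sub, h.zero] at ht
      obtain ⟨k, hk⟩ := ht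
      refine ⟨k + N + l, ?_⟩
      rw [PI_cons_smul]
      have h1 := Submodule.smul_mem _ (z ^ (k + N)) (PI_smul l hk)
      refine ⟨L.prod ^ (k + l + n) • m', ?_⟩
      have e1 : n + (k + N + l) = n + N + k + l := by ring
      have e2 : (z :: L).prod ^ (k + N + l) • m - z ^ (n + (k + N + l)) • L.prod ^ (k + l + n) • m' =
          z ^ (k + N) • L.prod ^ l • L.prod ^ k •
            (z ^ l • L.prod ^ N • m - z ^ (l + n) • L.prod ^ n • m') := by
        simp only [smul_sub, ← mul_smul, List.prod_cons]
        congr 2 <;> ring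
      rw [e2, e1]
      exact h1
    · rintro ⟨k, hk⟩
      rw [PI_cons_smul] at hk
      obtain ⟨m', hm'⟩ := hk
      refine ⟨k, h.θ (n + k) m', ?_⟩
      rw [← h.steps n k, ← map_smul, ← map_smul, ← sub_eq_zero, ← map_sub, h.zero]
      refine ⟨0, ?_⟩
      rw [List.prod_cons, mul_pow, mul_smul, add_comm n k] at hm'
      rw [pow_zero, one_smul, add_zero, add_comm n k]
      exact hm'

end LC

end fileLC4

section fileLC5

namespace LC

open CategoryTheory.Abelian

variable {R : Type u} [CommRing R]

lemma H_Lz (a : Ideal R) {z : R} (hz : z ∈ a) (i : ℕ) (G : Type u) [AddCommGroup G] [Module R G]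
    (h : H a i (ModuleCat.of R (Lz z G))) : h = 0 := by
  obtain ⟨n, hn⟩ := H_torsion a h
  have h1 := map_map a i (ModuleCat.ofHom (LinearMap.lsmul R (Lz z G) (z ^ n)))
    (ModuleCat.ofHom (LocalizedModule.divBy (pw z n))) h
  rw [map_lsmul, hn _ (Ideal.pow_mem_pow hz n), _root_.map_zero] at h1
  have h2 : ModuleCat.ofHom (LinearMap.lsmul R (Lz z G) (z ^ n)) ≫
      ModuleCat.ofHom (LocalizedModule.divBy (pw z n)) = 𝟙 _ := by
    ext x
    exact LocalizedModule.divBy_mul_by (pw z n) x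
  rw [h2, map_id] at h1
  exact h1.symm

lemma IsTors.sup {c e : Ideal R} {M : Type u} [AddCommGroup M] [Module R M] (h : IsTors c M)
    (h' : IsTors e M) : IsTors (c ⊔ e) M := by
  intro m
  obtain ⟨n, hn⟩ := h m
  obtain ⟨k, hk⟩ := h' m
  refine ⟨n + k, fun r hr => ?_⟩
  obtain ⟨s, hs, t, ht, rfl⟩ := Submodule.mem_sup.1 (Ideal.sup_pow_add_le_pow_sup_pow hr)
  rw [add_smul, hn s hs, hk t ht, add_zero]

lemma isTors_span {z : R} {M : Type u} [AddCommGroup M] [Module R M]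
    (h : ∀ m : M, ∃ n : ℕ, z ^ n • m = 0) : IsTors (Ideal.span {z}) M := by
  intro m
  obtain ⟨n, hn⟩ := h m
  refine ⟨n, fun r hr => ?_⟩
  rw [Ideal.span_singleton_pow, Ideal.mem_span_singleton'] at hr
  obtain ⟨s, rfl⟩ := hr
  rw [mul_smul, hn, smul_zero]

lemma IsTors.Qz {c : Ideal R} {z : R} {M : Type u} [AddCommGroup M] [Module R M] (h : IsTors c M) :
    IsTors (Ideal.span {z} ⊔ c) (Qz z M) := by
  refine IsTors.sup (isTors_span ?_) ?_
  · intro w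
    obtain ⟨n, t, rfl⟩ := dv_ex w
    refine ⟨n, ?_⟩
    rw [← map_smul, dv_zero]
    exact ⟨0, t, by simp⟩
  · intro w
    obtain ⟨n, t, rfl⟩ := dv_ex w
    obtain ⟨k, hk⟩ := h t
    exact ⟨k, fun r hr => by rw [← map_smul, hk r hr, _root_.map_zero]⟩

/-- the kernel of localization -/
noncomputable abbrev Kz (z : R) (G : Type u) [AddCommGroup G] [Module R G] : Submodule R G :=
  LinearMap.ker (LocalizedModule.mkLinearMap (Submonoid.powers z) G)

lemma IsTors.Kz {c : Ideal R} {z : R} {M : Type u} [AddCommGroup M] [Module R M] (h : IsTors c M) :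
    IsTors (Ideal.span {z} ⊔ c) (Kz z M) := by
  refine IsTors.sup (isTors_span ?_) (h.of_inj (LC.Kz z M).subtype Subtype.val_injective)
  rintro ⟨m, hm⟩
  rw [LinearMap.mem_ker, LocalizedModule.mkLinearMap_apply, ← LocalizedModule.zero_mk 1, LocalizedModule.mk_eq] at hm
  obtain ⟨⟨_, n, rfl⟩, hs⟩ := hm
  refine ⟨n, Subtype.ext ?_⟩
  simp only [one_smul, smul_zero] at hs
  exact hs

section
variable (z : R) (G : Type u) [AddCommGroup G] [Module R G]

/-- first half -/
noncomputable abbrev sA : ShortComplex (ModuleCat.{u} R) :=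
  sc (Kz z G).subtype (LocalizedModule.mkLinearMap (Submonoid.powers z) G).rangeRestrict (by
    intro x
    rw [← LinearMap.mem_ker, LinearMap.ker_rangeRestrict]
    simp)

lemma sA_exact : (sA z G).ShortExact :=
  sc_exact _ _ _ Subtype.val_injective (LinearMap.surjective_rangeRestrict _)

/-- second half -/
noncomputable abbrev sB : ShortComplex (ModuleCat.{u} R) :=
  qsc (LinearMap.range (LocalizedModule.mkLinearMap (Submonoid.powers z) G))

lemma sB_exact : (sB z G).ShortExact := qsc_exact _

variable {z} in
lemma δB_bij (a : Ideal R) (hz : z ∈ a) (i : ℕ) :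
    Function.Bijective (δ (sB_exact z G) a (rfl : i + 1 = i + 1)) := by
  constructor
  · rw [injective_iff_map_eq_zero]
    intro h h0
    obtain ⟨h', rfl⟩ := exact₃ (sB_exact z G) a rfl h0
    rw [H_Lz a hz i G h', _root_.map_zero]
  · intro h
    exact exact₁ (sB_exact z G) a rfl (H_Lz a hz _ G _)

end

lemma H_vanish [IsNoetherianRing R] {a : Ideal R} (L : List R) (hL : ∀ x ∈ L, x ∈ a) (c : Ideal R)
    (N : ℕ) (hN : a ^ N ≤ Ideal.ofList L ⊔ c) (G : Type u) [AddCommGroup G] [Module R G]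
    (hG : IsTors c G) (j : ℕ) (hj : L.length < j) (h : H a j (ModuleCat.of R G)) : h = 0 := by
  induction L generalizing c G j with
  | nil =>
    refine H_tors_eq_zero hj (ModuleCat.of R G) ?_ h
    intro m
    obtain ⟨n, hn⟩ := hG m
    refine ⟨N * n, fun r hr => hn r ?_⟩
    rw [pow_mul] at hr
    refine Ideal.pow_right_mono (hN.trans ?_) n hr
    simp
  | cons z L ih =>
    have hz : z ∈ a := hL z (by simp)
    have hL' : ∀ x ∈ L, x ∈ a := fun x hx => hL x (by simp [hx])
    have hN' : a ^ N ≤ Ideal.ofList L ⊔ (Ideal.span {z} ⊔ c) := by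
      refine hN.trans (le_of_eq ?_)
      rw [Ideal.ofList_cons, ← sup_assoc, sup_comm (Ideal.span {z})]
    obtain ⟨i, rfl⟩ : ∃ i, j = i + 1 := ⟨j - 1, by omega⟩
    rw [List.length_cons] at hj
    have h1 : map a (i + 1) (sA z G).g h = 0 := by
      obtain ⟨h', hh'⟩ := (δB_bij G a hz i).2 (map a (i + 1) (sA z G).g h)
      rw [← hh', ih hL' _ hN' (Qz z G) hG.Qz i (by omega) h', _root_.map_zero]
    obtain ⟨h', rfl⟩ := exact₂ (sA_exact z G) a h1
    rw [ih hL' _ hN' (Kz z G) hG.Kz (i + 1) (by omega) h', _root_.map_zero]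

lemma H_step [IsNoetherianRing R] {a : Ideal R} (z : R) (hz : z ∈ a) (L : List R)
    (hL : ∀ x ∈ L, x ∈ a) (c : Ideal R)
    (N : ℕ) (hN : a ^ N ≤ Ideal.ofList L ⊔ (Ideal.span {z} ⊔ c)) (G : Type u) [AddCommGroup G]
    [Module R G] (hG : IsTors c G) :
    Nonempty (H a (L.length + 1) (ModuleCat.of R G) ≃ₗ[R] H a L.length (ModuleCat.of R (Qz z G))) := by
  have h1 : Function.Bijective (map a (L.length + 1) (sA z G).g) := by
    constructor
    · rw [injective_iff_map_eq_zero]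
      intro h h0
      obtain ⟨h', rfl⟩ := exact₂ (sA_exact z G) a h0
      rw [H_vanish L hL _ N hN (Kz z G) hG.Kz _ (by omega) h', _root_.map_zero]
    · intro h
      exact exact₃ (sA_exact z G) a rfl (H_vanish L hL _ N hN (Kz z G) hG.Kz _ (by omega) _)
  exact ⟨(LinearEquiv.ofBijective _ h1).trans (LinearEquiv.ofBijective _ (δB_bij G a hz _)).symm⟩

lemma H_elim_aux [IsNoetherianRing R] {a : Ideal R} (L L' : List R) (hL : ∀ x ∈ L, x ∈ a)
    (N : ℕ) (hN : a ^ N ≤ Ideal.ofList L ⊔ Ideal.ofList L')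
    (M : Type u) [AddCommGroup M] [Module R M] (T : Type u) [AddCommGroup T] [Module R T]
    (hT : IsTop L' M T) (hT' : IsTors (Ideal.ofList L') T) (y : R) :
    (∀ h : H a L.length (ModuleCat.of R T), y • h = 0) ↔ Elim (L.reverse ++ L') y M := by
  induction L generalizing L' T with
  | nil =>
    rw [List.reverse_nil, List.nil_append, ← hT.elim]
    constructor
    · intro hy t
      obtain ⟨n, hn⟩ := hT' t
      obtain ⟨h, rfl⟩ := ev_surj (M := ModuleCat.of R T) a t (N * n) (by
        intro r hr
        refine hn r ?_
        rw [pow_mul] at hr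
        refine Ideal.pow_right_mono (hN.trans ?_) n hr
        simp)
      rw [← map_smul]
      exact (congrArg _ (hy h)).trans (_root_.map_zero _)
    · intro hy h
      apply ev_inj a
      rw [map_smul, _root_.map_zero]
      exact hy _
  | cons z L ih =>
    have hz : z ∈ a := hL z (by simp)
    have hL' : ∀ x ∈ L, x ∈ a := fun x hx => hL x (by simp [hx])
    have hN' : a ^ N ≤ Ideal.ofList L ⊔ Ideal.ofList (z :: L') := by
      refine hN.trans (le_of_eq ?_)
      rw [Ideal.ofList_cons, Ideal.ofList_cons, ← sup_assoc, sup_comm (Ideal.span {z})]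
    obtain ⟨e⟩ := H_step z hz L hL' (Ideal.ofList L') N (by rwa [← Ideal.ofList_cons]) T hT'
    have := ih (z :: L') hL' hN' (Qz z T) (isTop_cons hT z) (by
      rw [Ideal.ofList_cons]; exact hT'.Qz)
    rw [List.reverse_cons, List.append_assoc, List.singleton_append, ← this]
    constructor
    · intro hy h
      have := hy (e.symm h)
      rwa [← map_smul, LinearEquiv.map_eq_zero_iff] at this
    · intro hy h
      have := hy (e h)
      rwa [← map_smul, LinearEquiv.map_eq_zero_iff] at this

lemma elim_perm {L L' : List R} (h : L.Perm L') (y : R) (M : Type u) [AddCommGroup M]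
    [Module R M] : Elim L y M → Elim L' y M := by
  intro hy m n
  obtain ⟨k, hk⟩ := hy m n
  refine ⟨k, ?_⟩
  rw [h.prod_eq] at hk
  have : PI L (n + k) = PI L' (n + k) := by
    unfold PI Ideal.ofList
    congr 1
    ext x
    exact (h.map _).mem_iff
  rwa [← this]

/-- Main identification. -/
lemma H_elim [IsNoetherianRing R] {a : Ideal R} (L : List R) (hL : ∀ x ∈ L, x ∈ a)
    (N : ℕ) (hN : a ^ N ≤ Ideal.ofList L)
    (M : Type u) [AddCommGroup M] [Module R M] (y : R) :
    (∀ h : H a L.length (ModuleCat.of R M), y • h = 0) ↔ Elim L y M := by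
  rw [H_elim_aux L [] hL N (hN.trans le_sup_left) M M (isTop_nil M) ?_ y, List.append_nil]
  · exact ⟨elim_perm L.reverse_perm y M, elim_perm L.reverse_perm.symm y M⟩
  · intro m
    refine ⟨1, fun r hr => ?_⟩
    rw [pow_one, Ideal.ofList_nil] at hr
    rw [(Submodule.mem_bot R).1 hr, zero_smul]

end LC

end fileLC5

section fileA1

namespace LC

section Complete
variable {R : Type u} [CommRing R]

lemma prec_of_surj (I : Ideal R) {M N : Type u} [AddCommGroup M] [Module R M] [AddCommGroup N]
    [Module R N] [IsPrecomplete I M] (f : M →ₗ[R] N) (hf : Function.Surjective f) :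
    IsPrecomplete I N := by
  constructor
  intro s hs
  have h1 : ∀ n, ∃ t ∈ (I ^ n • ⊤ : Submodule R M), f t = s (n + 1) - s n := by
    intro n
    have := (hs (Nat.le_succ n)).symm
    rw [SModEq.sub_mem] at this
    have e : (I ^ n • ⊤ : Submodule R N) = (I ^ n • ⊤ : Submodule R M).map f := by
      rw [Submodule.map_smul'', Submodule.map_top, LinearMap.range_eq_top.2 hf]
    rw [e] at this
    exact this
  choose t ht ht' using h1
  obtain ⟨g0, hg0⟩ := hf (s 0)
  let g : ℕ → M := fun n => g0 + ∑ i ∈ Finset.range n, t i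
  have hg : ∀ n, f (g n) = s n := by
    intro n
    simp only [g, map_add, map_sum, hg0, ht']
    rw [Finset.sum_range_sub]
    abel
  have hc : ∀ {m n}, m ≤ n → g m ≡ g n [SMOD (I ^ m • ⊤ : Submodule R M)] := by
    intro m n hmn
    induction n, hmn using Nat.le_induction with
    | base => rfl
    | succ n hmn ih =>
      refine ih.trans ?_
      rw [SModEq.comm, SModEq.sub_mem]
      have : g (n + 1) - g n = t n := by simp [g, Finset.sum_range_succ]
      rw [this]
      exact Submodule.smul_mono_left (Ideal.pow_le_pow_right hmn) (ht n)
  obtain ⟨L, hL⟩ := IsPrecomplete.prec' g hc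
  refine ⟨f L, fun n => ?_⟩
  rw [← hg n]
  have := hL n
  rw [SModEq.sub_mem] at this ⊢
  rw [← map_sub]
  have h2 := Submodule.mem_map_of_mem (f := f) this
  rw [Submodule.map_smul''] at h2
  exact Submodule.smul_mono le_rfl le_top h2

lemma prec_pi (I : Ideal R) [IsPrecomplete I R] (s : ℕ) : IsPrecomplete I (Fin s → R) := by
  constructor
  intro f hf
  have h1 : ∀ i : Fin s, ∃ L : R, ∀ n, f n i ≡ L [SMOD (I ^ n • ⊤ : Submodule R R)] := by
    intro i
    refine IsPrecomplete.prec' (fun n => f n i) ?_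
    intro m n hmn
    have := hf hmn
    rw [SModEq.sub_mem] at this ⊢
    have h2 := Submodule.mem_map_of_mem (f := LinearMap.proj i) this
    rw [Submodule.map_smul''] at h2
    exact Submodule.smul_mono le_rfl le_top h2
  choose L hL using h1
  refine ⟨L, fun n => ?_⟩
  rw [SModEq.sub_mem]
  have : f n - L = ∑ i, (f n i - L i) • (Pi.single i 1 : Fin s → R) := by
    ext j
    simp [Finset.sum_apply, Pi.single_apply]
  rw [this]
  refine Submodule.sum_mem _ fun i _ => Submodule.smul_mem_smul ?_ trivial
  have := hL i n
  rw [SModEq.sub_mem] at this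
  simpa using this

lemma fin_of_quot (I : Ideal R) [IsPrecomplete I R] (K : Type u) [AddCommGroup K] [Module R K]
    [IsHausdorff I K] (hK : Module.Finite R (K ⧸ (I • ⊤ : Submodule R K))) :
    Module.Finite R K := by
  obtain ⟨s, g, hg⟩ := Module.Finite.exists_fin (R := R) (M := K ⧸ (I • ⊤ : Submodule R K))
  choose g' hg' using fun i => Submodule.Quotient.mk_surjective (I • ⊤ : Submodule R K) (g i)
  let f : (Fin s → R) →ₗ[R] K := Fintype.linearCombination R g'
  have := prec_pi I s
  have hs : Function.Surjective (Submodule.mkQ (I • ⊤ : Submodule R K) ∘ₗ f) := by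
    rw [← LinearMap.range_eq_top, eq_top_iff, ← hg, Submodule.span_le]
    rintro _ ⟨i, rfl⟩
    refine ⟨Pi.single i 1, ?_⟩
    simp [f, Fintype.linearCombination_apply_single, hg']
  exact Module.Finite.of_surjective f (surjective_of_mkQ_comp_surjective hs)

lemma fg_step (I : Ideal R) [IsAdicComplete I R] (J : Ideal R) (hJ : J.FG) (x : R) (hx : x ∈ I)
    (h : ∀ I' : Ideal R, J ⊔ Ideal.span {x} ≤ I' → I'.FG) (I' : Ideal R) (hI' : J ≤ I') :
    I'.FG := by
  have hprime : ∀ P : Ideal R, P.IsPrime → J ≤ P → P.FG := by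
    intro P hP hJP
    by_cases hxP : x ∈ P
    · exact h P (sup_le hJP (by simpa [Ideal.span_le] using hxP))
    have h1 : (P ⊔ Ideal.span {x}).FG := h _ (sup_le_sup_right hJP _)
    have hH : IsHausdorff I P := by
      constructor
      intro p hp
      apply Subtype.ext
      apply IsHausdorff.haus (I := I) (M := R) inferInstance
      intro n
      have := hp n
      rw [SModEq.zero] at this ⊢
      have h2 := Submodule.mem_map_of_mem (f := P.subtype) this
      rw [Submodule.map_smul''] at h2
      exact Submodule.smul_mono le_rfl le_top h2
    refine Module.Finite.iff_fg.1 ?_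
    apply fin_of_quot I P
    -- map of `P` in `R/(x)`
    have h3 : (Submodule.map (Submodule.mkQ (Ideal.span {x} : Ideal R)) (P : Submodule R R)).FG := by
      have h4 := Submodule.FG.map (Submodule.mkQ (Ideal.span {x} : Ideal R)) h1
      rwa [Submodule.map_sup, Submodule.mkQ_map_self, sup_bot_eq] at h4
    let Q := Submodule.map (Submodule.mkQ (Ideal.span {x} : Ideal R)) (P : Submodule R R)
    have h5 : Module.Finite R Q := Module.Finite.iff_fg.2 h3
    let φ : P →ₗ[R] P ⧸ (I • ⊤ : Submodule R P) := Submodule.mkQ _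
    let ψ : P →ₗ[R] Q := (Submodule.mkQ (Ideal.span {x} : Ideal R)).submoduleMap P
    have hψ : Function.Surjective ψ := LinearMap.submoduleMap_surjective _ _
    have hk : LinearMap.ker ψ ≤ LinearMap.ker φ := by
      rintro ⟨p, hp⟩ hpk
      have h6 : (Submodule.mkQ (Ideal.span {x} : Ideal R)) p = 0 := congrArg Subtype.val hpk
      rw [Submodule.mkQ_apply, Submodule.Quotient.mk_eq_zero, Ideal.mem_span_singleton'] at h6
      obtain ⟨c, rfl⟩ := h6
      have hc : c ∈ P := (hP.mem_or_mem hp).resolve_right hxP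
      rw [LinearMap.mem_ker]
      simp only [φ, Submodule.mkQ_apply, Submodule.Quotient.mk_eq_zero]
      have : (⟨c * x, hp⟩ : P) = x • ⟨c, hc⟩ := Subtype.ext (by simp [mul_comm])
      rw [this]
      exact Submodule.smul_mem_smul hx trivial
    let e := ψ.quotKerEquivOfSurjective hψ
    let θ : Q →ₗ[R] P ⧸ (I • ⊤ : Submodule R P) :=
      ((LinearMap.ker ψ).liftQ φ hk).comp e.symm.toLinearMap
    refine Module.Finite.of_surjective θ ?_
    rw [← LinearMap.range_eq_top, LinearMap.range_comp, LinearEquiv.range, Submodule.map_top,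
      Submodule.range_liftQ]
    exact Submodule.range_mkQ _
  have hN : IsNoetherianRing (R ⧸ J) := by
    apply IsNoetherianRing.of_prime
    intro P hP
    have h1 := hprime (P.comap (Ideal.Quotient.mk J)) inferInstance (by
      intro r hr
      rw [Ideal.mem_comap, Ideal.Quotient.eq_zero_iff_mem.2 hr]
      exact zero_mem _)
    have h2 := h1.map (Ideal.Quotient.mk J)
    rwa [Ideal.map_comap_of_surjective _ Ideal.Quotient.mk_surjective] at h2
  have hN' : IsNoetherian R (R ⧸ J) := by
    constructor
    intro N
    let N' : Ideal (R ⧸ J) :=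
      { N with
        smul_mem' := by
          intro c y hy
          obtain ⟨r, rfl⟩ := Ideal.Quotient.mk_surjective c
          exact N.smul_mem r hy }
    have h7 : (N'.restrictScalars R).FG := Submodule.FG.restrictScalars_of_surjective
      (IsNoetherian.noetherian N') Ideal.Quotient.mk_surjective
    exact h7
  exact Submodule.fg_of_fg_map_of_fg_inf_ker (Submodule.mkQ J) (IsNoetherian.noetherian _)
    (by rw [Submodule.ker_mkQ, inf_eq_right.2 hI']; exact hJ)

lemma noeth_of_complete [IsLocalRing R] (hm : (IsLocalRing.maximalIdeal R).FG)
    [IsAdicComplete (IsLocalRing.maximalIdeal R) R] : IsNoetherianRing R := by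
  classical
  have key : ∀ t : Finset R, (∀ x ∈ t, x ∈ IsLocalRing.maximalIdeal R) →
      (∀ I' : Ideal R, Ideal.span (t : Set R) ≤ I' → I'.FG) → ∀ I' : Ideal R, I'.FG := by
    intro t
    induction t using Finset.induction_on with
    | empty => intro _ h I'; exact h I' (by simp)
    | insert a t ha ih =>
      intro hmem h
      refine ih (fun x hx => hmem x (Finset.mem_insert_of_mem hx)) ?_
      intro I' hI'
      refine fg_step (IsLocalRing.maximalIdeal R) (Ideal.span (t : Set R)) ⟨t, rfl⟩ a
        (hmem a (Finset.mem_insert_self _ _)) ?_ I' hI'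
      intro I'' hI''
      apply h
      rwa [Finset.coe_insert, Ideal.span_insert, sup_comm]
  obtain ⟨t, ht⟩ := hm
  refine ⟨key t (fun x hx => ht ▸ Submodule.subset_span hx) ?_⟩
  intro I' hI'
  have hI : IsLocalRing.maximalIdeal R ≤ I' := ht ▸ hI'
  by_cases h : I' = ⊤
  · rw [h]
    exact Submodule.FG.of_finite
  · rw [← (IsLocalRing.maximalIdeal.isMaximal R).eq_of_le h hI]
    exact ⟨t, ht⟩

end Complete

section Hull
variable {R : Type u} [CommRing R] {I : Type u} [AddCommGroup I] [Module R I]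

/-- every nonzero element of `E` has a nonzero multiple in `k0` -/
def Ess (k0 E : Submodule R I) : Prop := ∀ x ∈ E, x ≠ 0 → ∃ r : R, r • x ∈ k0 ∧ r • x ≠ 0

lemma exists_hull [Module.Injective R I] (k0 : Submodule R I) :
    ∃ E : Submodule R I, k0 ≤ E ∧ Ess k0 E ∧ Module.Injective R E := by
  obtain ⟨E, hkE, hE⟩ := zorn_le_nonempty₀ {E : Submodule R I | Ess k0 E} (by
    intro c hc hch y hy
    refine ⟨sSup c, ?_, fun z hz => le_sSup hz⟩
    intro x hx hx0
    rw [Submodule.mem_sSup_of_directed ⟨y, hy⟩ hch.directedOn] at hx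
    obtain ⟨z, hz, hxz⟩ := hx
    exact hc hz x hxz hx0) k0 (fun x hx hx0 => ⟨1, by simpa using hx, by simpa using hx0⟩)
  obtain ⟨N, -, hN⟩ := zorn_le_nonempty₀ {N : Submodule R I | Disjoint N E} (by
    intro c hc hch y hy
    refine ⟨sSup c, ?_, fun z hz => le_sSup hz⟩
    show Disjoint _ _
    rw [Submodule.disjoint_def]
    intro x hx hxE
    rw [Submodule.mem_sSup_of_directed ⟨y, hy⟩ hch.directedOn] at hx
    obtain ⟨z, hz, hxz⟩ := hx
    exact (Submodule.disjoint_def.1 (hc hz)) x hxz hxE) ⊥ disjoint_bot_left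
  have hNE : Disjoint N E := hN.prop
  let j : E →ₗ[R] I ⧸ N := N.mkQ ∘ₗ E.subtype
  have hj : Function.Injective j := by
    rw [← LinearMap.ker_eq_bot, LinearMap.ker_eq_bot']
    rintro ⟨x, hx⟩ h
    have : x ∈ N := by
      rw [← Submodule.Quotient.mk_eq_zero]; exact h
    exact Subtype.ext (Submodule.disjoint_def.1 hNE x this hx)
  obtain ⟨g, hg⟩ := Module.Injective.out (R := R) (Q := I) j hj E.subtype
  have hg' : ∀ x ∈ E, g (N.mkQ x) = x := fun x hx => hg ⟨x, hx⟩
  -- essential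
  have hes : ∀ x : I, x ∉ N → ∃ r : R, ∃ e ∈ E, e ≠ 0 ∧ N.mkQ e = r • N.mkQ x := by
    intro x hx
    have hnd : ¬ Disjoint (N ⊔ Submodule.span R {x}) E := by
      intro hd
      have := hN.le_of_ge hd le_sup_left
      exact hx (this (Submodule.mem_sup_right (Submodule.mem_span_singleton_self x)))
    rw [Submodule.disjoint_def] at hnd
    push Not at hnd
    obtain ⟨e, he, heE, he0⟩ := hnd
    obtain ⟨n, hn, y, hy, rfl⟩ := Submodule.mem_sup.1 he
    obtain ⟨r, rfl⟩ := Submodule.mem_span_singleton.1 hy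
    refine ⟨r, _, heE, he0, ?_⟩
    rw [map_add, map_smul, (Submodule.Quotient.mk_eq_zero N (x := n)).2 hn |> fun h => (show N.mkQ n = 0 from h), zero_add]
  have hrange : LinearMap.range g ≤ E := by
    have h1 : Ess k0 (LinearMap.range g) := by
      rintro _ ⟨y, rfl⟩ hy0
      obtain ⟨x, rfl⟩ := N.mkQ_surjective y
      have hx : x ∉ N := by
        intro hx
        apply hy0
        rw [show N.mkQ x = 0 from (Submodule.Quotient.mk_eq_zero N).2 hx, map_zero]
      obtain ⟨r, e, heE, he0, he⟩ := hes x hx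
      obtain ⟨s, hs, hs0⟩ := hE.prop e heE he0
      have h2 : (s * r) • g (N.mkQ x) = s • e := by
        rw [mul_smul, ← map_smul g, ← he, hg' e heE]
      exact ⟨s * r, by rwa [h2], by rwa [h2]⟩
    exact hE.le_of_ge h1 (fun x hx => ⟨N.mkQ x, hg' x hx⟩)
  refine ⟨E, hkE, hE.prop, ⟨?_⟩⟩
  intro X Y _ _ _ _ f hf φ
  obtain ⟨h, hh⟩ := Module.Injective.out (R := R) (Q := I) f hf (E.subtype ∘ₗ φ)
  refine ⟨(g.codRestrict E (fun x => hrange ⟨x, rfl⟩)) ∘ₗ N.mkQ ∘ₗ h, fun x => ?_⟩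
  apply Subtype.ext
  simp only [LinearMap.comp_apply, LinearMap.codRestrict_apply, hh]
  exact hg' _ (φ x).2

end Hull

end LC

end fileA1

section fileLC6

namespace LC

open CategoryTheory.Abelian IsLocalRing
open scoped Pointwise

variable {R : Type u} [CommRing R]

/-- `E` behaves like the injective hull of the residue field. -/
structure IsE (R : Type u) [CommRing R] [IsLocalRing R] (E : Type u) [AddCommGroup E]
    [Module R E] : Prop where
  inj : Module.Injective R E
  soc : ∃ e : E, e ≠ 0 ∧ (∀ r ∈ maximalIdeal R, r • e = 0) ∧
    ∀ x : E, (∀ r ∈ maximalIdeal R, r • x = 0) → ∃ r : R, r • e = x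

lemma exists_isE (R : Type u) [CommRing R] [IsLocalRing R] :
    ∃ (E : Type u) (_ : AddCommGroup E) (_ : Module R E), IsE R E := by
  let k : ModuleCat.{u} R := ModuleCat.of R (R ⧸ maximalIdeal R)
  let J := Injective.under k
  have hJ0 : Injective J := Injective.injective_under k
  have hJ : Module.Injective R J :=
    (Module.injective_iff_injective_object R J).2 hJ0
  have hmono : Function.Injective (Injective.ι k).hom :=
    (ModuleCat.mono_iff_injective _).1 inferInstance
  let e0 : J := (Injective.ι k).hom (Submodule.Quotient.mk (1 : R))
  have he0 : e0 ≠ 0 := by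
    intro h
    have h1 : (Submodule.Quotient.mk (1 : R) : R ⧸ maximalIdeal R) = 0 :=
      hmono (h.trans (map_zero _).symm)
    rw [Submodule.Quotient.mk_eq_zero] at h1
    exact (Ideal.ne_top_iff_one _).1 (maximalIdeal.isMaximal R).ne_top h1
  have hk : ∀ r ∈ maximalIdeal R, r • e0 = 0 := by
    intro r hr
    have h1 : r • (Submodule.Quotient.mk (1 : R) : R ⧸ maximalIdeal R) = 0 := by
      rw [← Submodule.Quotient.mk_smul, Submodule.Quotient.mk_eq_zero]
      simpa using hr
    exact (map_smul (Injective.ι k).hom r _).symm.trans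
      ((congrArg (Injective.ι k).hom h1).trans (map_zero _))
  obtain ⟨E, hkE, hE, hEi⟩ := exists_hull (Submodule.span R {e0})
  refine ⟨E, inferInstance, inferInstance, hEi, ⟨e0, hkE (Submodule.mem_span_singleton_self e0)⟩,
    fun h => he0 (congrArg Subtype.val h), fun r hr => Subtype.ext (hk r hr), ?_⟩
  rintro ⟨x, hx⟩ hmx
  by_cases hx0 : x = 0
  · exact ⟨0, Subtype.ext (by simp [hx0])⟩
  obtain ⟨r, hr, hr0⟩ := hE x hx hx0
  have hu : IsUnit r := by
    by_contra hu
    exact hr0 (congrArg Subtype.val (hmx r ((mem_maximalIdeal r).2 hu)))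
  obtain ⟨v, hv⟩ := hu.exists_left_inv
  obtain ⟨t, ht⟩ := Submodule.mem_span_singleton.1 hr
  refine ⟨v * t, Subtype.ext ?_⟩
  show (v * t) • e0 = x
  rw [mul_smul, ht, smul_smul, hv, one_smul]

section
variable [IsLocalRing R] {E : Type u} [AddCommGroup E] [Module R E]

lemma IsE.sep (hE : IsE R E) {M : Type u} [AddCommGroup M] [Module R M] (x : M) (hx : x ≠ 0) :
    ∃ φ : M →ₗ[R] E, φ x ≠ 0 := by
  obtain ⟨e, he0, hem, -⟩ := hE.soc
  have := hE.inj
  let f : (R ⧸ LinearMap.ker (LinearMap.toSpanSingleton R M x)) →ₗ[R] M :=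
    Submodule.liftQ _ (LinearMap.toSpanSingleton R M x) le_rfl
  have hf : Function.Injective f := by
    rw [← LinearMap.ker_eq_bot]
    exact Submodule.ker_liftQ_eq_bot _ _ _ le_rfl
  let g : (R ⧸ LinearMap.ker (LinearMap.toSpanSingleton R M x)) →ₗ[R] E :=
    Submodule.liftQ _ (LinearMap.toSpanSingleton R E e) (by
      intro r hr
      rw [LinearMap.mem_ker, LinearMap.toSpanSingleton_apply] at hr ⊢
      apply hem
      rw [mem_maximalIdeal, mem_nonunits_iff]
      intro hu
      apply hx
      obtain ⟨v, hv⟩ := hu.exists_left_inv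
      rw [← one_smul R x, ← hv, mul_smul, hr, smul_zero])
  obtain ⟨φ, hφ⟩ := Module.Injective.out (R := R) (Q := E) f hf g
  refine ⟨φ, ?_⟩
  have h1 := hφ (Submodule.Quotient.mk 1)
  have h2 : f (Submodule.Quotient.mk 1) = x := one_smul R x
  have h3 : g (Submodule.Quotient.mk 1) = e := one_smul R e
  rw [h2, h3] at h1
  rwa [h1]

/-- extension of functionals vanishing on a kernel -/
lemma IsE.factor (hE : IsE R E) {M N : Type u} [AddCommGroup M] [Module R M] [AddCommGroup N]
    [Module R N] (f : M →ₗ[R] N) (φ : M →ₗ[R] E) (h : ∀ x, f x = 0 → φ x = 0) :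
    ∃ ψ : N →ₗ[R] E, ∀ x, ψ (f x) = φ x := by
  have := hE.inj
  let f' : (M ⧸ LinearMap.ker f) →ₗ[R] N := Submodule.liftQ _ f le_rfl
  have hf : Function.Injective f' := by
    rw [← LinearMap.ker_eq_bot]
    exact Submodule.ker_liftQ_eq_bot _ _ _ le_rfl
  let g : (M ⧸ LinearMap.ker f) →ₗ[R] E := Submodule.liftQ _ φ (fun x hx => h x hx)
  obtain ⟨ψ, hψ⟩ := Module.Injective.out (R := R) (Q := E) f' hf g
  exact ⟨ψ, fun x => hψ (Submodule.Quotient.mk x)⟩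

variable [IsNoetherianRing R]

lemma IsE.noeth_tors (hE : IsE R E) (n : ℕ) :
    IsNoetherian R (Submodule.torsionBySet R E ((maximalIdeal R ^ n : Ideal R) : Set R)) := by
  induction n with
  | zero =>
    have : Submodule.torsionBySet R E ((maximalIdeal R ^ 0 : Ideal R) : Set R) = ⊥ := by
      rw [eq_bot_iff]
      intro x hx
      rw [Submodule.mem_torsionBySet_iff] at hx
      simpa using hx ⟨1, by simp⟩
    rw [this]
    infer_instance
  | succ n ih =>
    obtain ⟨t, ht⟩ := IsNoetherian.noetherian (maximalIdeal R)
    let T1 := Submodule.torsionBySet R E ((maximalIdeal R ^ (n + 1) : Ideal R) : Set R)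
    let T0 := Submodule.torsionBySet R E ((maximalIdeal R ^ n : Ideal R) : Set R)
    have htm : ∀ a : t, (a : R) ∈ maximalIdeal R := fun a => ht ▸ Submodule.subset_span a.2
    let g : T1 →ₗ[R] (t → T0) := LinearMap.pi fun a =>
      ((LinearMap.lsmul R E a).comp T1.subtype).codRestrict T0 (by
        rintro ⟨x, hx⟩
        simp only [T0, T1, Submodule.mem_torsionBySet_iff] at hx ⊢
        rintro ⟨r, hr⟩
        have := hx ⟨r * a, by
          rw [pow_succ]; exact Ideal.mul_mem_mul hr (htm a)⟩
        simpa [mul_smul] using this)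
    obtain ⟨e, he0, hem, hes⟩ := hE.soc
    have hker : IsNoetherian R (LinearMap.ker g) := by
      have hle : (LinearMap.ker g).map T1.subtype ≤ Submodule.span R {e} := by
        rintro _ ⟨x, hx, rfl⟩
        have hx' : ∀ a : t, (a : R) • (x : E) = 0 := by
          intro a
          exact congrArg Subtype.val (congrFun (LinearMap.mem_ker.1 hx) a)
        have : ∀ r ∈ maximalIdeal R, r • (x : E) = 0 := by
          intro r hr
          rw [← ht] at hr
          induction hr using Submodule.span_induction with
          | mem y hy => exact hx' ⟨y, hy⟩
          | zero => simp
          | add y z _ _ h1 h2 => rw [add_smul, h1, h2, add_zero]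
          | smul c y _ h => rw [smul_assoc, h, smul_zero]
        obtain ⟨r, hr⟩ := hes _ this
        exact Submodule.mem_span_singleton.2 ⟨r, hr⟩
      let ι : LinearMap.ker g →ₗ[R] Submodule.span R {e} :=
        (T1.subtype.comp (LinearMap.ker g).subtype).codRestrict _
          (fun x => hle ⟨x, x.2, rfl⟩)
      refine isNoetherian_of_injective ι ?_
      intro x y hxy
      have := congrArg Subtype.val hxy
      exact Subtype.ext (Subtype.ext this)
    exact isNoetherian_of_range_eq_ker (LinearMap.ker g).subtype g (by simp)

lemma IsE.finite_dual (hE : IsE R E) (T : Type u) [AddCommGroup T] [Module R T]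
    [Module.Finite R T] (hT : IsTors (maximalIdeal R) T) : Module.Finite R (T →ₗ[R] E) := by
  obtain ⟨n, hn⟩ := hT.exists_pow
  have := hE.noeth_tors n
  obtain ⟨s, g, hg⟩ := Module.Finite.exists_fin (R := R) (M := T)
  let T0 := Submodule.torsionBySet R E ((maximalIdeal R ^ n : Ideal R) : Set R)
  let f : (T →ₗ[R] E) →ₗ[R] (Fin s → T0) :=
    { toFun := fun φ i => ⟨φ (g i), by
        simp only [T0, Submodule.mem_torsionBySet_iff]
        rintro ⟨r, hr⟩
        show r • φ (g i) = 0
        rw [← map_smul, hn r hr, map_zero]⟩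
      map_add' := fun _ _ => rfl
      map_smul' := fun _ _ => rfl }
  refine Module.Finite.of_injective f ?_
  intro φ ψ h
  have : Submodule.span R (Set.range g) ≤ LinearMap.eqLocus φ ψ := by
    rw [Submodule.span_le]
    rintro _ ⟨i, rfl⟩
    exact congrArg Subtype.val (congrFun h i)
  rw [hg] at this
  exact LinearMap.ext fun x => this trivial

lemma supportDim_le_zero (W : Type u) [AddCommGroup W] [Module R W] [Module.Finite R W] (n : ℕ)
    (hW : ∀ r ∈ maximalIdeal R ^ n, ∀ w : W, r • w = 0) : Module.supportDim R W ≤ 0 := by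
  have : Subsingleton (Module.support R W) := by
    have h : ∀ p ∈ Module.support R W, p.asIdeal = maximalIdeal R := by
      intro p hp
      rw [Module.support_eq_zeroLocus, PrimeSpectrum.mem_zeroLocus] at hp
      refine le_antisymm (le_maximalIdeal p.2.ne_top) ?_
      refine Ideal.IsPrime.le_of_pow_le (hP := p.2) (n := n) ?_
      intro r hr
      apply hp
      exact Module.mem_annihilator.2 (hW r hr)
    refine ⟨fun p q => Subtype.ext (PrimeSpectrum.ext ((h p p.2).trans (h q q.2).symm))⟩
  exact Order.krullDim_nonpos_of_subsingleton

lemma IsE.haus (hE : IsE R E) (i : ℕ) (M : ModuleCat.{u} R) :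
    IsHausdorff (maximalIdeal R) (H (maximalIdeal R) i M →ₗ[R] E) := by
  constructor
  intro φ hφ
  ext h
  obtain ⟨n, hn⟩ := H_torsion _ h
  have := hφ n
  rw [SModEq.zero] at this
  clear hφ
  induction this using Submodule.smul_induction_on' with
  | smul r hr w _ =>
    show r • w h = 0
    rw [← map_smul, hn r hr, _root_.map_zero]
  | add x _ y _ h1 h2 =>
    show x h + y h = 0
    rw [h1, h2]; simp

/-- Lemma F -/
lemma IsE.lemF (hE : IsE R E) [IsAdicComplete (maximalIdeal R) R] (i : ℕ) :
    ∀ (M : Type u) [AddCommGroup M] [Module R M] [Module.Finite R M],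
      Module.Finite R (H (maximalIdeal R) i (ModuleCat.of R M) →ₗ[R] E) ∧
      Module.supportDim R (H (maximalIdeal R) i (ModuleCat.of R M) →ₗ[R] E) ≤ i := by
  induction i with
  | zero =>
    intro M _ _ _
    have hfin : Module.Finite R (H (maximalIdeal R) 0 (ModuleCat.of R M)) :=
      Module.Finite.of_injective (ev (maximalIdeal R) (ModuleCat.of R M)) (ev_inj _)
    have ht : IsTors (maximalIdeal R) (H (maximalIdeal R) 0 (ModuleCat.of R M)) :=
      fun h => H_torsion _ h
    have h1 := hE.finite_dual _ ht
    refine ⟨h1, ?_⟩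
    obtain ⟨n, hn⟩ := ht.exists_pow
    refine supportDim_le_zero _ n ?_
    intro r hr w
    ext h
    show r • w h = 0
    rw [← map_smul, hn r hr, _root_.map_zero]
  | succ i ih =>
    have key : ∀ (M : Type u) [AddCommGroup M] [Module R M] [Module.Finite R M],
      (∀ x : M, (∀ r ∈ maximalIdeal R, r • x = 0) → x = 0) →
      Module.Finite R (H (maximalIdeal R) (i+1) (ModuleCat.of R M) →ₗ[R] E) ∧
      Module.supportDim R (H (maximalIdeal R) (i+1) (ModuleCat.of R M) →ₗ[R] E) ≤ (i + 1 : ℕ) := by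
      intro M _ _ _ hM
      obtain ⟨x, hxm, hx⟩ := exists_regular (maximalIdeal R) M hM
      let W := H (maximalIdeal R) (i+1) (ModuleCat.of R M) →ₗ[R] E
      let W' := H (maximalIdeal R) i (msc (M := M) x).X₃ →ₗ[R] E
      obtain ⟨h1, h2⟩ := ih (M ⧸ LinearMap.range (LinearMap.lsmul R M x))
      change Module.Finite R W' at h1
      change Module.supportDim R W' ≤ _ at h2
      let g : W →ₗ[R] W' := LinearMap.lcomp R E (δ (msc_exact x hx) (maximalIdeal R) rfl)
      have hker : ∀ φ : W, g φ = 0 ↔ φ ∈ (x • ⊤ : Submodule R W) := by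
        intro φ
        constructor
        · intro h
          obtain ⟨ψ, hψ⟩ := hE.factor (LinearMap.lsmul R _ x) φ (by
            intro h' h0
            obtain ⟨h'', rfl⟩ := exact₁ (msc_exact x hx) (maximalIdeal R) (i := i) rfl (h := h') (by
              rw [map_lsmul]; exact h0)
            exact LinearMap.congr_fun h h'')
          rw [Submodule.mem_smul_pointwise_iff_exists]
          refine ⟨ψ, trivial, ?_⟩
          ext h'
          rw [← hψ h']
          show x • ψ h' = ψ (x • h')
          rw [map_smul]
        · rw [Submodule.mem_smul_pointwise_iff_exists]
          rintro ⟨ψ, -, rfl⟩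
          ext h'
          show x • ψ (δ (msc_exact x hx) (maximalIdeal R) rfl h') = 0
          have := map_f_δ (msc_exact x hx) (maximalIdeal R) rfl h'
          rw [map_lsmul] at this
          rw [← map_smul, this, _root_.map_zero]
      let g' : QuotSMulTop x W →ₗ[R] W' := Submodule.liftQ _ g (fun φ hφ => (hker φ).2 hφ)
      have hg' : Function.Injective g' := by
        rw [← LinearMap.ker_eq_bot]
        exact Submodule.ker_liftQ_eq_bot _ _ _ (fun φ hφ => (hker φ).1 hφ)
      have hf1 : Module.Finite R (QuotSMulTop x W) := Module.Finite.of_injective g' hg'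
      have hle : (x • ⊤ : Submodule R W) ≤ (maximalIdeal R • ⊤ : Submodule R W) := by
        intro φ hφ
        obtain ⟨ψ, -, rfl⟩ := (Submodule.mem_smul_pointwise_iff_exists _ _ _).1 hφ
        exact Submodule.smul_mem_smul hxm trivial
      have hf2 : Module.Finite R (W ⧸ (maximalIdeal R • ⊤ : Submodule R W)) :=
        Module.Finite.of_surjective (Submodule.factor hle) (Submodule.factor_surjective hle)
      have := hE.haus (i + 1) (ModuleCat.of R M)
      have hfin : Module.Finite R W := fin_of_quot (maximalIdeal R) W hf2
      refine ⟨hfin, ?_⟩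
      refine (Module.supportDim_le_supportDim_quotSMulTop_succ (M := W) hxm).trans ?_
      have h3 := (Module.supportDim_le_of_injective g' hg').trans h2
      have h4 := add_le_add_left h3 1
      simpa using h4
    intro M _ _ _
    obtain ⟨h1, h2⟩ := key (M ⧸ tors (maximalIdeal R) M) (by
      intro x hx
      exact tors_quot (maximalIdeal R) M x 1 (by simpa using hx))
    let e := LinearEquiv.ofBijective (map (maximalIdeal R) (i + 1) (qsc (tors (maximalIdeal R) M)).g)
      ⟨map_tors_inj (maximalIdeal R) M (Nat.succ_pos i), map_tors_surj (maximalIdeal R) M⟩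
    let e' := (LinearEquiv.congrLeft E R e)
    exact ⟨Module.Finite.equiv e'.symm, (Module.supportDim_eq_of_equiv e').trans_le h2⟩

/-- consequence of Lemma F. -/
lemma IsE.exists_kill (hE : IsE R E) [IsAdicComplete (maximalIdeal R) R] (i : ℕ)
    (P : Ideal R) [P.IsPrime] (hP : (i : WithBot ℕ∞) < ringKrullDim (R ⧸ P))
    (M : Type u) [AddCommGroup M] [Module R M] [Module.Finite R M] :
    ∃ s ∉ P, ∀ h : H (maximalIdeal R) i (ModuleCat.of R M), s • h = 0 := by
  obtain ⟨h1, h2⟩ := hE.lemF i M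
  rw [Module.supportDim_eq_ringKrullDim_quotient_annihilator] at h2
  by_contra hcon
  push Not at hcon
  have hle : Module.annihilator R (H (maximalIdeal R) i (ModuleCat.of R M) →ₗ[R] E) ≤ P := by
    intro s hs
    by_contra hsP
    obtain ⟨h, hh⟩ := hcon s hsP
    obtain ⟨φ, hφ⟩ := hE.sep _ hh
    apply hφ
    rw [map_smul]
    exact LinearMap.congr_fun (Module.mem_annihilator.1 hs φ) h
  have h3 := ringKrullDim_le_of_surjective (Ideal.Quotient.factor hle)
    (Ideal.Quotient.factor_surjective hle)
  exact absurd (hP.trans_le (h3.trans h2)) (lt_irrefl _)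

end

end LC

end fileLC6

section fileLC7

namespace LC

open CategoryTheory.Abelian IsLocalRing
open scoped Pointwise

lemma wb_lt {x : WithBot ℕ∞} {d : ℕ} (h : x + 1 ≤ (d : WithBot ℕ∞)) :
    x < (d : WithBot ℕ∞) := by
  induction x with
  | bot => exact WithBot.bot_lt_coe _
  | coe x =>
    induction x with
    | top => exact absurd h (by
        intro h
        have h' : (⊤ : ℕ∞) + 1 ≤ (d : ℕ∞) := by exact_mod_cast h
        simp at h')
    | coe x =>
      have h' : x + 1 ≤ d := by exact_mod_cast h
      have : x < d := by omega
      exact_mod_cast this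

section mp
variable {R : Type u} [CommRing R] {M N P : Type u} [AddCommGroup M] [Module R M]
  [AddCommGroup N] [Module R N] [AddCommGroup P] [Module R P]

/-- functoriality for linear maps -/
noncomputable abbrev mp (a : Ideal R) (i : ℕ) (f : M →ₗ[R] N) :
    H a i (ModuleCat.of R M) →ₗ[R] H a i (ModuleCat.of R N) := map a i (ModuleCat.ofHom f)

lemma mp_mp (a : Ideal R) (i : ℕ) (f : M →ₗ[R] N) (g : N →ₗ[R] P)
    (h : H a i (ModuleCat.of R M)) : mp a i g (mp a i f h) = mp a i (g ∘ₗ f) h :=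
  map_map a i _ _ h

lemma mp_id (a : Ideal R) (i : ℕ) (h : H a i (ModuleCat.of R M)) :
    mp a i (LinearMap.id : M →ₗ[R] M) h = h := map_id a i h

lemma mp_zero (a : Ideal R) (i : ℕ) (h : H a i (ModuleCat.of R M)) :
    mp a i (0 : M →ₗ[R] N) h = 0 := map_zero' a i h

lemma mp_add (a : Ideal R) (i : ℕ) (f g : M →ₗ[R] N) (h : H a i (ModuleCat.of R M)) :
    mp a i (f + g) h = mp a i f h + mp a i g h := map_add' a i _ _ h

lemma mp_smul (a : Ideal R) (i : ℕ) (r : R) (f : M →ₗ[R] N) (h : H a i (ModuleCat.of R M)) :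
    mp a i (r • f) h = r • mp a i f h := map_smul' a i r _ h

lemma mp_sum (a : Ideal R) (i : ℕ) {ι : Type*} (s : Finset ι) (f : ι → M →ₗ[R] N)
    (h : H a i (ModuleCat.of R M)) :
    mp a i (∑ x ∈ s, f x) h = ∑ x ∈ s, mp a i (f x) h := by
  classical
  induction s using Finset.induction_on with
  | empty => simp [mp_zero]
  | insert x s hx ih => rw [Finset.sum_insert hx, Finset.sum_insert hx, mp_add, ih]

lemma pi_decomp (r : ℕ) : (LinearMap.id : (Fin r → R) →ₗ[R] (Fin r → R)) =
    ∑ j, (LinearMap.toSpanSingleton R (Fin r → R) (Pi.single j 1)) ∘ₗ LinearMap.proj j := by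
  apply LinearMap.ext
  intro f
  ext i
  simp [LinearMap.sum_apply, Finset.sum_apply, Pi.single_apply]

lemma mp_pi (a : Ideal R) (i r : ℕ) (h : H a i (ModuleCat.of R (Fin r → R))) :
    h = ∑ j, mp a i (LinearMap.toSpanSingleton R (Fin r → R) (Pi.single j 1))
      (mp a i (LinearMap.proj j : (Fin r → R) →ₗ[R] R) h) := by
  conv_lhs => rw [← mp_id a i h, pi_decomp, mp_sum]
  simp only [mp_mp]

end mp

section top
variable {R : Type u} [CommRing R] [IsNoetherianRing R] {M N P : Type u} [AddCommGroup M] [Module R M]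
  [AddCommGroup N] [Module R N] [AddCommGroup P] [Module R P] {d : ℕ}

lemma mp_surj (hd : ringKrullDim R ≤ (d : WithBot ℕ∞)) (a : Ideal R) [Module.Finite R M]
    (f : M →ₗ[R] N) (hf : Function.Surjective f) : Function.Surjective (mp a d f) := by
  intro h
  refine exact₃ (sc_exact (LinearMap.ker f).subtype f (LinearMap.exact_subtype_ker_map f)
    (Submodule.injective_subtype _) hf) a rfl ?_
  refine H_eq_zero_of_dim a (d + 1) (LinearMap.ker f) ?_ _
  refine lt_of_le_of_lt (Module.supportDim_le_ringKrullDim R _) (lt_of_le_of_lt hd ?_)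
  exact_mod_cast Nat.lt_succ_self d

lemma exists_free (M : Type u) [AddCommGroup M] [Module R M] [Module.Finite R M] :
    ∃ (r : ℕ) (π : (Fin r → R) →ₗ[R] M), Function.Surjective π := by
  obtain ⟨r, f, hf⟩ := Module.Finite.exists_fin' R M
  exact ⟨r, f, hf⟩

/-- top cohomology is generated by the images of `H(R)`. -/
lemma top_ext (hd : ringKrullDim R ≤ (d : WithBot ℕ∞)) (a : Ideal R) [Module.Finite R M]
    {E : Type u} [AddCommGroup E] [Module R E]
    (α β : H a d (ModuleCat.of R M) →ₗ[R] E)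
    (h : ∀ (m : M) (h0 : H a d (ModuleCat.of R R)),
      α (mp a d (LinearMap.toSpanSingleton R M m) h0) =
      β (mp a d (LinearMap.toSpanSingleton R M m) h0)) : α = β := by
  obtain ⟨r, π, hπ⟩ := exists_free (R := R) M
  ext x
  obtain ⟨y, rfl⟩ := mp_surj hd a π hπ x
  rw [mp_pi a d r y]
  simp only [map_sum]
  refine Finset.sum_congr rfl fun j _ => ?_
  have : π ∘ₗ LinearMap.toSpanSingleton R (Fin r → R) (Pi.single j 1) =
      LinearMap.toSpanSingleton R M (π (Pi.single j 1)) := by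
    ext; simp
  rw [mp_mp, this]
  exact h _ _

lemma kill_free {a : Ideal R} {i : ℕ} {s : R} (hs : ∀ h : H a i (ModuleCat.of R R), s • h = 0)
    (r : ℕ) (h : H a i (ModuleCat.of R (Fin r → R))) : s • h = 0 := by
  rw [mp_pi a i r h, Finset.smul_sum]
  refine Finset.sum_eq_zero fun j _ => ?_
  rw [← map_smul, hs, _root_.map_zero]

/-- nonzero elements act surjectively on top cohomology of a domain -/
lemma div_top [IsDomain R] (hd : ringKrullDim R ≤ (d : WithBot ℕ∞)) (a : Ideal R) (s : R)
    (hs : s ≠ 0) (h : H a d (ModuleCat.of R R)) : ∃ h', s • h' = h := by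
  have hreg : IsSMulRegular R s := fun x y hxy => mul_left_cancel₀ hs hxy
  obtain ⟨h', hh'⟩ := exact₂ (msc_exact (M := R) s hreg) a (h := h) (by
    refine H_eq_zero_of_dim a d (R ⧸ LinearMap.range (LinearMap.lsmul R R s)) ?_ _
    have h1 : LinearMap.range (LinearMap.lsmul R R s) = Ideal.span {s} := by
      ext x
      simp [Ideal.mem_span_singleton', mul_comm]
    rw [h1]
    rw [Module.supportDim_quotient_eq_ringKrullDim]
    have h2 := ringKrullDim_quotient_succ_le_of_nonZeroDivisor (mem_nonZeroDivisors_of_ne_zero hs)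
    exact wb_lt (h2.trans hd))
  rw [map_lsmul] at hh'
  exact ⟨h', hh'⟩

end top

end LC

end fileLC7

section fileA2

namespace LC

open IsLocalRing

lemma tf_functional {R : Type u} [CommRing R] [IsDomain R] (K : Type u) [AddCommGroup K]
    [Module R K] [Module.Finite R K] (htf : ∀ (s : R) (x : K), s ≠ 0 → s • x = 0 → x = 0)
    (u : K) (hu : u ≠ 0) : ∃ g : K →ₗ[R] R, g u ≠ 0 := by
  let F := FractionRing R
  let V := LocalizedModule (nonZeroDivisors R) K
  let ι : K →ₗ[R] V := LocalizedModule.mkLinearMap (nonZeroDivisors R) K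
  have hιu : ι u ≠ 0 := by
    intro h
    obtain ⟨c, hc⟩ := (IsLocalizedModule.eq_zero_iff (nonZeroDivisors R) ι).1 h
    exact hu (htf c u (nonZeroDivisors.coe_ne_zero c) hc)
  obtain ⟨f, hf⟩ := Module.Projective.exists_dual_ne_zero F hιu
  obtain ⟨n, k, hk⟩ := Module.Finite.exists_fin (R := R) (M := K)
  obtain ⟨b, hb⟩ := IsLocalization.exist_integer_multiples_of_finite (nonZeroDivisors R)
    (fun i => f (ι (k i)))
  let f' : K →ₗ[R] F := (b : R) • ((f.restrictScalars R) ∘ₗ ι)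
  have hr : ∀ x, f' x ∈ LinearMap.range (Algebra.linearMap R F) := by
    intro x
    have hx : x ∈ Submodule.span R (Set.range k) := hk ▸ trivial
    induction hx using Submodule.span_induction with
    | mem x hx =>
      obtain ⟨i, rfl⟩ := hx
      obtain ⟨r, hr⟩ := hb i
      exact ⟨r, hr⟩
    | zero => rw [map_zero]; exact zero_mem _
    | add x y _ _ h1 h2 => rw [map_add]; exact add_mem h1 h2
    | smul c x _ h => rw [map_smul]; exact Submodule.smul_mem _ _ h
  have hinj : Function.Injective (Algebra.linearMap R F) := IsFractionRing.injective R F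
  let e := LinearEquiv.ofInjective (Algebra.linearMap R F) hinj
  let g : K →ₗ[R] R := e.symm.toLinearMap ∘ₗ f'.codRestrict _ hr
  refine ⟨g, ?_⟩
  intro hg
  have h1 : (f'.codRestrict _ hr) u = 0 := by
    have : e.symm ((f'.codRestrict _ hr) u) = 0 := hg
    simpa using this
  have h2 : f' u = 0 := congrArg Subtype.val h1
  have h3 : (b : R) • f (ι u) = 0 := h2
  rw [Algebra.smul_def, mul_eq_zero] at h3
  rcases h3 with h3 | h3
  · rw [← map_zero (algebraMap R F)] at h3
    exact nonZeroDivisors.coe_ne_zero b (IsFractionRing.injective R F h3)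
  · exact hf h3

section
variable {R : Type u} [CommRing R] [IsNoetherianRing R] [IsLocalRing R]

lemma closed_ideal (J : Ideal R) (x : R) (h : ∀ j, x ∈ J ⊔ maximalIdeal R ^ j) : x ∈ J := by
  have h1 : (Submodule.mkQ J x) ∈ (⨅ i : ℕ, maximalIdeal R ^ i • ⊤ : Submodule R (R ⧸ J)) := by
    rw [Submodule.mem_iInf]
    intro i
    obtain ⟨a, ha, b, hb, rfl⟩ := Submodule.mem_sup.1 (h i)
    rw [map_add, show Submodule.mkQ J a = 0 from (Submodule.Quotient.mk_eq_zero J).2 ha, zero_add]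
    have : Submodule.mkQ J b = b • Submodule.mkQ J 1 := by
      rw [← map_smul, smul_eq_mul, mul_one]
    rw [this]
    exact Submodule.smul_mem_smul hb trivial
  rw [Ideal.iInf_pow_smul_eq_bot_of_isLocalRing _ (maximalIdeal.isMaximal R).ne_top] at h1
  exact (Submodule.Quotient.mk_eq_zero J).1 h1

lemma artinian_quot (k : ℕ) : IsArtinianRing (R ⧸ maximalIdeal R ^ k) := by
  rw [isArtinianRing_iff_isNoetherianRing_krullDimLE_zero]
  refine ⟨inferInstance, ?_⟩
  refine Ring.KrullDimLE.mk₀ fun P hP => ?_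
  have h1 : (P.comap (Ideal.Quotient.mk (maximalIdeal R ^ k))) = maximalIdeal R := by
    have hp : (P.comap (Ideal.Quotient.mk (maximalIdeal R ^ k))).IsPrime := inferInstance
    refine le_antisymm (le_maximalIdeal hp.ne_top) ?_
    refine Ideal.IsPrime.le_of_pow_le (n := k) ?_
    intro r hr
    rw [Ideal.mem_comap, Ideal.Quotient.eq_zero_iff_mem.2 hr]
    exact zero_mem _
  have h2 : (P.comap (Ideal.Quotient.mk (maximalIdeal R ^ k))).IsMaximal :=
    (congrArg Ideal.IsMaximal h1).mpr (maximalIdeal.isMaximal R)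
  rw [← Ideal.map_comap_of_surjective _ Ideal.Quotient.mk_surjective P]
  refine (Ideal.map_eq_top_or_isMaximal_of_surjective _ Ideal.Quotient.mk_surjective h2).resolve_left ?_
  rw [Ideal.map_comap_of_surjective _ Ideal.Quotient.mk_surjective P]
  exact hP.ne_top

lemma stab (J : ℕ → Ideal R) (hJ : Antitone J) (k : ℕ) :
    ∃ N, ∀ n, N ≤ n → J N ≤ J n ⊔ maximalIdeal R ^ k := by
  have := artinian_quot (R := R) k
  let f : ℕ →o (Ideal (R ⧸ maximalIdeal R ^ k))ᵒᵈ :=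
    ⟨fun n => OrderDual.toDual ((J n).map (Ideal.Quotient.mk _)), fun a b h =>
      OrderDual.toDual_le_toDual.2 (Ideal.map_mono (hJ h))⟩
  obtain ⟨N, hN⟩ := IsArtinian.monotone_stabilizes f
  refine ⟨N, fun n hn x hx => ?_⟩
  have h1 : (J N).map (Ideal.Quotient.mk (maximalIdeal R ^ k)) =
    (J n).map (Ideal.Quotient.mk _) := hN n hn
  have h2 := Ideal.mem_map_of_mem (Ideal.Quotient.mk (maximalIdeal R ^ k)) hx
  rw [h1] at h2
  obtain ⟨y, hy, hxy⟩ := (Ideal.mem_map_iff_of_surjective _ Ideal.Quotient.mk_surjective).1 h2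
  rw [eq_comm, Ideal.Quotient.eq] at hxy
  exact Submodule.mem_sup.2 ⟨y, hy, x - y, hxy, by ring⟩

lemma chev [IsAdicComplete (maximalIdeal R) R] (J : ℕ → Ideal R) (hJ : Antitone J)
    (h0 : ∀ x, (∀ n, x ∈ J n) → x = 0) (k0 : ℕ) : ∃ n, J n ≤ maximalIdeal R ^ k0 := by
  by_contra hcon
  push Not at hcon
  choose N hN using stab J hJ
  let M : ℕ → ℕ := fun k => ∑ j ∈ Finset.range (k + 1), (N j + 1)
  have hM1 : ∀ k, N k ≤ M k := by
    intro k
    simp only [M, Finset.sum_range_succ]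
    omega
  have hM2 : ∀ k, M k ≤ M (k + 1) := by
    intro k
    simp only [M, Finset.sum_range_succ _ (k + 1)]
    omega
  have hM3 : ∀ k, k ≤ M k := by
    intro k
    induction k with
    | zero => omega
    | succ k ih =>
      simp only [M, Finset.sum_range_succ _ (k + 1)] at ih ⊢
      omega
  have step : ∀ k (x : J (M k)), ∃ y : J (M (k + 1)), (y : R) - x ∈ maximalIdeal R ^ k := by
    intro k x
    have h1 := hN k (M (k + 1)) ((hM1 k).trans (hM2 k)) (hJ (hM1 k) x.2)
    obtain ⟨y, hy, z, hz, hyz⟩ := Submodule.mem_sup.1 h1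
    refine ⟨⟨y, hy⟩, ?_⟩
    rw [← hyz]
    have : (y - (y + z)) = -z := by ring
    show y - (y + z) ∈ _
    rw [this]
    exact neg_mem hz
  choose nx hnx using step
  obtain ⟨x0, hx0, hx0'⟩ := Set.not_subset.1 (hcon (M k0))
  let X : ∀ j, J (M (k0 + j)) := fun j => Nat.rec ⟨x0, hx0⟩ (fun j x => nx (k0 + j) x) j
  have hX : ∀ j, ((X (j + 1)).1 - (X j).1) ∈ maximalIdeal R ^ (k0 + j) := fun j => hnx (k0 + j) (X j)
  have hX' : ∀ {m n}, m ≤ n → ((X n).1 - (X m).1) ∈ maximalIdeal R ^ (k0 + m) := by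
    intro m n hmn
    induction n, hmn using Nat.le_induction with
    | base => simp
    | succ n hmn ih =>
      have := add_mem (Ideal.pow_le_pow_right (by omega) (hX n)) ih
      convert this using 1
      ring
  obtain ⟨L, hL⟩ := IsPrecomplete.prec' (I := maximalIdeal R) (M := R) (fun n => (X n).1) (by
    intro m n hmn
    rw [SModEq.comm, SModEq.sub_mem]
    have := Ideal.pow_le_pow_right (by omega : m ≤ k0 + m) (hX' hmn)
    simpa using this)
  have hL' : ∀ n, (X n).1 - L ∈ maximalIdeal R ^ n := by
    intro n
    have := hL n
    rw [SModEq.sub_mem] at this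
    simpa using this
  have hL0 : L = 0 := by
    apply h0
    intro n
    apply closed_ideal
    intro j
    have h1 : (X (n + j)).1 ∈ J n := hJ ((hM3 _).trans' (by omega)) (X (n + j)).2
    have h2 := Ideal.pow_le_pow_right (by omega : j ≤ n + j) (hL' (n + j))
    exact Submodule.mem_sup.2 ⟨_, h1, _, neg_mem h2, by ring⟩
  apply hx0'
  have h3 := hL' k0
  rw [hL0, sub_zero] at h3
  have h4 := sub_mem h3 (Ideal.pow_le_pow_right (by omega) (hX' (Nat.zero_le k0)))
  have : (X k0).1 - ((X k0).1 - (X 0).1) = x0 := by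
    exact (sub_sub_cancel _ _).trans rfl
  rwa [this] at h4

lemma chev_prime [IsDomain R] [IsAdicComplete (maximalIdeal R) R] (P : Ideal R) [hP : P.IsPrime]
    (hPm : P ≠ maximalIdeal R) (n : ℕ) :
    ∃ n', n ≤ n' ∧ ∀ x k, (∀ r ∈ maximalIdeal R ^ k, r * x ∈ P ^ n') → x ∈ P ^ n := by
  have hmP : ∀ k, ∃ t ∈ maximalIdeal R ^ k, t ∉ P := by
    intro k
    by_contra hcon
    push Not at hcon
    exact hPm (le_antisymm (le_maximalIdeal hP.ne_top)
      (Ideal.IsPrime.le_of_pow_le (n := k) (fun x hx => hcon x hx)))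
  let J : ℕ → Ideal R := fun n =>
    { carrier := {x | ∃ k, ∀ r ∈ maximalIdeal R ^ k, r * x ∈ P ^ n}
      zero_mem' := ⟨0, by simp⟩
      add_mem' := by
        rintro x y ⟨k, hk⟩ ⟨l, hl⟩
        refine ⟨k + l, fun r hr => ?_⟩
        rw [mul_add]
        exact add_mem (hk r (Ideal.pow_le_pow_right (by omega) hr))
          (hl r (Ideal.pow_le_pow_right (by omega) hr))
      smul_mem' := by
        rintro c x ⟨k, hk⟩
        refine ⟨k, fun r hr => ?_⟩
        rw [smul_eq_mul, mul_left_comm]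
        exact Ideal.mul_mem_left _ _ (hk r hr) }
  have hJ : Antitone J := by
    rintro a b hab x ⟨k, hk⟩
    exact ⟨k, fun r hr => Ideal.pow_le_pow_right hab (hk r hr)⟩
  have hJ0 : ∀ x, (∀ n, x ∈ J n) → x = 0 := by
    intro x hx
    let A := Localization.AtPrime P
    have h1 : algebraMap R A x ∈ (⨅ i : ℕ, (maximalIdeal A) ^ i : Ideal A) := by
      rw [Submodule.mem_iInf]
      intro i
      obtain ⟨k, hk⟩ := hx i
      obtain ⟨t, ht, htP⟩ := hmP k
      have h2 := Ideal.mem_map_of_mem (algebraMap R A) (hk t ht)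
      rw [Ideal.map_pow, Localization.AtPrime.map_eq_maximalIdeal, map_mul] at h2
      have hu : IsUnit (algebraMap R A t) := IsLocalization.map_units A (⟨t, htP⟩ : P.primeCompl)
      exact (Ideal.unit_mul_mem_iff_mem _ hu).1 h2
    have : IsNoetherianRing A := IsLocalization.isNoetherianRing P.primeCompl A inferInstance
    rw [Ideal.iInf_pow_eq_bot_of_isLocalRing _ (maximalIdeal.isMaximal A).ne_top] at h1
    have h2 : algebraMap R A x = algebraMap R A 0 := by rw [map_zero]; exact h1
    exact IsLocalization.injective A P.primeCompl_le_nonZeroDivisors h2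
  -- `m^k0 J n ⊆ P^n`
  have hk0 : ∃ k0, ∀ r ∈ maximalIdeal R ^ k0, ∀ x ∈ J n, r * x ∈ P ^ n := by
    obtain ⟨t, ht⟩ := IsNoetherian.noetherian (J n)
    have : ∀ x : R, ∃ k, x ∈ J n → ∀ r ∈ maximalIdeal R ^ k, r * x ∈ P ^ n := by
      intro x
      by_cases hx : x ∈ J n
      · obtain ⟨k, hk⟩ := hx
        exact ⟨k, fun _ => hk⟩
      · exact ⟨0, fun h => absurd h hx⟩
    choose k hk using this
    refine ⟨t.sup k, fun r hr x hx => ?_⟩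
    have hx' : x ∈ Submodule.span R (t : Set R) := ht ▸ hx
    induction hx' using Submodule.span_induction with
    | mem y hy =>
      exact hk y (ht ▸ Submodule.subset_span hy) r (Ideal.pow_le_pow_right (Finset.le_sup hy) hr)
    | zero => simp
    | add y z hy hz h1 h2 =>
      rw [mul_add]; exact add_mem (h1 (ht ▸ hy)) (h2 (ht ▸ hz))
    | smul c y hy h =>
      rw [smul_eq_mul, mul_left_comm]
      exact Ideal.mul_mem_left _ _ (h (ht ▸ hy))
  obtain ⟨k0, hk0⟩ := hk0
  obtain ⟨c, hc⟩ := Ideal.exists_pow_inf_eq_pow_smul (maximalIdeal R) (J n)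
  obtain ⟨n1, hn1⟩ := chev J hJ hJ0 (k0 + c)
  refine ⟨max n n1, le_max_left _ _, fun x k hx => ?_⟩
  have hxJ : x ∈ J (max n n1) := ⟨k, hx⟩
  have hx1 : x ∈ maximalIdeal R ^ (k0 + c) := hn1 (hJ (le_max_right _ _) hxJ)
  have hx2 : x ∈ J n := hJ (le_max_left _ _) hxJ
  have hx3 : x ∈ (maximalIdeal R ^ (k0 + c) • ⊤ ⊓ J n : Submodule R R) := ⟨by simpa using hx1, hx2⟩
  rw [hc (k0 + c) (by omega)] at hx3
  have hle : (maximalIdeal R ^ (k0 + c - c) • (maximalIdeal R ^ c • ⊤ ⊓ J n) : Submodule R R) ≤ P ^ n := by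
    rw [Submodule.smul_le]
    intro r hr y hy
    rw [Nat.add_sub_cancel] at hr
    exact hk0 r hr y hy.2
  exact hle hx3

end
end LC

end fileA2

section fileLC8

namespace LC

open CategoryTheory.Abelian IsLocalRing
open scoped Pointwise

lemma sup_pow_le {R : Type u} [CommRing R] (b I : Ideal R) (k : ℕ) : (b ⊔ I) ^ k ≤ b ⊔ I ^ k := by
  induction k with
  | zero => simp
  | succ k ih =>
    rw [pow_succ]
    refine (Ideal.mul_mono_left ih).trans ?_
    rw [Ideal.sup_mul, Ideal.mul_sup (I ^ k), ← pow_succ]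
    refine sup_le ?_ (sup_le ?_ ?_)
    · exact le_trans (Ideal.mul_le_left (I := b)) le_sup_left
    · exact le_trans (Ideal.mul_le_right (J := b)) le_sup_left
    · exact le_sup_right

section restop
variable {R : Type u} [CommRing R] [IsNoetherianRing R] [IsLocalRing R] [IsDomain R] {d : ℕ}

lemma dim_zero_max (hd : ringKrullDim R ≤ (0 : WithBot ℕ∞)) (z : R) (hz : z ∈ maximalIdeal R) :
    z = 0 := by
  by_contra hz0
  have h2 := ringKrullDim_quotient_succ_le_of_nonZeroDivisor (mem_nonZeroDivisors_of_ne_zero hz0)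
  have h3 := wb_lt (d := 0) (h2.trans hd)
  have : Nontrivial (R ⧸ Ideal.span {z}) := by
    apply Ideal.Quotient.nontrivial_iff.2
    intro h
    have : Ideal.span {z} ≤ maximalIdeal R := (Ideal.span_singleton_le_iff_mem _).2 hz
    rw [h] at this
    exact (maximalIdeal.isMaximal R).ne_top (top_le_iff.1 this)
  have h4 := ringKrullDim_nonneg_of_nontrivial (R := R ⧸ Ideal.span {z})
  exact absurd h3 (not_lt.2 h4)

lemma res_top_step (hd : ringKrullDim R ≤ (d : WithBot ℕ∞)) (b : Ideal R) (z : R)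
    (hz : z ∈ maximalIdeal R) (hb : b ≤ b ⊔ Ideal.span {z}) :
    Function.Surjective (res hb d (ModuleCat.of R R)) := by
  by_cases hz0 : z = 0
  · have hbz : (b ⊔ Ideal.span {z}) ^ 1 ≤ b ⊔ ⊥ := by simp [hz0]
    refine (res_bij (c := ⊥) hb hbz d _ ?_).2
    intro x
    exact ⟨1, fun r hr => by
      rw [pow_one] at hr
      rw [(Submodule.mem_bot R).1 hr]
      exact zero_smul R x⟩
  cases d with
  | zero => exact absurd (dim_zero_max (by simpa using hd) z hz) hz0
  | succ d =>
    intro h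
    obtain ⟨k, hk⟩ := H_tors_max b (d + 1) hd R z hz h
    have hreg : IsSMulRegular R (z ^ k) := fun x y hxy => mul_left_cancel₀ (pow_ne_zero k hz0) hxy
    have hS := msc_exact (M := R) (z ^ k) hreg
    obtain ⟨h', hh'⟩ := exact₁ hS b rfl (h := h) (by
      rw [map_lsmul]; exact hk)
    have hbz : (b ⊔ Ideal.span {z}) ^ k ≤ b ⊔ Ideal.span {z ^ k} := by
      rw [← Ideal.span_singleton_pow]
      exact sup_pow_le _ _ k
    obtain ⟨h'', rfl⟩ := (res_bij (c := Ideal.span {z ^ k}) hb hbz d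
      (ModuleCat.of R (R ⧸ LinearMap.range (LinearMap.lsmul R R (z ^ k)))) (by
        intro x
        refine ⟨1, fun r hr => ?_⟩
        rw [pow_one] at hr
        obtain ⟨y, rfl⟩ := Submodule.Quotient.mk_surjective _ x
        obtain ⟨c, rfl⟩ := Ideal.mem_span_singleton'.1 hr
        refine (Submodule.Quotient.mk_smul _ _ _).symm.trans ((Submodule.Quotient.mk_eq_zero _).2 ?_)
        exact ⟨c * y, by simp; ring⟩)).2 h'
    refine ⟨δ hS _ rfl h'', ?_⟩
    rw [← hh']
    exact res_δ hS hb rfl h''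

lemma res_top_surj (hd : ringKrullDim R ≤ (d : WithBot ℕ∞)) {a b : Ideal R} (hab : a ≤ b)
    (hb : b ≤ maximalIdeal R) : Function.Surjective (res hab d (ModuleCat.of R R)) := by
  classical
  obtain ⟨t, ht⟩ := IsNoetherian.noetherian b
  have key : ∀ s : Finset R, (s : Set R) ⊆ maximalIdeal R → ∀ hle : a ≤ a ⊔ Ideal.span (s : Set R),
      Function.Surjective (res hle d (ModuleCat.of R R)) := by
    intro s
    induction s using Finset.induction_on with
    | empty =>
      intro _ hle
      refine (res_bij (c := ⊥) hle (N := 1) (by simp) d _ ?_).2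
      intro x
      exact ⟨1, fun r hr => by
        rw [pow_one] at hr
        rw [(Submodule.mem_bot R).1 hr]
        exact zero_smul R x⟩
    | insert z s hzs ih =>
      intro hs hle h
      rw [Finset.coe_insert, Set.insert_subset_iff] at hs
      obtain ⟨h', rfl⟩ := ih hs.2 le_sup_left h
      have heq : a ⊔ Ideal.span ((insert z s : Finset R) : Set R) =
          (a ⊔ Ideal.span (s : Set R)) ⊔ Ideal.span {z} := by
        rw [Finset.coe_insert, Ideal.span_insert]
        ac_rfl
      revert hle
      rw [heq]
      intro hle
      obtain ⟨h'', rfl⟩ := res_top_step hd (a ⊔ Ideal.span (s : Set R)) z hs.1 le_sup_left h'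
      exact ⟨h'', (res_res _ _ _).symm⟩
  have hb' : b = a ⊔ Ideal.span (t : Set R) := by
    rw [show Ideal.span (t : Set R) = b from ht]
    exact (sup_eq_right.2 hab).symm
  have htm : (t : Set R) ⊆ maximalIdeal R := fun x hx => hb (by
    rw [← ht]; exact Submodule.subset_span hx)
  have := key t htm
  revert hab
  rw [hb']
  exact this

end restop

section dual
variable {R : Type u} [CommRing R] [IsNoetherianRing R] [IsLocalRing R] {d : ℕ}
  {E : Type u} [AddCommGroup E] [Module R E]

variable (R d E) in
/-- the canonical module -/
abbrev KK : Type u := H (maximalIdeal R) d (ModuleCat.of R R) →ₗ[R] E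

set_option maxHeartbeats 1000000 in
lemma exists_trace (hE : IsE R E) (hd : ringKrullDim R ≤ (d : WithBot ℕ∞))
    [Module.Finite R (KK R d E)] :
    ∃ τ : H (maximalIdeal R) d (ModuleCat.of R (KK R d E)) →ₗ[R] E,
      ∀ (u : KK R d E) (h : H (maximalIdeal R) d (ModuleCat.of R R)),
        τ (mp (maximalIdeal R) d (LinearMap.toSpanSingleton R (KK R d E) u) h) = u h := by
  obtain ⟨r, π, hπ⟩ := exists_free (R := R) (KK R d E)
  let w : H (maximalIdeal R) d (ModuleCat.of R (Fin r → R)) →ₗ[R] E :=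
    ∑ i, (π (Pi.single i 1)) ∘ₗ mp (maximalIdeal R) d (LinearMap.proj i)
  have hw : ∀ (f : Fin r → R) (h0 : H (maximalIdeal R) d (ModuleCat.of R R)),
      w (mp (maximalIdeal R) d (LinearMap.toSpanSingleton R _ f) h0) = π f h0 := by
    intro f h0
    have h1 : ∀ i, mp (maximalIdeal R) d (LinearMap.proj i)
      (mp (maximalIdeal R) d (LinearMap.toSpanSingleton R _ f) h0) = f i • h0 := by
      intro i
      rw [mp_mp, show (LinearMap.proj i : (Fin r → R) →ₗ[R] R) ∘ₗ
        LinearMap.toSpanSingleton R _ f = f i • LinearMap.id by ext; simp, mp_smul, mp_id]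
    have h2 : π f = ∑ i, f i • π (Pi.single i 1) := by
      conv_lhs => rw [pi_eq_sum_univ' f]
      simp [map_sum, map_smul]
    rw [h2]
    simp only [w, LinearMap.sum_apply, LinearMap.comp_apply, h1, map_smul, LinearMap.smul_apply]
  have hS := sc_exact (LinearMap.ker π).subtype π (LinearMap.exact_subtype_ker_map π)
    (Submodule.injective_subtype _) hπ
  have hker : w ∘ₗ mp (maximalIdeal R) d (LinearMap.ker π).subtype = 0 := by
    refine top_ext hd _ _ _ fun m h0 => ?_
    rw [LinearMap.comp_apply, mp_mp, show (LinearMap.ker π).subtype ∘ₗ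
      LinearMap.toSpanSingleton R _ m = LinearMap.toSpanSingleton R _ m.1 by ext; simp, hw,
      show π m.1 = 0 from m.2]
    rfl
  obtain ⟨τ, hτ⟩ := hE.factor (mp (maximalIdeal R) d π) w (by
    intro x hx
    obtain ⟨y, rfl⟩ := exact₂ hS (maximalIdeal R) (h := x) hx
    exact LinearMap.congr_fun hker y)
  refine ⟨τ, fun u h => ?_⟩
  obtain ⟨f, rfl⟩ := hπ u
  have h3 : LinearMap.toSpanSingleton R (KK R d E) (π f) =
      π ∘ₗ LinearMap.toSpanSingleton R _ f := by
    apply LinearMap.ext_ring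
    simp
  rw [← hw, ← hτ, mp_mp, h3]


lemma trace_nondeg (τ : H (maximalIdeal R) d (ModuleCat.of R (KK R d E)) →ₗ[R] E)
    (hτ : ∀ (u : KK R d E) (h : H (maximalIdeal R) d (ModuleCat.of R R)),
        τ (mp (maximalIdeal R) d (LinearMap.toSpanSingleton R (KK R d E) u) h) = u h)
    {M : Type u} [AddCommGroup M] [Module R M] (e : M →ₗ[R] KK R d E)
    (he : ∀ h, τ (mp (maximalIdeal R) d e h) = 0) : e = 0 := by
  ext m h0
  have := he (mp (maximalIdeal R) d (LinearMap.toSpanSingleton R M m) h0)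
  rw [mp_mp, show e ∘ₗ LinearMap.toSpanSingleton R M m = LinearMap.toSpanSingleton R _ (e m) by
    apply LinearMap.ext_ring; simp, hτ] at this
  exact this

lemma trace_rep (hd : ringKrullDim R ≤ (d : WithBot ℕ∞)) (τ : H (maximalIdeal R) d (ModuleCat.of R (KK R d E)) →ₗ[R] E)
    (hτ : ∀ (u : KK R d E) (h : H (maximalIdeal R) d (ModuleCat.of R R)),
        τ (mp (maximalIdeal R) d (LinearMap.toSpanSingleton R (KK R d E) u) h) = u h)
    {M : Type u} [AddCommGroup M] [Module R M] [Module.Finite R M]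
    (w : H (maximalIdeal R) d (ModuleCat.of R M) →ₗ[R] E) :
    ∃ e : M →ₗ[R] KK R d E, ∀ h, τ (mp (maximalIdeal R) d e h) = w h := by
  let e : M →ₗ[R] KK R d E :=
    { toFun := fun m => w ∘ₗ mp (maximalIdeal R) d (LinearMap.toSpanSingleton R M m)
      map_add' := fun x y => by
        ext h
        simp only [LinearMap.comp_apply, LinearMap.add_apply]
        rw [LinearMap.toSpanSingleton_add, mp_add, map_add]
      map_smul' := fun r x => by
        ext h
        simp only [LinearMap.comp_apply, LinearMap.smul_apply, RingHom.id_apply]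
        rw [LinearMap.toSpanSingleton_smul, mp_smul, map_smul] }
  refine ⟨e, fun h => ?_⟩
  have : τ ∘ₗ mp (maximalIdeal R) d e = w := by
    refine top_ext hd _ _ _ fun m h0 => ?_
    rw [LinearMap.comp_apply, mp_mp, show e ∘ₗ LinearMap.toSpanSingleton R M m =
      LinearMap.toSpanSingleton R _ (e m) by apply LinearMap.ext_ring; simp, hτ]
    rfl
  exact LinearMap.congr_fun this h

lemma trace_ext (hE : IsE R E) (hd : ringKrullDim R ≤ (d : WithBot ℕ∞)) (τ : H (maximalIdeal R) d (ModuleCat.of R (KK R d E)) →ₗ[R] E)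
    (hτ : ∀ (u : KK R d E) (h : H (maximalIdeal R) d (ModuleCat.of R R)),
        τ (mp (maximalIdeal R) d (LinearMap.toSpanSingleton R (KK R d E) u) h) = u h)
    (s : R) (hs : ∀ i < d, ∀ h : H (maximalIdeal R) i (ModuleCat.of R R), s • h = 0)
    (j : ℕ) : ∀ (i : ℕ) (hij : i + j = d) (M : Type u) [AddCommGroup M] [Module R M]
    [Module.Finite R M] (e : Ext (ModuleCat.of R M) (ModuleCat.of R (KK R d E)) j),
    (∀ h, τ (comp (maximalIdeal R) e hij h) = 0) → s ^ j • e = 0 := by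
  induction j with
  | zero =>
    intro i hij M _ _ _ e he
    obtain ⟨f, rfl⟩ := (Ext.mk₀_bijective _ _).2 e
    obtain rfl : i = d := by omega
    have := trace_nondeg τ hτ f.hom he
    have hf : f = 0 := by
      exact ModuleCat.hom_ext this
    rw [hf, Ext.mk₀_zero, smul_zero]
  | succ j ih =>
    intro i hij M _ _ _ e he
    obtain ⟨r, π, hπ⟩ := exists_free (R := R) M
    have hS := sc_exact (LinearMap.ker π).subtype π (LinearMap.exact_subtype_ker_map π)
      (Submodule.injective_subtype _) hπ
    have : Projective (ModuleCat.of R (Fin r → R)) :=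
      (IsProjective.iff_projective _).1 inferInstance
    obtain ⟨e', rfl⟩ := Ext.contravariant_sequence_exact₃ hS _ e (Ext.eq_zero_of_projective _)
      (by omega : 1 + j = j + 1)
    have hij' : i + 1 + j = d := by omega
    obtain ⟨ψ, hψ⟩ := hE.factor (mp (maximalIdeal R) (i + 1) (LinearMap.ker π).subtype)
      (τ ∘ₗ comp (maximalIdeal R) e' hij') (by
        intro x hx
        obtain ⟨y, rfl⟩ := exact₁ hS (maximalIdeal R) rfl (h := x) hx
        rw [LinearMap.comp_apply, δ, comp_comp _ _ _ _ _ (by omega) hij]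
        exact he y)
    cases j with
    | zero =>
      obtain rfl : i + 1 = d := by omega
      obtain ⟨w, hw⟩ := trace_rep hd τ hτ ψ
      obtain ⟨f, rfl⟩ := (Ext.mk₀_bijective _ _).2 e'
      have h0 : f.hom - w ∘ₗ (LinearMap.ker π).subtype = 0 := by
        refine trace_nondeg τ hτ _ fun h => ?_
        rw [sub_eq_add_neg, mp_add, ← neg_one_smul R, mp_smul, ← mp_mp, map_add, map_smul, hw, hψ]
        rw [neg_one_smul, ← sub_eq_add_neg, sub_eq_zero]
        rfl
      have h1 : f = (ModuleCat.ofHom (LinearMap.ker π).subtype) ≫ ModuleCat.ofHom w := by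
        apply ModuleCat.hom_ext
        exact sub_eq_zero.1 h0
      rw [h1, ← Ext.mk₀_comp_mk₀]
      rw [← Ext.comp_assoc _ _ _ (by omega : 1 + 0 = 1) _ (by omega)]
      erw [hS.extClass_comp]
      simp
    | succ j =>
      have h1 := ih (i + 1) hij' (LinearMap.ker π) (s • e') (by
        intro h
        rw [comp_smul, map_smul, ← map_smul, ← map_smul]
        refine (hψ (s • h)).symm.trans ?_
        rw [map_smul, kill_free (hs (i + 1) (by omega)), _root_.map_zero])
      rw [← Ext.comp_smul, pow_succ, mul_smul, h1, Ext.comp_zero]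

end dual

section A
variable {R : Type u} [CommRing R] [IsNoetherianRing R] [IsLocalRing R] [IsDomain R] {d : ℕ}
  [IsAdicComplete (maximalIdeal R) R]

lemma exists_kill_all (hd : ringKrullDim R = (d : WithBot ℕ∞)) {E : Type u} [AddCommGroup E]
    [Module R E] (hE : IsE R E) (n : ℕ) (hn : n ≤ d) : ∃ s : R, s ≠ 0 ∧
      ∀ i < n, ∀ h : H (maximalIdeal R) i (ModuleCat.of R R), s • h = 0 := by
  induction n with
  | zero => exact ⟨1, one_ne_zero, fun i hi => by omega⟩
  | succ n ih =>
    obtain ⟨s, hs, hk⟩ := ih (by omega)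
    obtain ⟨t, ht, hkt⟩ := hE.exists_kill n ⊥ (by
      rw [ringKrullDim_eq_of_ringEquiv (RingEquiv.quotientBot R), hd]
      exact_mod_cast hn) R
    refine ⟨s * t, mul_ne_zero hs ht, fun i hi h => ?_⟩
    rcases Nat.lt_succ_iff_lt_or_eq.1 hi with h1 | rfl
    · rw [mul_comm, mul_smul, hk i h1, smul_zero]
    · rw [mul_smul, hkt, smul_zero]

/-- local Hartshorne-Lichtenbaum for a complete domain -/
theorem HL (hd : ringKrullDim R = (d : WithBot ℕ∞)) (a : Ideal R) (ha : a ≤ maximalIdeal R)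
    (h : H a d (ModuleCat.of R R)) (hh : h ≠ 0) : ∃ N, maximalIdeal R ^ N ≤ a := by
  by_contra hcon
  have hP : ∃ P : Ideal R, P.IsPrime ∧ a ≤ P ∧ P ≠ maximalIdeal R := by
    by_contra hc
    push Not at hc
    apply hcon
    obtain ⟨N, hN⟩ := Ideal.exists_pow_le_of_le_radical_of_fg (I := maximalIdeal R) (J := a) (by
      rw [Ideal.radical_eq_sInf]
      exact le_sInf fun J hJ => (hc J hJ.2 hJ.1).ge) (IsNoetherian.noetherian _)
    exact ⟨N, hN⟩
  obtain ⟨P, hPp, haP, hPm⟩ := hP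
  obtain ⟨E, _, _, hE⟩ := exists_isE R
  obtain ⟨s, hs, hsk⟩ := exists_kill_all hd hE d le_rfl
  have hKf : Module.Finite R (KK R d E) := (hE.lemF d R).1
  obtain ⟨τ, hτ⟩ := exists_trace hE hd.le
  have htf : ∀ (s : R) (x : KK R d E), s ≠ 0 → s • x = 0 → x = 0 := by
    intro s x hs hx
    ext h
    obtain ⟨h', rfl⟩ := div_top hd.le _ s hs h
    rw [map_smul]
    exact LinearMap.congr_fun hx h'
  obtain ⟨h1, rfl⟩ := res_top_surj hd.le ha le_rfl h
  have hh1 : h1 ≠ 0 := by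
    rintro rfl
    exact hh (_root_.map_zero _)
  obtain ⟨u, hu⟩ := hE.sep h1 hh1
  obtain ⟨g, hg⟩ := tf_functional (KK R d E) htf u (by rintro rfl; exact hu rfl)
  have hPle : P ≤ maximalIdeal R := le_maximalIdeal hPp.ne_top
  -- `s^d` kills `H_P^d(K)`
  have hkill : ∀ h : H P d (ModuleCat.of R (KK R d E)), s ^ d • h = 0 := by
    intro h
    obtain ⟨n, e, rfl⟩ := mk_surj h
    obtain ⟨n', hnn', hn'⟩ := chev_prime P hPm n
    rw [← mk_pre hnn' (Ideal.pow_le_pow_right hnn') e, ← map_smul]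
    rw [trace_ext hE hd.le τ hτ s hsk d 0 (zero_add d) (R ⧸ P ^ n') _ ?_, _root_.map_zero]
    intro h0
    rw [pre_apply, ← comp_comp (k := 0) _ _ _ (by omega) (by omega)]
    have : map (maximalIdeal R) 0 (tr (Ideal.pow_le_pow_right hnn' : P ^ n' ≤ P ^ n)) h0 = 0 := by
      apply ev_inj
      rw [ev_map, _root_.map_zero]
      obtain ⟨k, hk⟩ := ev_torsion _ h0
      generalize ev _ _ h0 = x at hk
      obtain ⟨x, rfl⟩ := Ideal.Quotient.mk_surjective x
      have hx : x ∈ P ^ n := hn' x k (fun r hr => by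
        have := hk r hr
        exact Ideal.Quotient.eq_zero_iff_mem.1 this)
      exact Ideal.Quotient.eq_zero_iff_mem.2 hx
    erw [this]
    rw [_root_.map_zero, _root_.map_zero]
  have hkill2 : ∀ h : H P d (ModuleCat.of R R), (g u * s ^ d) • h = 0 := by
    intro h
    have h2 : mp P d (g ∘ₗ LinearMap.toSpanSingleton R _ u) h = g u • h := by
      rw [show g ∘ₗ LinearMap.toSpanSingleton R _ u = g u • LinearMap.id by
        apply LinearMap.ext_ring; simp, mp_smul, mp_id]
    rw [mul_comm, mul_smul, ← h2, ← mp_mp, ← map_smul, hkill, _root_.map_zero]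
  obtain ⟨h2, hh2⟩ := div_top hd.le a (g u * s ^ d) (mul_ne_zero hg (pow_ne_zero d hs))
    (res ha d (ModuleCat.of R R) h1)
  obtain ⟨h3, rfl⟩ := res_top_surj hd.le haP hPle h2
  apply hh
  rw [← hh2, ← map_smul, hkill2, _root_.map_zero]

end A

end LC

end fileLC8

section fileLC9

namespace LC

open CategoryTheory.Abelian IsLocalRing
open scoped Pointwise

section B
variable {C : Type u} [CommRing C] {d : ℕ}

lemma prime_min (hd : ringKrullDim C ≤ (d : WithBot ℕ∞)) (P : Ideal C)
    (hP : (d : WithBot ℕ∞) ≤ ringKrullDim (C ⧸ P)) (q : Ideal C) [q.IsPrime] (hq : q ≤ P) :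
    P ≤ q := by
  intro x hx
  by_contra hxq
  let xb : C ⧸ q := Ideal.Quotient.mk q x
  have hxb : xb ≠ 0 := fun h => hxq (Ideal.Quotient.eq_zero_iff_mem.1 h)
  have h1 := ringKrullDim_quotient_succ_le_of_nonZeroDivisor (mem_nonZeroDivisors_of_ne_zero hxb)
  have h2 : ringKrullDim (C ⧸ q) ≤ d := (ringKrullDim_quotient_le q).trans hd
  have h3 := wb_lt (h1.trans h2)
  have h4 : ringKrullDim (C ⧸ P) ≤ ringKrullDim ((C ⧸ q) ⧸ Ideal.span {xb}) := by
    refine ringKrullDim_le_of_surjective (Ideal.Quotient.lift (Ideal.span {xb})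
      (Ideal.Quotient.factor hq) ?_) ?_
    · intro z hz
      obtain ⟨c, rfl⟩ := Ideal.mem_span_singleton'.1 hz
      rw [map_mul, show Ideal.Quotient.factor hq xb = 0 from Ideal.Quotient.eq_zero_iff_mem.2 hx,
        mul_zero]
    · exact Ideal.Quotient.lift_surjective_of_surjective _ _ (Ideal.Quotient.factor_surjective hq)
  exact absurd (hP.trans h4) (not_le.2 h3)

lemma min_nil (P : Ideal C) [hP : P.IsPrime] (hmin : ∀ q : Ideal C, q.IsPrime → q ≤ P → P ≤ q)
    (x : C) (hx : x ∈ P) : ∃ s ∉ P, ∃ n : ℕ, s * x ^ n = 0 := by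
  by_contra hcon
  push Not at hcon
  obtain ⟨q, hq, -, hdis⟩ := Ideal.exists_le_prime_disjoint (⊥ : Ideal C)
    (P.primeCompl ⊔ Submonoid.powers x) (by
      rw [Set.disjoint_left]
      intro z hz hz'
      obtain ⟨s, hs, w, ⟨n, rfl⟩, hsw⟩ := Submonoid.mem_sup.1 hz'
      exact hcon s hs n (hsw.trans hz))
  rw [Set.disjoint_left] at hdis
  have hqP : q ≤ P := by
    intro z hz
    by_contra hzP
    exact hdis hz (Submonoid.mem_sup_left (S := P.primeCompl) hzP)
  exact hdis (hmin q hq hqP hx) (Submonoid.mem_sup_right (Submonoid.mem_powers x))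

/-- the `P`-primary component of zero -/
def QQ (P : Ideal C) [hP : P.IsPrime] : Ideal C where
  carrier := {q | ∃ s ∉ P, s * q = 0}
  zero_mem' := ⟨1, hP.one_notMem, by simp⟩
  add_mem' := by
    rintro x y ⟨s, hs, hsx⟩ ⟨t, ht, hty⟩
    refine ⟨s * t, fun h => (hP.mem_or_mem h).elim hs ht, ?_⟩
    linear_combination t * hsx + s * hty
  smul_mem' := by
    rintro c x ⟨s, hs, hsx⟩
    refine ⟨s, hs, ?_⟩
    rw [smul_eq_mul]
    linear_combination c * hsx

variable [IsNoetherianRing C] [IsLocalRing C] [IsAdicComplete (maximalIdeal C) C]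

lemma thmB (hd : ringKrullDim C ≤ (d : WithBot ℕ∞)) (P : Ideal C) [hPp : P.IsPrime]
    (hP : (d : WithBot ℕ∞) ≤ ringKrullDim (C ⧸ P)) (a : Ideal C) (ha : a ≤ maximalIdeal C) (N : ℕ)
    (hN : maximalIdeal C ^ N ≤ a ⊔ P) (y : C) (hy : ∀ r, r * y = 0 ↔ r ∈ P)
    (hk : ∀ h : H a d (ModuleCat.of C C), y • h = 0) (h : H a d (ModuleCat.of C (C ⧸ P))) :
    h = 0 := by
  have hmin : ∀ q : Ideal C, q.IsPrime → q ≤ P → P ≤ q := fun q hq hqP => prime_min hd P hP q hqP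
  have hQP : QQ P ≤ P := by
    rintro x ⟨s, hs, hsx⟩
    exact (hPp.mem_or_mem (hsx ▸ P.zero_mem : s * x ∈ P)).resolve_left hs
  obtain ⟨n, hn⟩ : ∃ n, P ^ n ≤ QQ P := by
    refine Ideal.exists_pow_le_of_le_radical_of_fg ?_ (IsNoetherian.noetherian _)
    intro x hx
    obtain ⟨s, hs, n, hsn⟩ := min_nil P hmin x hx
    exact ⟨n, s, hs, hsn⟩
  have hyQ : ∀ z, z * y ∈ QQ P → z ∈ P := by
    rintro z ⟨s, hs, hsz⟩
    rw [← mul_assoc, hy] at hsz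
    exact (hPp.mem_or_mem hsz).resolve_left hs
  let π : (C ⧸ QQ P) →ₗ[C] (C ⧸ P) := Submodule.factor hQP
  have hπ : Function.Surjective π := Submodule.factor_surjective hQP
  let ι : (C ⧸ P) →ₗ[C] (C ⧸ QQ P) := Submodule.liftQ P
    (LinearMap.toSpanSingleton C (C ⧸ QQ P) (Submodule.Quotient.mk y)) (by
      intro r hr
      rw [LinearMap.mem_ker, LinearMap.toSpanSingleton_apply, ← Submodule.Quotient.mk_smul,
        smul_eq_mul, (hy r).2 hr, Submodule.Quotient.mk_zero])
  have hι : Function.Injective ι := by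
    rw [injective_iff_map_eq_zero]
    intro x hx
    obtain ⟨z, rfl⟩ := Submodule.Quotient.mk_surjective _ x
    refine (Submodule.Quotient.mk_eq_zero _).2 (hyQ z ?_)
    exact (Submodule.Quotient.mk_eq_zero _).1 hx
  have hιπ : ι ∘ₗ π = y • LinearMap.id := by
    ext
    show (1 : C) • (Submodule.Quotient.mk y : C ⧸ QQ P) = y • Submodule.Quotient.mk 1
    rw [← Submodule.Quotient.mk_smul, ← Submodule.Quotient.mk_smul, smul_eq_mul, smul_eq_mul,
      one_mul, mul_one]
  have hkQ : ∀ h : H a d (ModuleCat.of C (C ⧸ QQ P)), y • h = 0 := by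
    intro h
    obtain ⟨h', rfl⟩ := mp_surj hd a (QQ P).mkQ (Submodule.mkQ_surjective _) h
    rw [← map_smul, hk, _root_.map_zero]
  have hι0 : ∀ h : H a d (ModuleCat.of C (C ⧸ P)), mp a d ι h = 0 := by
    intro h
    obtain ⟨h', rfl⟩ := mp_surj hd a π hπ h
    rw [mp_mp, hιπ, mp_smul, mp_id, hkQ]
  cases d with
  | zero =>
    apply ev_inj
    have h1 := congrArg (ev a _) (hι0 h)
    rw [ev_map, _root_.map_zero] at h1
    rw [_root_.map_zero]
    exact hι (h1.trans (_root_.map_zero ι).symm)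
  | succ d =>
    let G := (C ⧸ QQ P) ⧸ LinearMap.range ι
    have hS := sc_exact ι (LinearMap.range ι).mkQ (LinearMap.exact_map_mkQ_range _) hι
      (Submodule.mkQ_surjective _)
    have hG : IsTors P G := by
      intro g
      obtain ⟨g, rfl⟩ := Submodule.Quotient.mk_surjective _ g
      obtain ⟨g, rfl⟩ := Submodule.Quotient.mk_surjective _ g
      refine ⟨n, fun r hr => ?_⟩
      rw [← Submodule.Quotient.mk_smul, ← Submodule.Quotient.mk_smul]
      have h5 : (Submodule.Quotient.mk (r • g) : C ⧸ QQ P) = 0 :=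
        (Submodule.Quotient.mk_eq_zero (QQ P)).2 (Ideal.mul_mem_right g (QQ P) (hn hr))
      rw [h5, Submodule.Quotient.mk_zero]
    obtain ⟨E, _, _, hE⟩ := exists_isE C
    obtain ⟨s, hsP, hs⟩ := hE.exists_kill d P (lt_of_lt_of_le (by exact_mod_cast Nat.lt_succ_self d) hP) G
    have hsk : ∀ h : H a (d + 1) (ModuleCat.of C (C ⧸ P)), s • h = 0 := by
      intro h
      obtain ⟨h', rfl⟩ := exact₁ hS a rfl (hι0 h)
      obtain ⟨h'', rfl⟩ := (res_bij ha hN d (ModuleCat.of C G) hG).2 h'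
      rw [← map_smul]
      erw [← map_smul (res ha d (ModuleCat.of C G)), hs h'', _root_.map_zero]
    have hreg : IsSMulRegular (C ⧸ P) s := by
      intro x x' hxx
      obtain ⟨x, rfl⟩ := Submodule.Quotient.mk_surjective _ x
      obtain ⟨x', rfl⟩ := Submodule.Quotient.mk_surjective _ x'
      simp only [← Submodule.Quotient.mk_smul] at hxx
      rw [Submodule.Quotient.eq] at hxx ⊢
      rw [← smul_sub, smul_eq_mul] at hxx
      exact (hPp.mem_or_mem hxx).resolve_left hsP
    obtain ⟨h', hh'⟩ := exact₂ (msc_exact (M := C ⧸ P) s hreg) a (h := h) (by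
      refine H_eq_zero_of_dim a (d + 1) ((C ⧸ P) ⧸ LinearMap.range (LinearMap.lsmul C (C ⧸ P) s)) ?_ _
      have h1 := Module.supportDim_quotSMulTop_succ_le_of_notMem_minimalPrimes (R := C) (M := C ⧸ P)
        (x := s) (by
          intro p hp
          rw [Ideal.annihilator_quotient, Ideal.minimalPrimes_eq_subsingleton_self] at hp
          rw [Set.mem_singleton_iff.1 hp]
          exact hsP)
      have h2 : s • (⊤ : Submodule C (C ⧸ P)) = LinearMap.range (LinearMap.lsmul C (C ⧸ P) s) := by
        ext x
        simp [Submodule.mem_smul_pointwise_iff_exists]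
      unfold QuotSMulTop at h1
      rw [h2] at h1
      exact wb_lt (h1.trans ((Module.supportDim_le_ringKrullDim _ _).trans hd)))
    rw [← hh', map_lsmul, hsk]

end B

end LC

end fileLC9

section fileLC10

namespace LC

open CategoryTheory.Abelian IsLocalRing
open scoped Pointwise

section el
variable {R : Type u} [CommRing R]

lemma mem_smul_quot (J I : Ideal R) (x : R) :
    (Submodule.Quotient.mk x : R ⧸ I) ∈ J • (⊤ : Submodule R (R ⧸ I)) ↔ x ∈ J ⊔ I := by
  have h : J • (⊤ : Submodule R (R ⧸ I)) = Submodule.map I.mkQ J := by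
    have : (⊤ : Submodule R (R ⧸ I)) = Submodule.map I.mkQ ⊤ := by
      rw [Submodule.map_top, Submodule.range_mkQ]
    rw [this, ← Submodule.map_smul'', smul_eq_mul, Ideal.mul_top]
  rw [h]
  constructor
  · rintro ⟨z, hz, hzx⟩
    have h1 : z - x ∈ I := (Submodule.Quotient.eq I).1 hzx
    have : x = z - (z - x) := by ring
    rw [this]
    exact sub_mem (Ideal.mem_sup_left hz) (Ideal.mem_sup_right h1)
  · intro hx
    obtain ⟨z, hz, w, hw, rfl⟩ := Submodule.mem_sup.1 hx
    refine ⟨z, hz, (Submodule.Quotient.eq I).2 ?_⟩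
    simpa using hw

lemma elim_quot (L : List R) (y : R) (I : Ideal R) :
    Elim L y (R ⧸ I) ↔ ∀ n, ∃ k, L.prod ^ k * y ∈ PI L (n + k) ⊔ I := by
  constructor
  · intro h n
    obtain ⟨k, hk⟩ := h (Submodule.Quotient.mk 1) n
    refine ⟨k, ?_⟩
    rw [← Submodule.Quotient.mk_smul, ← Submodule.Quotient.mk_smul, mem_smul_quot] at hk
    simpa using hk
  · intro h m n
    obtain ⟨m, rfl⟩ := Submodule.Quotient.mk_surjective _ m
    obtain ⟨k, hk⟩ := h n
    refine ⟨k, ?_⟩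
    rw [← Submodule.Quotient.mk_smul, ← Submodule.Quotient.mk_smul, mem_smul_quot, smul_eq_mul,
      smul_eq_mul, ← mul_assoc]
    exact Ideal.mul_mem_right _ _ hk

lemma elim_self (L : List R) (y : R) :
    Elim L y R ↔ ∀ n, ∃ k, L.prod ^ k * y ∈ PI L (n + k) := by
  have h : ∀ j, PI L j • (⊤ : Submodule R R) = PI L j := fun j => by
    rw [smul_eq_mul]; exact Ideal.mul_top _
  constructor
  · intro hh n
    obtain ⟨k, hk⟩ := hh 1 n
    refine ⟨k, ?_⟩
    rw [h] at hk
    simpa using hk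
  · intro hh m n
    obtain ⟨k, hk⟩ := hh n
    refine ⟨k, ?_⟩
    rw [h, smul_eq_mul, smul_eq_mul, ← mul_assoc]
    exact Ideal.mul_mem_right _ _ hk

lemma PI_map {S : Type u} [CommRing S] (f : R →+* S) (L : List R) (j : ℕ) :
    PI (L.map f) j = (PI L j).map f := by
  rw [PI, PI, Ideal.map_ofList, List.map_map, List.map_map]
  congr 1
  apply List.map_congr_left
  intro x _
  simp

lemma elim_mul (L : List R) (y z : R) (h : Elim L y R) : Elim L (z * y) R := by
  rw [elim_self] at h ⊢
  intro n
  obtain ⟨k, hk⟩ := h n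
  refine ⟨k, ?_⟩
  rw [mul_left_comm]
  exact Ideal.mul_mem_left _ _ hk

end el

section Xc
variable {C : Type u} [CommRing C] [IsNoetherianRing C] {d : ℕ}

/-- a prime with nonvanishing top cohomology -/
lemma exists_prime_top (hd : ringKrullDim C ≤ (d : WithBot ℕ∞)) (a p : Ideal C)
    (hp : ¬ ∀ h : H a d (ModuleCat.of C (C ⧸ p)), h = 0) :
    ∃ P : Ideal C, P.IsPrime ∧ p ≤ P ∧ ¬ ∀ h : H a d (ModuleCat.of C (C ⧸ P)), h = 0 := by
  let S : Set (Ideal C) := {I | p ≤ I ∧ ¬ ∀ h : H a d (ModuleCat.of C (C ⧸ I)), h = 0}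
  obtain ⟨I, ⟨hpI, hI⟩, hmax⟩ := set_has_maximal_iff_noetherian.2 (inferInstance : IsNoetherian C C) S
    ⟨p, le_rfl, hp⟩
  have hmax' : ∀ J : Ideal C, I < J → ∀ h : H a d (ModuleCat.of C (C ⧸ J)), h = 0 := by
    intro J hJ
    by_contra hc
    exact hmax J ⟨hpI.trans hJ.le, hc⟩ hJ
  refine ⟨I, ?_, hpI, hI⟩
  constructor
  · rintro rfl
    apply hI
    intro h
    rw [← mp_id a d h, show (LinearMap.id : (C ⧸ (⊤ : Ideal C)) →ₗ[C] (C ⧸ (⊤ : Ideal C))) = 0 from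
      Subsingleton.elim _ _, mp_zero]
  · intro x y hxy
    by_contra hcon
    push Not at hcon
    obtain ⟨hx, hy⟩ := hcon
    apply hI
    intro h
    let f : C →ₗ[C] (C ⧸ I) := LinearMap.toSpanSingleton C (C ⧸ I) (Submodule.Quotient.mk x)
    have hf : ∀ r, f r = 0 ↔ r * x ∈ I := fun r => by
      rw [LinearMap.toSpanSingleton_apply, ← Submodule.Quotient.mk_smul, Submodule.Quotient.mk_eq_zero,
        smul_eq_mul]
    let K : Ideal C := LinearMap.ker f
    have hK : I < K := by
      refine lt_of_le_of_ne (fun r hr => (hf r).2 (Ideal.mul_mem_right _ _ hr)) ?_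
      intro h
      exact hy (h ▸ ((hf y).2 (by rwa [mul_comm])) : y ∈ I)
    let g : (C ⧸ K) →ₗ[C] (C ⧸ I) := Submodule.liftQ K f le_rfl
    have hg : Function.Injective g := by
      rw [← LinearMap.ker_eq_bot]
      exact Submodule.ker_liftQ_eq_bot _ _ _ le_rfl
    let J : Ideal C := I ⊔ Ideal.span {x}
    have hIJ : I < J := by
      refine lt_of_le_of_ne le_sup_left ?_
      intro h
      exact hx (h ▸ Ideal.mem_sup_right (Ideal.mem_span_singleton_self x) : x ∈ I)
    have hex : Function.Exact g (Submodule.factor hIJ.le) := by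
      intro z
      obtain ⟨z, rfl⟩ := Submodule.Quotient.mk_surjective _ z
      constructor
      · intro hz
        have hz' : z ∈ J := (Submodule.Quotient.mk_eq_zero J).1 hz
        obtain ⟨i, hi, w, hw, rfl⟩ := Submodule.mem_sup.1 hz'
        obtain ⟨c, rfl⟩ := Ideal.mem_span_singleton'.1 hw
        refine ⟨Submodule.Quotient.mk c, ?_⟩
        show f c = _
        rw [LinearMap.toSpanSingleton_apply, ← Submodule.Quotient.mk_smul, Submodule.Quotient.eq,
          smul_eq_mul]
        have : c * x - (i + c * x) = -i := by ring
        rw [this]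
        exact neg_mem hi
      · rintro ⟨c, hc⟩
        obtain ⟨c, rfl⟩ := Submodule.Quotient.mk_surjective _ c
        rw [← hc]
        refine (Submodule.Quotient.mk_eq_zero J).2 ?_
        exact Ideal.mem_sup_right (Ideal.mul_mem_left _ c (Ideal.mem_span_singleton_self x))
    have hS := sc_exact g (Submodule.factor hIJ.le) hex hg (Submodule.factor_surjective _)
    obtain ⟨h', rfl⟩ := exact₂ hS a (h := h) (hmax' J hIJ _)
    rw [hmax' K hK h', _root_.map_zero]

variable [IsLocalRing C] [IsAdicComplete (maximalIdeal C) C]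

instance locq {C : Type u} [CommRing C] [IsLocalRing C] (P : Ideal C) [hP : P.IsPrime] :
    IsLocalRing (C ⧸ P) :=
  IsLocalRing.of_surjective' (Ideal.Quotient.mk P) Ideal.Quotient.mk_surjective

lemma quot_complete (P : Ideal C) [hP : P.IsPrime] :
    IsAdicComplete (maximalIdeal (C ⧸ P)) (C ⧸ P) := by
  have hmap : maximalIdeal (C ⧸ P) = (maximalIdeal C).map (algebraMap C (C ⧸ P)) := by
    symm
    apply IsLocalRing.eq_maximalIdeal
    refine (Ideal.map_eq_top_or_isMaximal_of_surjective _ Ideal.Quotient.mk_surjective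
      (maximalIdeal.isMaximal C)).resolve_left ?_
    intro h
    have h1 := Ideal.comap_map_of_surjective (Ideal.Quotient.mk P) Ideal.Quotient.mk_surjective
      (maximalIdeal C)
    rw [h, Ideal.comap_top, ← RingHom.ker_eq_comap_bot, Ideal.mk_ker,
      sup_eq_left.2 (le_maximalIdeal hP.ne_top)] at h1
    exact (maximalIdeal.isMaximal C).ne_top h1.symm
  rw [hmap, IsAdicComplete.map_algebraMap_iff]
  have h1 : IsPrecomplete (maximalIdeal C) (C ⧸ P) :=
    prec_of_surj (maximalIdeal C) (Submodule.mkQ P) (Submodule.mkQ_surjective P)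
  have h2 : IsHausdorff (maximalIdeal C) (C ⧸ P) := by
    constructor
    intro x hx
    have h3 : x ∈ (⨅ i : ℕ, maximalIdeal C ^ i • ⊤ : Submodule C (C ⧸ P)) := by
      rw [Submodule.mem_iInf]
      intro i
      have := hx i
      rwa [SModEq.zero] at this
    rw [Ideal.iInf_pow_smul_eq_bot_of_isLocalRing _ (maximalIdeal.isMaximal C).ne_top] at h3
    exact h3
  exact { }

theorem thmXc (L : List C) (hL : ∀ x ∈ L, x ∈ maximalIdeal C)
    (hd : ringKrullDim C ≤ (L.length : WithBot ℕ∞)) (p : Ideal C) (y : C)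
    (hy : ∀ r, r * y = 0 ↔ r ∈ p) (hE : Elim L y C) : Elim L 1 (C ⧸ p) := by
  by_contra hcon
  have hLa : ∀ x ∈ L, x ∈ Ideal.ofList L := fun x hx => Ideal.subset_span hx
  have ham : Ideal.ofList L ≤ maximalIdeal C := Ideal.span_le.2 hL
  have e1 : ∀ (M : Type u) [AddCommGroup M] [Module C M] (z : C),
      (∀ h : H (Ideal.ofList L) L.length (ModuleCat.of C M), z • h = 0) ↔ Elim L z M :=
    fun M _ _ z => H_elim L hLa 1 (by rw [pow_one]) M z
  obtain ⟨P, hP, hpP, hPn⟩ := exists_prime_top hd (Ideal.ofList L) p (by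
    intro h
    exact hcon ((e1 (C ⧸ p) 1).1 fun h' => by rw [h h', smul_zero]))
  have hdP : (L.length : WithBot ℕ∞) ≤ ringKrullDim (C ⧸ P) := by
    by_contra hlt
    apply hPn
    intro h
    refine H_eq_zero_of_dim _ _ (C ⧸ P) ?_ h
    rw [Module.supportDim_quotient_eq_ringKrullDim]
    exact not_le.1 hlt
  have hmin : P ∈ p.minimalPrimes :=
    ⟨⟨hP, hpP⟩, fun q hq hqP => by
      have := hq.1
      exact prime_min hd P hdP q hqP⟩
  have hass : P ∈ associatedPrimes C (C ⧸ p) := by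
    apply Module.associatedPrimes.minimalPrimes_annihilator_subset_associatedPrimes
    rwa [Ideal.annihilator_quotient]
  obtain ⟨-, x, hx⟩ := ass_iff.1 hass
  obtain ⟨x, rfl⟩ := Submodule.Quotient.mk_surjective _ x
  have hxy : ∀ r, r * (x * y) = 0 ↔ r ∈ P := by
    intro r
    rw [hx r, ← Submodule.Quotient.mk_smul, Submodule.Quotient.mk_eq_zero, ← hy, smul_eq_mul,
      mul_assoc]
  have hk := (e1 C (x * y)).2 (elim_mul L y x hE)
  -- the domain
  have hPn' : ¬ Elim L 1 (C ⧸ P) := fun h => hPn fun h' => by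
    have := (e1 (C ⧸ P) 1).2 h h'
    rwa [one_smul] at this
  have : IsAdicComplete (maximalIdeal (C ⧸ P)) (C ⧸ P) := quot_complete P
  let L' := L.map (Ideal.Quotient.mk P)
  have hlen : L'.length = L.length := List.length_map _
  have hdim : ringKrullDim (C ⧸ P) = (L'.length : WithBot ℕ∞) := by
    rw [hlen]
    exact le_antisymm ((ringKrullDim_quotient_le P).trans hd) hdP
  have hel : ¬ Elim L' 1 (C ⧸ P) := by
    intro h
    apply hPn'
    rw [elim_self] at h
    rw [elim_quot]
    intro n
    obtain ⟨k, hk⟩ := h n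
    refine ⟨k, ?_⟩
    rw [PI_map, ← map_list_prod, ← map_pow, mul_one, ← Ideal.mem_comap,
      Ideal.comap_map_of_surjective _ Ideal.Quotient.mk_surjective, ← RingHom.ker_eq_comap_bot,
      Ideal.mk_ker] at hk
    rwa [mul_one]
  have hnz : ¬ ∀ h : H (Ideal.ofList L') L'.length (ModuleCat.of (C ⧸ P) (C ⧸ P)), h = 0 := by
    intro h
    apply hel
    rw [← H_elim L' (fun x hx => Ideal.subset_span hx) 1 (by rw [pow_one]; exact le_rfl)]
    intro h'
    rw [h h', smul_zero]
  push Not at hnz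
  obtain ⟨h0, hh0⟩ := hnz
  have hmk : ∀ z ∈ maximalIdeal C, Ideal.Quotient.mk P z ∈ maximalIdeal (C ⧸ P) := by
    intro z hz hu
    apply hz
    obtain ⟨w, hw⟩ := hu.exists_right_inv
    obtain ⟨w, rfl⟩ := Ideal.Quotient.mk_surjective w
    rw [← map_mul, ← map_one (Ideal.Quotient.mk P), Ideal.Quotient.eq] at hw
    by_contra hz'
    have h1 : z * w ∈ maximalIdeal C := Ideal.mul_mem_right _ _ hz'
    have h2 := sub_mem h1 (le_maximalIdeal hP.ne_top hw)
    rw [sub_sub_cancel] at h2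
    exact (maximalIdeal.isMaximal C).ne_top ((Ideal.eq_top_iff_one _).2 h2)
  obtain ⟨N, hN⟩ := HL hdim (Ideal.ofList L') (Ideal.span_le.2 (by
    intro z hz
    obtain ⟨w, hw, rfl⟩ := List.mem_map.1 (show z ∈ L.map (Ideal.Quotient.mk P) from hz)
    exact hmk w (hL w hw))) h0 hh0
  have hN' : maximalIdeal C ^ N ≤ Ideal.ofList L ⊔ P := by
    have h1 : (maximalIdeal C ^ N).map (Ideal.Quotient.mk P) ≤ (Ideal.ofList L).map (Ideal.Quotient.mk P) := by
      rw [Ideal.map_pow, Ideal.map_ofList]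
      refine le_trans (Ideal.pow_right_mono (Ideal.map_le_iff_le_comap.2 hmk) N) hN
    rw [Ideal.map_le_iff_le_comap, Ideal.comap_map_of_surjective _ Ideal.Quotient.mk_surjective,
      ← RingHom.ker_eq_comap_bot, Ideal.mk_ker] at h1
    exact h1
  exact hPn (thmB hd P hdP (Ideal.ofList L) ham N hN' (x * y) hxy hk)

end Xc

end LC

end fileLC10

section fileLC11

namespace LC

open CategoryTheory.Abelian IsLocalRing
open scoped Pointwise

section X
variable {R : Type u} [CommRing R] [IsNoetherianRing R] [IsLocalRing R]

/-- the completion -/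
abbrev CR (R : Type u) [CommRing R] [IsLocalRing R] : Type u := AdicCompletion (maximalIdeal R) R

lemma CR_noeth : IsNoetherianRing (CR R) := by
  apply noeth_of_complete
  rw [AdicCompletion.maximalIdeal_eq_map]
  exact Ideal.FG.map (maximalIdeal R).fg_of_isNoetherianRing _

lemma CR_dim : ringKrullDim (CR R) ≤ ringKrullDim R := by
  have := CR_noeth (R := R)
  rw [← maximalIdeal_height_eq_ringKrullDim, ← maximalIdeal_height_eq_ringKrullDim]
  have hl : (maximalIdeal (CR R)).LiesOver (maximalIdeal R) := by
    constructor
    exact (IsLocalRing.maximalIdeal_comap (algebraMap R (CR R))).symm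
  have h := Ideal.height_le_height_add_of_liesOver (maximalIdeal R) (maximalIdeal (CR R))
  have h0 : ((maximalIdeal (CR R)).map (Ideal.Quotient.mk <| (maximalIdeal R).map (algebraMap R (CR R)))) = ⊥ := by
    rw [AdicCompletion.maximalIdeal_eq_map, Ideal.map_quotient_self]
  have hnt : Nontrivial (CR R ⧸ (maximalIdeal R).map (algebraMap R (CR R))) := by
    rw [← AdicCompletion.maximalIdeal_eq_map]
    exact Ideal.Quotient.nontrivial_iff.2 (maximalIdeal.isMaximal _).ne_top
  rw [h0, Ideal.height_bot, add_zero] at h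
  exact_mod_cast h

lemma CR_contr (I : Ideal R) (x : R) (h : algebraMap R (CR R) x ∈ I.map (algebraMap R (CR R))) :
    x ∈ I := by
  apply closed_ideal
  intro j
  have h1 := Ideal.mem_map_of_mem (AdicCompletion.evalₐ (maximalIdeal R) j).toRingHom h
  rw [Ideal.map_map] at h1
  have h2 : (AdicCompletion.evalₐ (maximalIdeal R) j).toRingHom.comp (algebraMap R (CR R)) =
      Ideal.Quotient.mk (maximalIdeal R ^ j) := by
    ext r
    exact (AdicCompletion.evalₐ (maximalIdeal R) j).commutes r
  have h3 : (AdicCompletion.evalₐ (maximalIdeal R) j).toRingHom (algebraMap R (CR R) x) =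
      Ideal.Quotient.mk (maximalIdeal R ^ j) x := (AdicCompletion.evalₐ (maximalIdeal R) j).commutes x
  rw [h2, h3, ← Ideal.mem_comap, Ideal.comap_map_of_surjective _ Ideal.Quotient.mk_surjective,
    ← RingHom.ker_eq_comap_bot, Ideal.mk_ker] at h1
  exact h1

lemma CR_ann (p : Ideal R) (y : R) (hy : ∀ r, r * y = 0 ↔ r ∈ p) (c : CR R) :
    c * algebraMap R (CR R) y = 0 ↔ c ∈ p.map (algebraMap R (CR R)) := by
  constructor
  · intro h
    have h1 : ∑ i : Fin 1, (fun _ => y : Fin 1 → R) i • (fun _ => c : Fin 1 → CR R) i = 0 := by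
      rw [Fin.sum_univ_one, Algebra.smul_def, mul_comm, h]
    obtain ⟨k, a, z, h2, h3⟩ := Module.Flat.isTrivialRelation_of_sum_smul_eq_zero h1
    have h4 := h2 0
    simp only at h4
    rw [h4]
    refine Ideal.sum_mem _ fun j _ => ?_
    rw [Algebra.smul_def]
    refine Ideal.mul_mem_right _ _ (Ideal.mem_map_of_mem _ ((hy _).1 ?_))
    have := h3 j
    rw [Fin.sum_univ_one, mul_comm] at this
    exact this
  · intro h
    have h1 : p.map (algebraMap R (CR R)) ≤ LinearMap.ker (LinearMap.mulRight (CR R) (algebraMap R (CR R) y)) := by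
      rw [Ideal.map_le_iff_le_comap]
      intro r hr
      rw [Ideal.mem_comap, LinearMap.mem_ker, LinearMap.mulRight_apply, ← map_mul, (hy r).2 hr,
        _root_.map_zero]
    exact h1 h

theorem thmX (L : List R) (hL : ∀ x ∈ L, x ∈ maximalIdeal R)
    (hd : ringKrullDim R ≤ (L.length : WithBot ℕ∞)) (p : Ideal R) (y : R)
    (hy : ∀ r, r * y = 0 ↔ r ∈ p) (hE : Elim L y R) : Elim L 1 (R ⧸ p) := by
  have := CR_noeth (R := R)
  have h := thmXc (C := CR R) (L.map (algebraMap R (CR R))) (by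
      intro x hx
      obtain ⟨z, hz, rfl⟩ := List.mem_map.1 hx
      rw [AdicCompletion.maximalIdeal_eq_map]
      exact Ideal.mem_map_of_mem _ (hL z hz)) (by
      rw [List.length_map]
      exact CR_dim.trans hd) (p.map (algebraMap R (CR R))) (algebraMap R (CR R) y) (CR_ann p y hy) (by
      rw [elim_self] at hE ⊢
      intro n
      obtain ⟨k, hk⟩ := hE n
      refine ⟨k, ?_⟩
      rw [PI_map, ← map_list_prod, ← map_pow, ← map_mul]
      exact Ideal.mem_map_of_mem _ hk)
  rw [elim_quot] at h ⊢
  intro n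
  obtain ⟨k, hk⟩ := h n
  refine ⟨k, ?_⟩
  rw [PI_map, ← map_list_prod, ← map_pow, mul_one, ← Ideal.map_sup] at hk
  rw [mul_one]
  exact CR_contr _ _ hk

end X

section phase0
variable {R : Type u} [CommRing R] [IsNoetherianRing R]

lemma exists_list (a : Ideal R) (n : ℕ) : ∃ L : List R, L.length = n ∧ (∀ x ∈ L, x ∈ a) ∧
    ∀ q : Ideal R, q.IsPrime → Ideal.ofList L ≤ q → ¬ a ≤ q → (n : ℕ∞) ≤ q.height := by
  induction n with
  | zero => exact ⟨[], rfl, by simp, fun q _ _ _ => by simp⟩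
  | succ n ih =>
    obtain ⟨L, hlen, hL, hq⟩ := ih
    have hfin : ((Ideal.ofList L).minimalPrimes ∩ {q | ¬ a ≤ q}).Finite :=
      (Ideal.finite_minimalPrimes_of_isNoetherianRing R _).inter_of_left _
    obtain ⟨x, hxa, hx⟩ : ∃ x ∈ a, ∀ q ∈ (Ideal.ofList L).minimalPrimes, ¬ a ≤ q → x ∉ q := by
      by_contra hcon
      push Not at hcon
      have h1 := (a.subset_union_prime_finite hfin (f := id) 0 0 (fun q hq _ _ => hq.1.1.1)).1 (by
        intro x hx
        obtain ⟨q, hq1, hq2, hq3⟩ := hcon x hx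
        exact Set.mem_biUnion (show q ∈ _ from ⟨hq1, hq2⟩) hq3)
      obtain ⟨q, hq, hq'⟩ := h1
      exact hq.2 hq'
    refine ⟨x :: L, by simp [hlen], by simpa using ⟨hxa, hL⟩, ?_⟩
    intro q hqp hqL hqa
    rw [Ideal.ofList_cons] at hqL
    obtain ⟨q', hq', hq'q⟩ := Ideal.exists_minimalPrimes_le (le_sup_right.trans hqL)
    have hqp' := hq'.1.1
    have hna : ¬ a ≤ q' := fun h => hqa (h.trans hq'q)
    have hxq' := hx q' hq' hna
    have hxq : x ∈ q := hqL (Ideal.mem_sup_left (Ideal.mem_span_singleton_self x))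
    have hlt : q' < q := lt_of_le_of_ne hq'q (fun h => hxq' (h ▸ hxq))
    have h1 := hq q' hqp' hq'.1.2 hna
    have h2 : q'.height + 1 ≤ q.height := Ideal.height_add_one_le_of_lt_of_isPrime hlt
    push_cast
    exact (add_le_add h1 le_rfl).trans h2

variable [IsLocalRing R]

lemma exists_gens (a : Ideal R) (ha : a ≤ maximalIdeal R) (d : ℕ) (hd : ringKrullDim R ≤ (d : WithBot ℕ∞)) :
    ∃ L : List R, L.length = d ∧ (∀ x ∈ L, x ∈ a) ∧ ∃ N, a ^ N ≤ Ideal.ofList L := by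
  obtain ⟨L, hlen, hL, hq⟩ := exists_list a d
  refine ⟨L, hlen, hL, ?_⟩
  have h1 : a ≤ (Ideal.ofList L).radical := by
    rw [Ideal.radical_eq_sInf]
    refine le_sInf ?_
    rintro q ⟨hqL, hqp⟩
    by_contra hqa
    have h2 := hq q hqp hqL hqa
    have h3 : q < maximalIdeal R := lt_of_le_of_ne (le_maximalIdeal hqp.ne_top) (fun h => hqa (h ▸ ha))
    have h4 : q.height + 1 ≤ (maximalIdeal R).height := Ideal.height_add_one_le_of_lt_of_isPrime h3
    have h5 : (maximalIdeal R).height ≤ (d : ℕ∞) := by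
      rw [← maximalIdeal_height_eq_ringKrullDim] at hd
      exact_mod_cast hd
    have h6 := ((add_le_add h2 le_rfl).trans h4).trans h5
    have h7 : d + 1 ≤ d := by exact_mod_cast h6
    omega
  exact Ideal.exists_pow_le_of_le_radical_of_fg h1 a.fg_of_isNoetherianRing

end phase0

end LC

end fileLC11

section fileE1

namespace LC

variable {R : Type u} [CommRing R]

abbrev Cat (R : Type u) [CommRing R] := ModuleCat.{u} R
open Opposite
variable (d : ℕ) (Y : ModuleCat.{u} R)

/-- derived functor argument -/
noncomputable abbrev Fn : ModuleCat.{u} R ⥤ (ModuleCat.{u} R)ᵒᵖ :=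
  ((linearYoneda R (ModuleCat.{u} R)).obj Y).rightOp

/-- the complex -/
noncomputable abbrev KP {X : ModuleCat.{u} R} (P : ProjectiveResolution X) :
    ChainComplex (ModuleCat.{u} R)ᵒᵖ ℕ :=
  ((Fn Y).mapHomologicalComplex _).obj P.complex

/-- the old Ext -/
noncomputable abbrev OE (X : ModuleCat.{u} R) : ModuleCat.{u} R :=
  ((Ext R (ModuleCat.{u} R) d).obj (op X)).obj Y

noncomputable def q1 {X : ModuleCat.{u} R} (P : ProjectiveResolution X) :
    ((KP Y P).opcycles d).unop ⟶ OE d Y X :=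
  ((KP Y P).homologyι d).unop ≫ (P.isoLeftDerivedObj (Fn Y) d).hom.unop

noncomputable def i1 {X : ModuleCat.{u} R} (P : ProjectiveResolution X) :
    ((KP Y P).opcycles d).unop ⟶ ModuleCat.of R (P.complex.X d ⟶ Y) :=
  ((KP Y P).pOpcycles d).unop

lemma q1_surj {X : ModuleCat.{u} R} (P : ProjectiveResolution X) :
    Function.Surjective (q1 d Y P) := by
  have h1 : Function.Surjective ((KP Y P).homologyι d).unop :=
    (ModuleCat.epi_iff_surjective _).1 (unop_epi_of_mono _)
  have h2 : Function.Surjective (P.isoLeftDerivedObj (Fn Y) d).hom.unop :=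
    (ModuleCat.epi_iff_surjective _).1 (unop_epi_of_mono _)
  intro x
  obtain ⟨y, rfl⟩ := h2 x
  obtain ⟨z, rfl⟩ := h1 y
  exact ⟨z, rfl⟩

lemma q1_zero' {X : ModuleCat.{u} R} (P : ProjectiveResolution X)
    (w : ((KP Y P).opcycles d).unop) :
    q1 d Y P w = 0 ↔ ((KP Y P).homologyι d).unop w = 0 := by
  have h2 : Function.Injective (P.isoLeftDerivedObj (Fn Y) d).hom.unop :=
    (ModuleCat.mono_iff_injective _).1 (unop_mono_of_epi _)
  constructor
  · intro h
    apply h2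
    exact h.trans (_root_.map_zero (P.isoLeftDerivedObj (Fn Y) d).hom.unop.hom).symm
  · intro h
    change (P.isoLeftDerivedObj (Fn Y) d).hom.unop (((KP Y P).homologyι d).unop w) = 0
    rw [h]
    exact _root_.map_zero _

lemma i1_inj {X : ModuleCat.{u} R} (P : ProjectiveResolution X) :
    Function.Injective (i1 d Y P) :=
  (ModuleCat.mono_iff_injective _).1 (unop_mono_of_epi _)

lemma i1_d {X : ModuleCat.{u} R} (P : ProjectiveResolution X) (w : ((KP Y P).opcycles d).unop) :
    P.complex.d (d + 1) d ≫ (show P.complex.X d ⟶ Y from i1 d Y P w) = 0 := by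
  have h := congrArg Quiver.Hom.unop ((KP Y P).d_pOpcycles (d + 1) d)
  exact ConcreteCategory.congr_hom h w

lemma i1_ex {X : ModuleCat.{u} R} (P : ProjectiveResolution X) (f : P.complex.X d ⟶ Y)
    (hf : P.complex.d (d + 1) d ≫ f = 0) : ∃ w, i1 d Y P w = f := by
  let a : ModuleCat.of R R ⟶ ModuleCat.of R (P.complex.X d ⟶ Y) :=
    ModuleCat.ofHom (LinearMap.toSpanSingleton R _ f)
  let b : (KP Y P).X d ⟶ op (ModuleCat.of R R) := a.op
  have hb : (KP Y P).d (d + 1) d ≫ b = 0 := by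
    apply Quiver.Hom.unop_inj
    ext
    change P.complex.d (d + 1) d ≫ ((1 : R) • f) = 0
    rw [one_smul, hf]
  have hc := (KP Y P).p_descOpcycles b (d + 1) (by simp) hb
  refine ⟨((KP Y P).descOpcycles b (d + 1) (by simp) hb).unop (1 : R), ?_⟩
  have := ConcreteCategory.congr_hom (congrArg Quiver.Hom.unop hc) (1 : R)
  refine this.trans ?_
  change (1 : R) • f = f
  exact one_smul _ _

lemma q1_zero {X : ModuleCat.{u} R} (P : ProjectiveResolution X) (w : ((KP Y P).opcycles d).unop) :
    q1 d Y P w = 0 ↔ ∃ g : ((KP Y P).X ((ComplexShape.down ℕ).next d)).unop,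
      ((KP Y P).fromOpcycles d ((ComplexShape.down ℕ).next d)).unop g = w := by
  rw [q1_zero']
  let S : ShortComplex (ModuleCat.{u} R)ᵒᵖ := ShortComplex.mk ((KP Y P).homologyι d)
    ((KP Y P).fromOpcycles d ((ComplexShape.down ℕ).next d)) (by simp)
  have hS : S.Exact := S.exact_of_f_is_kernel ((KP Y P).homologyIsKernel d _ rfl)
  constructor
  · intro h
    exact (ShortComplex.moduleCat_exact_iff _).1 hS.unop w h
  · rintro ⟨g, rfl⟩
    exact ConcreteCategory.congr_hom S.unop.zero g

lemma q1_zero_iff {X : ModuleCat.{u} R} (P : ProjectiveResolution X)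
    (w : ((KP Y P).opcycles d).unop) :
    q1 d Y P w = 0 ↔ ∃ g : P.complex.X ((ComplexShape.down ℕ).next d) ⟶ Y,
      P.complex.d d ((ComplexShape.down ℕ).next d) ≫ g = i1 d Y P w := by
  rw [q1_zero]
  have h := congrArg Quiver.Hom.unop
    ((KP Y P).p_fromOpcycles d ((ComplexShape.down ℕ).next d))
  constructor
  · rintro ⟨g, rfl⟩
    exact ⟨g, (ConcreteCategory.congr_hom h g).symm⟩
  · rintro ⟨g, hg⟩
    refine ⟨g, i1_inj d Y P ?_⟩
    rw [← hg]
    exact ConcreteCategory.congr_hom h g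

lemma q1_nat {X X' : ModuleCat.{u} R} (P : ProjectiveResolution X) (P' : ProjectiveResolution X')
    {φ : X' ⟶ X} (Φ : P'.Hom P φ) (w : ((KP Y P).opcycles d).unop) :
    ∃ w', i1 d Y P' w' = Φ.hom.f d ≫ (show P.complex.X d ⟶ Y from i1 d Y P w) ∧
      q1 d Y P' w' = (((Ext R (ModuleCat.{u} R) d).map φ.op).app Y) (q1 d Y P w) := by
  let Ψ : KP Y P' ⟶ KP Y P := ((Fn Y).mapHomologicalComplex _).map Φ.hom
  refine ⟨(HomologicalComplex.opcyclesMap Ψ d).unop w, ?_, ?_⟩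
  · have h := congrArg Quiver.Hom.unop (HomologicalComplex.p_opcyclesMap Ψ d)
    exact (ConcreteCategory.congr_hom h w)
  · have h1 := congrArg Quiver.Hom.unop (HomologicalComplex.homologyι_naturality Ψ d)
    have h2 := congrArg Quiver.Hom.unop
      (ProjectiveResolution.isoLeftDerivedObj_hom_naturality φ P' P Φ.hom
        Φ.hom_f_zero_comp_π_f_zero (Fn Y) d)
    have e1 := ConcreteCategory.congr_hom h1 w
    have e2 := ConcreteCategory.congr_hom h2 (((KP Y P).homologyι d).unop w)
    refine Eq.trans ?_ e2.symm
    exact congrArg (P'.isoLeftDerivedObj (Fn Y) d).hom.unop e1.symm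

lemma extMk_zero_iff {X : ModuleCat.{u} R} (P : ProjectiveResolution X)
    (f : P.complex.X d ⟶ Y) (hf : P.complex.d (d + 1) d ≫ f = 0) :
    P.extMk f (d + 1) rfl hf = 0 ↔ ∃ g : P.complex.X ((ComplexShape.down ℕ).next d) ⟶ Y,
      P.complex.d d ((ComplexShape.down ℕ).next d) ≫ g = f := by
  rcases d with _ | d
  · simp only [← P.extEquivCohomologyClass.apply_eq_iff_eq,
      ProjectiveResolution.extEquivCohomologyClass_extMk,
      ProjectiveResolution.extEquivCohomologyClass_zero,
      CochainComplex.HomComplex.CohomologyClass.mk_eq_zero_iff]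
    rw [CochainComplex.HomComplex.Cocycle.toSingleMk_mem_coboundaries_iff _ _ _ _ _ 1 (by simp)]
    have hz : Limits.IsZero (P.cochainComplex.X 1) := by
      exact CochainComplex.isZero_of_isStrictlyLE _ 0 1 (by omega)
    constructor
    · rintro ⟨g, hg⟩
      refine ⟨0, ?_⟩
      rw [hz.eq_of_src g 0, Limits.comp_zero] at hg
      rw [Limits.comp_zero, ← cancel_epi (P.cochainComplexXIso (-(0:ℕ)) 0 rfl).hom, ← hg,
        Limits.comp_zero]
    · rintro ⟨g, hg⟩
      refine ⟨0, ?_⟩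
      have : P.complex.d 0 ((ComplexShape.down ℕ).next 0) = 0 := by
        apply P.complex.shape
        simp
      rw [this, Limits.zero_comp] at hg
      rw [← hg]
      simp
  · have : (ComplexShape.down ℕ).next (d + 1) = d := by simp
    rw [this]
    exact P.extMk_eq_zero_iff f (d + 1 + 1) rfl hf d rfl

noncomputable def x1 {X : ModuleCat.{u} R} (P : ProjectiveResolution X) :
    ((KP Y P).opcycles d).unop →ₗ[R] Abelian.Ext X Y d where
  toFun w := P.extMk (show P.complex.X d ⟶ Y from i1 d Y P w) (d + 1) rfl (i1_d d Y P w)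
  map_add' v w := by
    rw [P.add_extMk]
    congr 1
    exact _root_.map_add (i1 d Y P).hom v w
  map_smul' r v := by
    rw [RingHom.id_apply, Abelian.Ext.smul_eq_comp_mk₀, P.extMk_comp_mk₀]
    congr 1
    rw [Linear.comp_smul, Category.comp_id]
    exact _root_.map_smul (i1 d Y P).hom r v

lemma x1_surj {X : ModuleCat.{u} R} (P : ProjectiveResolution X) :
    Function.Surjective (x1 d Y P) := by
  intro e
  obtain ⟨f, hf, rfl⟩ := P.extMk_surjective e (d + 1) rfl
  obtain ⟨w, rfl⟩ := i1_ex d Y P f hf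
  exact ⟨w, rfl⟩

lemma ker_eq {X : ModuleCat.{u} R} (P : ProjectiveResolution X) :
    LinearMap.ker (x1 d Y P) = LinearMap.ker (q1 d Y P).hom := by
  ext w
  exact (extMk_zero_iff d Y P _ (i1_d d Y P w)).trans (q1_zero_iff d Y P w).symm

/-- comparison between the two versions of Ext. -/
noncomputable def eE {X : ModuleCat.{u} R} (P : ProjectiveResolution X) :
    Abelian.Ext X Y d ≃ₗ[R] OE d Y X :=
  ((x1 d Y P).quotKerEquivOfSurjective (x1_surj d Y P)).symm ≪≫ₗ
    Submodule.quotEquivOfEq _ _ (ker_eq d Y P) ≪≫ₗ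
    ((q1 d Y P).hom.quotKerEquivOfSurjective (q1_surj d Y P))

lemma eE_x1 {X : ModuleCat.{u} R} (P : ProjectiveResolution X)
    (w : ((KP Y P).opcycles d).unop) : eE d Y P (x1 d Y P w) = q1 d Y P w := by
  have : ((x1 d Y P).quotKerEquivOfSurjective (x1_surj d Y P)).symm (x1 d Y P w) =
      Submodule.Quotient.mk w := by
    rw [LinearEquiv.symm_apply_eq]
    rfl
  unfold eE
  rw [LinearEquiv.trans_apply, LinearEquiv.trans_apply, this]
  rfl

lemma eE_nat {X X' : ModuleCat.{u} R} (P : ProjectiveResolution X) (P' : ProjectiveResolution X')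
    (φ : X' ⟶ X) (e : Abelian.Ext X Y d) :
    eE d Y P' ((Abelian.Ext.mk₀ φ).comp e (zero_add d)) =
      (((Ext R (ModuleCat.{u} R) d).map φ.op).app Y) (eE d Y P e) := by
  obtain ⟨w, rfl⟩ := x1_surj d Y P e
  let Φ : P'.Hom P φ := ⟨ProjectiveResolution.lift φ P' P,
    ProjectiveResolution.lift_commutes_zero φ P' P⟩
  obtain ⟨w', h1, h2⟩ := q1_nat d Y P P' Φ w
  rw [eE_x1, ← h2, ← eE_x1]
  congr 1
  refine (ProjectiveResolution.mk₀_comp_extMk _ _ rfl (i1_d d Y P w) Φ).trans ?_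
  change P'.extMk _ _ _ _ = P'.extMk _ _ rfl (i1_d d Y P' w')
  congr 1
  exact h1.symm

section LCEquiv
variable (a : Ideal R)
open Limits localCohomology

noncomputable def ePow (n : ℕ) : Abelian.Ext (ModuleCat.of R (R ⧸ a ^ n)) Y d ≃ₗ[R]
    OE d Y (ModuleCat.of R (R ⧸ a ^ n)) :=
  eE d Y (projectiveResolution _)

lemma ePow_pre {n m : ℕ} (h : n ≤ m) (hle : a ^ m ≤ a ^ n)
    (e : Abelian.Ext (ModuleCat.of R (R ⧸ a ^ n)) Y d) :
    ePow d Y a m (pre hle Y d e) =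
      ((diagram (idealPowersDiagram a) d).map (homOfLE h).op.op).app Y (ePow d Y a n e) :=
  eE_nat d Y _ _ _ e

noncomputable def ιc (n : ℕ) : OE d Y (ModuleCat.of R (R ⧸ a ^ n)) ⟶
    (localCohomology a d).obj Y :=
  (colimit.ι (diagram (idealPowersDiagram a) d) (op (op n))).app Y

noncomputable def isC : IsColimit (((evaluation _ _).obj Y).mapCocone
    (colimit.cocone (diagram (idealPowersDiagram a) d))) :=
  isColimitOfPreserves _ (colimit.isColimit _)

noncomputable def toLC : H a d Y →ₗ[R] (localCohomology a d).obj Y :=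
  Module.DirectLimit.lift R ℕ _ (sysMap a Y d)
    (fun n => (ιc d Y a n).hom.comp (ePow d Y a n).toLinearMap) (by
      intro n m h e
      change ιc d Y a m (ePow d Y a m (pre _ Y d e)) = ιc d Y a n (ePow d Y a n e)
      rw [ePow_pre d Y a h]
      have := colimit.w (diagram (idealPowersDiagram a) d) (homOfLE h).op.op
      have := congrArg (fun z => z.app Y) this
      exact ConcreteCategory.congr_hom this _)

lemma toLC_mk (n : ℕ) (e) : toLC d Y a (mk a n e) = ιc d Y a n (ePow d Y a n e) :=
  Module.DirectLimit.lift_of (f := sysMap a Y d) _ _ _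

instance : PreservesColimit (diagram (idealPowersDiagram a) d ⋙ (evaluation _ _).obj Y)
    (forget (ModuleCat.{u} R)) := by
  have := preservesSmallestFilteredColimits_of_preservesFilteredColimits (forget (ModuleCat.{u} R))
  infer_instance

lemma toLC_surj : Function.Surjective (toLC d Y a) := by
  intro x
  obtain ⟨j, y, hy⟩ := Concrete.isColimit_exists_rep _ (isC d Y a) x
  obtain ⟨e, rfl⟩ := (ePow d Y a j.unop.unop).surjective y
  exact ⟨mk a j.unop.unop e, (toLC_mk d Y a _ _).trans hy⟩

lemma toLC_inj : Function.Injective (toLC d Y a) := by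
  rw [injective_iff_map_eq_zero]
  intro h h0
  obtain ⟨n, e, rfl⟩ := mk_surj h
  rw [toLC_mk] at h0
  obtain ⟨j, f, g, hfg⟩ := Concrete.isColimit_exists_of_rep_eq _ (isC d Y a)
    (i := op (op n)) (j := op (op n)) (ePow d Y a n e) 0
      (h0.trans (_root_.map_zero (ιc d Y a n).hom).symm)
  have hn : n ≤ j.unop.unop := leOfHom f.unop.unop
  have hle : a ^ j.unop.unop ≤ a ^ n := Ideal.pow_le_pow_right hn
  rw [← mk_pre hn hle]
  have : pre hle Y d e = 0 := by
    apply (ePow d Y a _).injective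
    rw [ePow_pre d Y a hn, _root_.map_zero]
    refine Eq.trans hfg ?_
    exact _root_.map_zero (((diagram (idealPowersDiagram a) d).map g).app Y).hom
  rw [this, _root_.map_zero]

/-- The comparison isomorphism. -/
noncomputable def lcEquiv : H a d Y ≃ₗ[R] (localCohomology a d).obj Y :=
  LinearEquiv.ofBijective (toLC d Y a) ⟨toLC_inj d Y a, toLC_surj d Y a⟩

end LCEquiv

end LC

end fileE1

section fileLC12

namespace LC

open CategoryTheory.Abelian IsLocalRing
open scoped Pointwise

lemma att_equiv {R : Type u} [CommRing R] {M M' : Type u} [AddCommGroup M] [Module R M]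
    [AddCommGroup M'] [Module R M'] (e : M ≃ₗ[R] M') (p : Ideal R) (h : IsAttachedPrime R M p) :
    IsAttachedPrime R M' p := by
  obtain ⟨hp, N, hN⟩ := h
  refine ⟨hp, N.map e.toLinearMap, hN.trans ?_⟩
  exact (Submodule.Quotient.equiv N (N.map e.toLinearMap) e rfl).annihilator_eq

section fin
variable {R : Type u} [CommRing R] [IsNoetherianRing R] {d : ℕ}

lemma top_ne (hd : ringKrullDim R ≤ (d : WithBot ℕ∞)) (a p : Ideal R)
    (h : IsAttachedPrime R (H a d (ModuleCat.of R R)) p) :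
    ¬ ∀ h : H a d (ModuleCat.of R (R ⧸ p)), h = 0 := by
  obtain ⟨hp, N, hN⟩ := h
  intro h0
  have hpN : ∀ r ∈ p, ∀ h : H a d (ModuleCat.of R R), r • h ∈ N := by
    intro r hr h
    rw [hN, Module.mem_annihilator] at hr
    have := hr (Submodule.Quotient.mk h)
    rwa [← Submodule.Quotient.mk_smul, Submodule.Quotient.mk_eq_zero] at this
  have hall : ∀ h : H a d (ModuleCat.of R R), h ∈ N := by
    intro h
    obtain ⟨h', rfl⟩ := exact₂ (qsc_exact (M := R) p) a (h := h) (h0 _)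
    obtain ⟨n, f, hf⟩ := Module.Finite.exists_fin' R p
    obtain ⟨h'', rfl⟩ := mp_surj hd a f hf h'
    have h1 : mp a d (p.subtype) (mp a d f h'') ∈ N := by
      rw [mp_mp]
      have h2 : p.subtype ∘ₗ f = ∑ j, ((f (Pi.single j 1) : p) : R) •
          (LinearMap.proj j : (Fin n → R) →ₗ[R] R) := by
        apply LinearMap.pi_ext'
        intro i
        ext
        simp [LinearMap.sum_apply, Pi.single_apply]
      rw [h2, mp_sum]
      refine Submodule.sum_mem _ fun j _ => ?_
      rw [mp_smul]
      exact hpN _ (f (Pi.single j 1)).2 _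
    exact h1
  apply hp.ne_top
  rw [hN, Ideal.eq_top_iff_one, Module.mem_annihilator]
  intro x
  obtain ⟨x, rfl⟩ := Submodule.Quotient.mk_surjective _ x
  rw [one_smul]
  exact (Submodule.Quotient.mk_eq_zero _).2 (hall x)

lemma att_min (hd : ringKrullDim R ≤ (d : WithBot ℕ∞)) (a p : Ideal R)
    (h : IsAttachedPrime R (H a d (ModuleCat.of R R)) p) : p ∈ associatedPrimes R R := by
  have hp := h.1
  have hdp : (d : WithBot ℕ∞) ≤ ringKrullDim (R ⧸ p) := by
    by_contra hlt
    apply top_ne hd a p h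
    intro h
    refine H_eq_zero_of_dim _ _ (R ⧸ p) ?_ h
    rw [Module.supportDim_quotient_eq_ringKrullDim]
    exact not_le.1 hlt
  apply Module.associatedPrimes.minimalPrimes_annihilator_subset_associatedPrimes
  refine ⟨⟨hp, ?_⟩, fun q hq hqp => ?_⟩
  · intro r hr
    have h1 := Module.mem_annihilator.1 hr (1 : R)
    rw [smul_eq_mul, mul_one] at h1
    rw [h1]
    exact p.zero_mem
  · have := hq.1
    exact prime_min hd p hdp q hqp

lemma ass_att (a p : Ideal R)
    (hann : ∀ r : R, (∀ h : H a d (ModuleCat.of R R), r • h = 0) → r = 0)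
    (h : p ∈ associatedPrimes R R) : IsAttachedPrime R (H a d (ModuleCat.of R R)) p := by
  obtain ⟨hp, y, hy⟩ := ass_iff.1 h
  refine ⟨hp, p • ⊤, le_antisymm ?_ ?_⟩
  · intro r hr
    rw [Module.mem_annihilator]
    intro x
    obtain ⟨x, rfl⟩ := Submodule.Quotient.mk_surjective _ x
    rw [← Submodule.Quotient.mk_smul, Submodule.Quotient.mk_eq_zero]
    exact Submodule.smul_mem_smul hr trivial
  · intro r hr
    rw [hy, smul_eq_mul]
    apply hann
    intro x
    have h1 := Module.mem_annihilator.1 hr (Submodule.Quotient.mk x)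
    rw [← Submodule.Quotient.mk_smul, Submodule.Quotient.mk_eq_zero] at h1
    rw [mul_comm, mul_smul]
    have h2 : (p • ⊤ : Submodule R (H a d (ModuleCat.of R R))) ≤
        LinearMap.ker (LinearMap.lsmul R (H a d (ModuleCat.of R R)) y) := by
      rw [Submodule.smul_le]
      intro s hs n _
      rw [LinearMap.mem_ker, LinearMap.lsmul_apply, smul_smul, mul_comm]
      have h3 := (hy s).1 hs
      rw [smul_eq_mul] at h3
      rw [h3, zero_smul]
    exact h2 h1

variable [IsLocalRing R]

lemma main_back (hd : ringKrullDim R ≤ (d : WithBot ℕ∞)) (a : Ideal R)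
    (hA : ∀ p ∈ associatedPrimes R R, IsAttachedPrime R (H a d (ModuleCat.of R R)) p)
    (y : R) (hy : ∀ h : H a d (ModuleCat.of R R), y • h = 0) : y = 0 := by
  by_contra hy0
  -- associated prime of `R y`
  have hnt : Nontrivial (Ideal.span {y}) := by
    refine ⟨⟨⟨y, Ideal.mem_span_singleton_self y⟩, 0, fun h => hy0 (congrArg Subtype.val h)⟩⟩
  obtain ⟨p, hp⟩ := associatedPrimes.nonempty R (Ideal.span {y})
  have hpR : p ∈ associatedPrimes R R :=
    associatedPrimes.subset_of_injective (Ideal.span {y}).injective_subtype hp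
  obtain ⟨-, ⟨z, hz⟩, hzp⟩ := ass_iff.1 hp
  obtain ⟨c, rfl⟩ := Ideal.mem_span_singleton'.1 hz
  have hcy : ∀ r, r * (c * y) = 0 ↔ r ∈ p := by
    intro r
    rw [hzp r]
    exact ⟨fun h => Subtype.ext h, fun h => congrArg Subtype.val h⟩
  have hatt := hA p hpR
  by_cases ha : a ≤ maximalIdeal R
  · obtain ⟨L, hlen, hL, N, hN⟩ := exists_gens a ha d hd
    subst hlen
    have hE : Elim L (c * y) R := (H_elim L hL N hN R (c * y)).1 (fun h => by
      rw [mul_smul, hy, smul_zero])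
    have hX := thmX L (fun x hx => ha (hL x hx)) hd p (c * y) hcy hE
    apply top_ne hd a p hatt
    intro h
    have := (H_elim L hL N hN (R ⧸ p) 1).2 hX h
    rwa [one_smul] at this
  · have htop : a = ⊤ := by
      by_contra h
      exact ha (le_maximalIdeal h)
    subst htop
    apply top_ne hd ⊤ p hatt
    intro h
    obtain ⟨n, hn⟩ := H_torsion ⊤ h
    have := hn 1 (by rw [Ideal.top_pow]; trivial)
    rwa [one_smul] at this

end fin
end LC

end fileLC12

/-- If `(R, 𝔪)` is local of dimension `d` and `𝔞` an ideal, then `Ann_R(H^d_𝔞(R)) = 0` iff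
`Ass_R R = Att_R(H^d_𝔞(R))`. -/
theorem stmt_19 {R : Type u} [CommRing R] [IsNoetherianRing R] [IsLocalRing R] (𝔞 : Ideal R)
    (d : ℕ) (hd : ringKrullDim R = (d : WithBot ℕ∞)) :
    Module.annihilator R ((localCohomology 𝔞 d).obj (ModuleCat.of R R)) = ⊥ ↔
      associatedPrimes R R =
        {p : Ideal R | IsAttachedPrime R ((localCohomology 𝔞 d).obj (ModuleCat.of R R)) p} := by
  have e := LC.lcEquiv d (ModuleCat.of R R) 𝔞
  rw [← e.annihilator_eq]
  constructor
  · intro h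
    have hann : ∀ r : R, (∀ h : LC.H 𝔞 d (ModuleCat.of R R), r • h = 0) → r = 0 := by
      intro r hr
      have h1 : r ∈ Module.annihilator R (LC.H 𝔞 d (ModuleCat.of R R)) := Module.mem_annihilator.2 hr
      rw [h] at h1
      exact h1
    ext p
    constructor
    · intro hp
      exact LC.att_equiv e p (LC.ass_att 𝔞 p hann hp)
    · intro hp
      exact LC.att_min hd.le 𝔞 p (LC.att_equiv e.symm p hp)
  · intro h
    rw [eq_bot_iff]
    intro y hy
    refine LC.main_back hd.le 𝔞 (fun p hp => ?_) y (Module.mem_annihilator.1 hy)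
    rw [h] at hp
    exact LC.att_equiv e.symm p hp
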